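/- Let T be a Calderón–Zygmund operator on ℝⁿ with standard kernel K of smoothness exponent δ∈(0,1], let T** be its maximal truncated operator, and let D be a dyadic grid. Then for every measurable function f on ℝⁿ and every cube Q₀∈D there exists a sparse family S⊆D such that for almost every x∈Q₀: |T**f(x) − m_{Q₀}(T**f)| ≤ C·(Mf(x) + Σ_{m=0}^∞ 2^{−mδ}·T_{S,m}|f|(x)), where C depends only on T and n. -/

import Mathlib

open MeasureTheory Set Filter
open scoped ENNReal NNReal Topology

noncomputable section

namespace SparseCZ

/-- Euclidean space `ℝⁿ`. -/
abbrev Rn (n : ℕ) := EuclideanSpace ℝ (Fin n)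

/-- An axis-parallel (half-open) cube in `ℝⁿ`, recorded by its lower corner and sidelength. -/
structure Cube (n : ℕ) where
  corner : Fin n → ℝ
  side : ℝ
  side_pos : 0 < side

namespace Cube

variable {n : ℕ}

/-- The set of points of a cube. -/
def toSet (Q : Cube n) : Set (Rn n) :=
  {x | ∀ i, Q.corner i ≤ x i ∧ x i < Q.corner i + Q.side}

/-- `2^m Q`: the cube concentric with `Q` of sidelength `2^m · ℓ_Q`. -/
def dilatePow (Q : Cube n) (m : ℕ) : Cube n where
  corner := fun i => Q.corner i + Q.side / 2 - 2 ^ m * Q.side / 2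
  side := 2 ^ m * Q.side
  side_pos := by have := Q.side_pos; positivity

end Cube

variable {n : ℕ}

/-- A dyadic grid in `ℝⁿ`: cubes of sidelengths `2^k`, pairwise intersections are one of the two
cubes or empty, and the cubes of each fixed sidelength partition `ℝⁿ`. -/
def IsDyadicGrid (D : Set (Cube n)) : Prop :=
  (∀ Q ∈ D, ∃ k : ℤ, Q.side = 2 ^ k) ∧
  (∀ Q ∈ D, ∀ R ∈ D,
    Q.toSet ∩ R.toSet = Q.toSet ∨ Q.toSet ∩ R.toSet = R.toSet ∨ Q.toSet ∩ R.toSet = ∅) ∧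
  (∀ k : ℤ, ∀ x : Rn n, ∃! Q : Cube n, Q ∈ D ∧ Q.side = 2 ^ k ∧ x ∈ Q.toSet)

/-- A sparse family of cubes. -/
def IsSparse (S : Set (Cube n)) : Prop :=
  ∀ Q ∈ S, volume (⋃ P ∈ {P | P ∈ S ∧ P.toSet ⊂ Q.toSet}, Cube.toSet P) ≤ volume Q.toSet / 2

/-- Average `|s|⁻¹ ∫_s f` of an `ℝ≥0∞`-valued function. -/
def avgE (s : Set (Rn n)) (f : Rn n → ℝ≥0∞) : ℝ≥0∞ :=
  (volume s)⁻¹ * ∫⁻ x in s, f x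

/-- The Hardy–Littlewood maximal operator over (axis-parallel) cubes. -/
def hlMax (f : Rn n → ℝ≥0∞) (x : Rn n) : ℝ≥0∞ :=
  ⨆ (Q : Cube n) (_ : x ∈ Q.toSet), avgE Q.toSet f

/-- Sparse operator `A_{D,S} f = Σ_{Q∈S} f_Q χ_Q`. -/
def sparseOp (S : Set (Cube n)) (f : Rn n → ℝ≥0∞) (x : Rn n) : ℝ≥0∞ :=
  ∑' Q : S, Set.indicator (Q.1.toSet) (fun _ => avgE Q.1.toSet f) x

/-- Shifted sparse operator `T_{S,m} f = Σ_{Q∈S} f_{2^m Q} χ_Q`. -/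
def sparseOpShift (S : Set (Cube n)) (m : ℕ) (f : Rn n → ℝ≥0∞) (x : Rn n) : ℝ≥0∞ :=
  ∑' Q : S, Set.indicator (Q.1.toSet) (fun _ => avgE (Q.1.dilatePow m).toSet f) x

/-- The median `m_Q(g)` of a function over a cube. -/
def median (g : Rn n → ℝ) (Q : Cube n) : ℝ :=
  sSup {l : ℝ | volume {x ∈ Q.toSet | l < g x} ≤ volume Q.toSet / 2 ∧
                volume {x ∈ Q.toSet | g x < l} ≤ volume Q.toSet / 2}

/-- A weight: a positive, measurable, locally integrable function. -/
def IsWeight (w : Rn n → ℝ) : Prop :=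
  Measurable w ∧ (∀ x, 0 < w x) ∧ LocallyIntegrable w volume

/-- `w(s) = ∫_s w`. -/
def wInt (w : Rn n → ℝ) (s : Set (Rn n)) : ℝ≥0∞ :=
  ∫⁻ x in s, ENNReal.ofReal (w x)

/-- The measure `w·dx`. -/
def wMeasure (w : Rn n → ℝ) : Measure (Rn n) :=
  volume.withDensity fun x => ENNReal.ofReal (w x)

/-- The Muckenhoupt `A_p` characteristic `[w]_{A_p}`. -/
def ApConst (n : ℕ) (p : ℝ) (w : Rn n → ℝ) : ℝ≥0∞ :=
  ⨆ Q : Cube n,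
    avgE Q.toSet (fun x => ENNReal.ofReal (w x)) *
      (avgE Q.toSet fun x => ENNReal.ofReal (w x ^ (1 - p / (p - 1)))) ^ (p - 1)

/-- The Fujii–Wilson `A_∞` characteristic `[w]_{A_∞}`. -/
def AinftyConst (n : ℕ) (w : Rn n → ℝ) : ℝ≥0∞ :=
  ⨆ Q : Cube n,
    (wInt w Q.toSet)⁻¹ *
      ∫⁻ x in Q.toSet, hlMax (fun y => ENNReal.ofReal (Set.indicator Q.toSet w y)) x

/-- The weighted dyadic maximal operator `M^D_w`. -/
def dyadicMaxW (D : Set (Cube n)) (w : Rn n → ℝ) (f : Rn n → ℝ≥0∞) (x : Rn n) : ℝ≥0∞ :=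
  ⨆ (Q : Cube n) (_ : Q ∈ D) (_ : x ∈ Q.toSet),
    (wInt w Q.toSet)⁻¹ * ∫⁻ y in Q.toSet, f y * ENNReal.ofReal (w y)

/-- A Calderón–Zygmund operator `T` with standard kernel `K` (constant `c`, smoothness `δ`). -/
structure IsCZO (n : ℕ) (T : (Rn n → ℝ) → Rn n → ℝ)
    (K : Rn n → Rn n → ℝ) (c δ : ℝ) : Prop where
  c_pos : 0 < c
  delta_pos : 0 < δ
  delta_le_one : δ ≤ 1
  size : ∀ x y, x ≠ y → |K x y| ≤ c / dist x y ^ n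
  smooth : ∀ x x' y : Rn n, x ≠ y → dist x x' ≤ dist x y / 2 →
    |K x y - K x' y| + |K y x - K y x'| ≤ c * dist x x' ^ δ / dist x y ^ ((n : ℝ) + δ)
  linear : IsLinearMap ℝ T
  l2_bounded : ∃ A : ℝ≥0∞, A ≠ ⊤ ∧ ∀ f, eLpNorm (T f) 2 volume ≤ A * eLpNorm f 2 volume
  repr : ∀ f : Rn n → ℝ, Integrable f volume → ∀ x ∉ tsupport f, T f x = ∫ y, K x y * f y

/-- The maximal truncated operator `T**` associated with a kernel `K`. -/
def maxTrunc (K : Rn n → Rn n → ℝ) (f : Rn n → ℝ) (x : Rn n) : ℝ :=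
  ⨆ e : {e : ℝ × ℝ // 0 < e.1 ∧ e.1 < e.2},
    |∫ y in {y | e.1.1 < dist x y ∧ dist x y < e.1.2}, K x y * f y|

/-- The `L¹ → L^{1,∞}` operator (quasi-)norm `sup {λ·|{|Uf|>λ}| : λ>0, ‖f‖₁ ≤ 1}`. -/
def weakNorm11 (U : (Rn n → ℝ) → Rn n → ℝ) : ℝ≥0∞ :=
  ⨆ (f : Rn n → ℝ) (_ : eLpNorm f 1 volume ≤ 1) (l : {l : ℝ // 0 < l}),
    ENNReal.ofReal l.1 * volume {x | l.1 < |U f x|}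

/-- A Banach function space over `(ℝⁿ, dx)` (rearrangement invariance not required),
described by its function norm `ρ` acting on nonnegative (`ℝ≥0∞`-valued) functions. -/
structure BFS (n : ℕ) where
  ρ : (Rn n → ℝ≥0∞) → ℝ≥0∞
  zero_iff : ∀ f, ρ f = 0 ↔ f =ᵐ[volume] 0
  add_le : ∀ f g, ρ (fun x => f x + g x) ≤ ρ f + ρ g
  smul_eq : ∀ (a : ℝ≥0) (f), ρ (fun x => (a : ℝ≥0∞) * f x) = a * ρ f
  mono : ∀ f g, f ≤ᵐ[volume] g → ρ f ≤ ρ g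
  fatou : ∀ f : ℕ → Rn n → ℝ≥0∞, Monotone f → ρ (fun x => ⨆ k, f k x) = ⨆ k, ρ (f k)
  indicator_lt_top : ∀ E : Set (Rn n), MeasurableSet E → volume E < ⊤ → ρ (E.indicator 1) < ⊤
  setIntegral_le : ∀ E : Set (Rn n), MeasurableSet E → volume E < ⊤ →
    ∃ C : ℝ≥0∞, C ≠ ⊤ ∧ ∀ f, ∫⁻ x in E, f x ≤ C * ρ f

/-- The decreasing rearrangement of `f` with respect to the measure `μ`. -/
def rearr {α : Type*} [MeasurableSpace α] (μ : Measure α) (f : α → ℝ≥0∞) (t : ℝ) : ℝ≥0∞ :=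
  sInf {l : ℝ≥0∞ | μ {x | l < f x} ≤ ENNReal.ofReal t}

/-- Lebesgue measure on `(0,∞)`. -/
def lebPos : Measure ℝ := volume.restrict (Set.Ioi 0)

/-- A rearrangement invariant quasi-Banach function space, given (via the Luxemburg
representation) by its function quasi-norm `ρ` over `(ℝ⁺, dt)`; the (weighted) norm of a
function on `ℝⁿ` is `ρ` applied to its decreasing rearrangement. -/
structure RIQBFS where
  ρ : (ℝ → ℝ≥0∞) → ℝ≥0∞
  quasi_triangle : ∃ Cq : ℝ≥0∞, 1 ≤ Cq ∧ Cq ≠ ⊤ ∧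
    ∀ f g, ρ (fun t => f t + g t) ≤ Cq * (ρ f + ρ g)
  smul_eq : ∀ (a : ℝ≥0) (f), ρ (fun t => (a : ℝ≥0∞) * f t) = a * ρ f
  zero_iff : ∀ f, ρ f = 0 ↔ f =ᵐ[lebPos] 0
  mono : ∀ f g, f ≤ᵐ[lebPos] g → ρ f ≤ ρ g
  fatou : ∀ f : ℕ → ℝ → ℝ≥0∞, Monotone f → ρ (fun t => ⨆ k, f k t) = ⨆ k, ρ (f k)
  rearr_invariant : ∀ f g,
    (∀ l : ℝ≥0∞, lebPos {t | l < f t} = lebPos {t | l < g t}) → ρ f = ρ g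

namespace RIQBFS

/-- The norm of `X(w)`: `‖f‖_{X(w)} = ρ(f*_w)`. -/
def normW (X : RIQBFS) {n : ℕ} (w : Rn n → ℝ) (f : Rn n → ℝ≥0∞) : ℝ≥0∞ :=
  X.ρ (rearr (wMeasure w) f)

/-- The (unweighted) norm of `X`: `‖f‖_X = ρ(f*)`. -/
def normV (X : RIQBFS) {n : ℕ} (f : Rn n → ℝ≥0∞) : ℝ≥0∞ :=
  X.ρ (rearr (volume : Measure (Rn n)) f)

/-- `h_X(t)`: the operator norm of the dilation `D_t f(s) = f(s/t)` on `X̄`. -/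
def dilNorm (X : RIQBFS) (t : ℝ) : ℝ≥0∞ :=
  ⨆ (f : ℝ → ℝ≥0∞) (_ : X.ρ f ≤ 1), X.ρ fun s => f (s / t)

/-- The lower Boyd index `p_X = sup_{1<t<∞} log t / log h_X(t)`. -/
def boydLower (X : RIQBFS) : ℝ :=
  ⨆ t : {t : ℝ // 1 < t}, Real.log t.1 / Real.log (X.dilNorm t.1).toReal

/-- The upper Boyd index `q_X = inf_{0<t<1} log t / log h_X(t)`. -/
def boydUpper (X : RIQBFS) : ℝ :=
  ⨅ t : {t : ℝ // 0 < t ∧ t < 1}, Real.log t.1 / Real.log (X.dilNorm t.1).toReal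

/-- `p`-convexity of `X` (as a space of functions on `ℝⁿ`). -/
def pConvex (X : RIQBFS) (n : ℕ) (p : ℝ) : Prop :=
  ∃ C : ℝ≥0∞, C ≠ ⊤ ∧ ∀ (N : ℕ) (f : Fin N → Rn n → ℝ≥0∞),
    X.normV (fun x : Rn n => (∑ j, f j x ^ p) ^ (1 / p)) ≤
      C * (∑ j, X.normV (f j) ^ p) ^ (1 / p)

end RIQBFS

/-- A rearrangement invariant Banach function space: an RIQBFS whose quasi-norm is an actual
norm satisfying the Banach function space axioms. -/
structure RIBFS extends RIQBFS where
  add_le : ∀ f g, ρ (fun t => f t + g t) ≤ ρ f + ρ g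
  indicator_lt_top : ∀ E : Set ℝ, MeasurableSet E → lebPos E < ⊤ → ρ (E.indicator 1) < ⊤
  setIntegral_le : ∀ E : Set ℝ, MeasurableSet E → lebPos E < ⊤ →
    ∃ C : ℝ≥0∞, C ≠ ⊤ ∧ ∀ f, ∫⁻ t in E, f t ∂lebPos ≤ C * ρ f

/-- The class `Φ`: nonnegative increasing functions on `[0,∞)` with `φ(0⁺)=0`, `φ(∞)=∞`. -/
def PhiClass (φ : ℝ → ℝ) : Prop :=
  (∀ ⦃s t : ℝ⦄, 0 ≤ s → s ≤ t → φ s ≤ φ t) ∧ (∀ t, 0 ≤ t → 0 ≤ φ t) ∧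
  Tendsto φ (nhdsWithin 0 (Set.Ioi 0)) (nhds 0) ∧ Tendsto φ atTop atTop

/-- Quasi-convexity: `ψ(t) ≤ φ(t) ≤ a·ψ(a·t)` for some convex `ψ` and `a ≥ 1`. -/
def QuasiConvexPhi (φ : ℝ → ℝ) : Prop :=
  ∃ (ψ : ℝ → ℝ) (a : ℝ), 1 ≤ a ∧ ConvexOn ℝ (Set.Ici 0) ψ ∧
    ∀ t, 0 ≤ t → ψ t ≤ φ t ∧ φ t ≤ a * ψ (a * t)

/-- `h_φ(t) = sup_{s>0} φ(st)/φ(s)`. -/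
def hphi (φ : ℝ → ℝ) (t : ℝ) : ℝ :=
  ⨆ s : {s : ℝ // 0 < s}, φ (s.1 * t) / φ s.1

/-- The lower dilation index `i_φ = sup_{0<t<1} log h_φ(t)/log t`. -/
def iphi (φ : ℝ → ℝ) : ℝ :=
  ⨆ t : {t : ℝ // 0 < t ∧ t < 1}, Real.log (hphi φ t.1) / Real.log t.1

/-- The upper dilation index `I_φ = inf_{1<t} log h_φ(t)/log t`. -/
def IphiUpper (φ : ℝ → ℝ) : ℝ :=
  ⨅ t : {t : ℝ // 1 < t}, Real.log (hphi φ t.1) / Real.log t.1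

/-- An `N`-function. -/
def IsNFunction (φ : ℝ → ℝ) : Prop :=
  ConvexOn ℝ (Set.Ici 0) φ ∧ (∀ ⦃s t : ℝ⦄, 0 ≤ s → s ≤ t → φ s ≤ φ t) ∧
  (∀ t, 0 ≤ t → 0 ≤ φ t) ∧ φ 0 = 0 ∧
  Tendsto (fun t => φ t / t) (nhdsWithin 0 (Set.Ioi 0)) (nhds 0) ∧
  Tendsto (fun t => φ t / t) atTop atTop

/-- The complementary (Young conjugate) function `φ̄(s) = sup_{t>0} (st − φ(t))`. -/
def complementary (φ : ℝ → ℝ) (s : ℝ) : ℝ :=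
  ⨆ t : {t : ℝ // 0 < t}, (s * t.1 - φ t.1)

/-- The modular `ρ_w^φ(g) = ∫ φ(g(x)) w(x) dx` for a nonnegative (`ℝ≥0∞`-valued) `g`. -/
def modularE (φ : ℝ → ℝ) (w : Rn n → ℝ) (g : Rn n → ℝ≥0∞) : ℝ≥0∞ :=
  ∫⁻ x, ENNReal.ofReal (φ (g x).toReal) * ENNReal.ofReal (w x)

end SparseCZ

namespace SparseCZ

open Metric

/-! ### Geometry -/

lemma dist_le_of_coord {n : ℕ} {x y : Rn n} {a : ℝ} (ha : 0 ≤ a)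
    (h : ∀ i, |x i - y i| ≤ a) : dist x y ≤ n * a := by
  rw [EuclideanSpace.dist_eq]
  apply Real.sqrt_le_iff.2
  refine ⟨by positivity, ?_⟩
  calc ∑ i, dist (x i) (y i) ^ 2 ≤ ∑ _i : Fin n, a ^ 2 := by
        apply Finset.sum_le_sum
        intro i _
        rw [Real.dist_eq]
        exact pow_le_pow_left₀ (abs_nonneg _) (h i) 2
    _ = n * a ^ 2 := by simp
    _ ≤ (n * a) ^ 2 := by
        rw [mul_pow]
        have : (n : ℝ) ≤ (n : ℝ) ^ 2 := by
          exact_mod_cast Nat.le_self_pow (by norm_num) n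
        exact mul_le_mul_of_nonneg_right this (by positivity)

lemma coord_le_dist {n : ℕ} (x y : Rn n) (i : Fin n) : |x i - y i| ≤ dist x y := by
  rw [dist_eq_norm]
  have := PiLp.norm_apply_le (x - y) i
  simpa using this

namespace Cube
variable {n : ℕ}

/-- The lower corner as a point. -/
def pt (Q : Cube n) : Rn n := WithLp.toLp 2 Q.corner

lemma pt_mem (Q : Cube n) : Q.pt ∈ Q.toSet := by
  intro i
  have := Q.side_pos
  simp [pt, this]

lemma toSet_eq (Q : Cube n) : Q.toSet =
    (WithLp.ofLp : Rn n → (Fin n → ℝ)) ⁻¹' (Set.pi univ fun i => Ico (Q.corner i) (Q.corner i + Q.side)) := by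
  ext x; simp [toSet, Set.mem_pi]

lemma measurableSet (Q : Cube n) : MeasurableSet Q.toSet := by
  rw [toSet_eq]
  exact (PiLp.volume_preserving_ofLp (Fin n)).measurable
    (MeasurableSet.univ_pi fun i => measurableSet_Ico)

lemma volume_eq (Q : Cube n) : volume Q.toSet = ENNReal.ofReal (Q.side ^ n) := by
  rw [toSet_eq, (PiLp.volume_preserving_ofLp (Fin n)).measure_preimage
    (MeasurableSet.univ_pi fun i => measurableSet_Ico).nullMeasurableSet, Real.volume_pi_Ico]
  simp [ENNReal.ofReal_pow Q.side_pos.le]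

lemma volume_pos (Q : Cube n) : 0 < volume Q.toSet := by
  rw [volume_eq]; have := Q.side_pos; exact ENNReal.ofReal_pos.2 (by positivity)

lemma volume_ne_zero (Q : Cube n) : volume Q.toSet ≠ 0 := Q.volume_pos.ne'

lemma volume_ne_top (Q : Cube n) : volume Q.toSet ≠ ∞ := by
  rw [volume_eq]; exact ENNReal.ofReal_ne_top

lemma dist_le (Q : Cube n) {x y : Rn n} (hx : x ∈ Q.toSet) (hy : y ∈ Q.toSet) :
    dist x y ≤ n * Q.side := by
  apply dist_le_of_coord Q.side_pos.le
  intro i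
  have h1 := hx i
  have h2 := hy i
  rw [abs_le]; constructor <;> linarith

lemma ball_subset_dilate (Q : Cube n) (m : ℕ) {x y : Rn n} (hx : x ∈ Q.toSet)
    (h : dist x y < (2 ^ m - 1) / 2 * Q.side) : y ∈ (Q.dilatePow m).toSet := by
  intro i
  have h1 := hx i
  have h2 := (coord_le_dist x y i).trans_lt h
  rw [abs_lt] at h2
  simp only [dilatePow]
  constructor <;> nlinarith

lemma dilate_volume (Q : Cube n) (m : ℕ) :
    volume (Q.dilatePow m).toSet = 2 ^ (m * n) * volume Q.toSet := by
  rw [volume_eq, volume_eq]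
  simp only [dilatePow]
  rw [mul_pow, ENNReal.ofReal_mul (by positivity), ← pow_mul, ENNReal.ofReal_pow (by norm_num)]
  simp

lemma interior_nonempty (Q : Cube n) : (interior Q.toSet).Nonempty := by
  have hs := Q.side_pos
  refine ⟨WithLp.toLp 2 (fun i => Q.corner i + Q.side / 2), ?_⟩
  rw [mem_interior]
  refine ⟨Metric.ball (WithLp.toLp 2 (fun i => Q.corner i + Q.side / 2)) (Q.side / 2), ?_, Metric.isOpen_ball, by
    simp [hs]⟩
  intro x hx i
  rw [Metric.mem_ball] at hx
  have h2 := (coord_le_dist _ _ i).trans_lt hx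
  rw [abs_lt] at h2
  simp only at h2
  constructor <;> linarith

end Cube

/-! ### The centered maximal function -/

/-- volume of the unit ball -/
def vB (n : ℕ) : ℝ≥0∞ := volume (closedBall (0 : Rn n) 1)

lemma vB_pos (n : ℕ) : vB n ≠ 0 := by
  unfold vB
  exact (measure_closedBall_pos volume _ one_pos).ne'

lemma vB_top (n : ℕ) : vB n ≠ ∞ := measure_closedBall_lt_top.ne

lemma vol_cball {n : ℕ} (x : Rn n) {r : ℝ} (hr : 0 ≤ r) :
    volume (closedBall x r) = ENNReal.ofReal (r ^ n) * vB n := by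
  rw [Measure.addHaar_closedBall' volume x hr]
  simp [vB]

variable {n : ℕ}

/-- centered maximal function -/
def Mc (h : Rn n → ℝ≥0∞) (x : Rn n) : ℝ≥0∞ :=
  ⨆ (r : ℝ) (_ : 0 < r), (volume (closedBall x r))⁻¹ * ∫⁻ y in closedBall x r, h y

lemma lint_le_Mc (h : Rn n → ℝ≥0∞) (x : Rn n) {r : ℝ} (hr : 0 < r) :
    ∫⁻ y in closedBall x r, h y ≤ volume (closedBall x r) * Mc h x := by
  have h1 : (volume (closedBall x r))⁻¹ * ∫⁻ y in closedBall x r, h y ≤ Mc h x :=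
    le_iSup₂_of_le r hr le_rfl
  have hp := (measure_closedBall_pos volume x hr).ne'
  have ht : volume (closedBall x r) ≠ ∞ := measure_closedBall_lt_top.ne
  calc ∫⁻ y in closedBall x r, h y = volume (closedBall x r) * ((volume (closedBall x r))⁻¹ * ∫⁻ y in closedBall x r, h y) := by
        rw [← mul_assoc, ENNReal.mul_inv_cancel hp ht, one_mul]
    _ ≤ _ := by gcongr

lemma Mc_one_le (x : Rn n) : Mc (fun _ => 1) x ≤ 1 := by
  refine iSup₂_le fun r hr => ?_
  simp only [lintegral_const, Measure.restrict_apply MeasurableSet.univ, univ_inter, one_mul]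
  exact ENNReal.inv_mul_le_one _

/-- weak type (1,1) for the maximal function. -/
lemma Mc_weak [NeZero n] (h : Rn n → ℝ≥0∞) (lam : ℝ≥0∞) :
    lam * volume {x | lam < Mc h x} ≤ 5 ^ n * ∫⁻ y, h y := by
  by_cases hI : ∫⁻ y, h y = ∞
  · rw [hI, ENNReal.mul_top (by positivity)]; exact le_top
  by_cases hl : lam = 0
  · simp [hl]
  by_cases hlt : lam = ∞
  · simp [hlt]
  have hn : n ≠ 0 := NeZero.ne n
  set E := {x | lam < Mc h x} with hE
  have hr : ∀ x : Rn n, ∃ r : ℝ, x ∈ E → 0 < r ∧ lam * volume (closedBall x r) ≤ ∫⁻ y in closedBall x r, h y := by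
    intro x
    by_cases hx : x ∈ E
    · have hx' : lam < Mc h x := hx
      simp only [Mc, lt_iSup_iff] at hx'
      obtain ⟨r, hr, h1⟩ := hx'
      refine ⟨r, fun _ => ⟨hr, ?_⟩⟩
      have hp := (measure_closedBall_pos volume x hr).ne'
      have ht : volume (closedBall x r) ≠ ∞ := measure_closedBall_lt_top.ne
      calc lam * volume (closedBall x r) ≤ ((volume (closedBall x r))⁻¹ * ∫⁻ y in closedBall x r, h y) * volume (closedBall x r) := by gcongr
        _ = (volume (closedBall x r) * (volume (closedBall x r))⁻¹) * ∫⁻ y in closedBall x r, h y := by ring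
        _ = _ := by rw [ENNReal.mul_inv_cancel hp ht, one_mul]
    · exact ⟨0, fun h => absurd h hx⟩
  choose r hr using hr
  -- bounded radii
  set B := (∫⁻ y, h y) / (lam * vB n) with hB
  have hBt : B ≠ ∞ := ENNReal.div_ne_top hI (mul_ne_zero hl (vB_pos n))
  have hR : ∀ a ∈ E, r a ≤ max 1 B.toReal := by
    intro a ha
    obtain ⟨h0, h1⟩ := hr a ha
    rw [vol_cball a h0.le] at h1
    have h2 : ENNReal.ofReal (r a ^ n) ≤ B := by
      rw [hB, ENNReal.le_div_iff_mul_le (Or.inl (mul_ne_zero hl (vB_pos n))) (Or.inl (ENNReal.mul_ne_top hlt (vB_top n)))]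
      calc _ = lam * (ENNReal.ofReal (r a ^ n) * vB n) := by ring
        _ ≤ _ := h1.trans (setLIntegral_le_lintegral _ _)
    have h3 : r a ^ n ≤ B.toReal := (ENNReal.ofReal_le_iff_le_toReal hBt).1 h2
    by_cases h4 : r a ≤ 1
    · exact h4.trans (le_max_left _ _)
    · push Not at h4
      exact ((le_self_pow₀ h4.le hn).trans h3).trans (le_max_right _ _)
  obtain ⟨u, hu, hd, hc⟩ := Vitali.exists_disjoint_subfamily_covering_enlargement_closedBall E
    (fun x => x) r _ hR 5 (by norm_num)
  have huc : u.Countable := by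
    apply hd.countable_of_nonempty_interior
    intro i hi
    exact ⟨i, mem_interior.2 ⟨ball i (r i), ball_subset_closedBall, isOpen_ball, mem_ball_self (hr i (hu hi)).1⟩⟩
  have hsub : E ⊆ ⋃ b ∈ u, closedBall b (5 * r b) := by
    intro x hx
    obtain ⟨b, hb, hh⟩ := hc x hx
    exact mem_biUnion hb (hh (mem_closedBall_self (hr x hx).1.le))
  calc lam * volume E ≤ lam * ∑' b : u, volume (closedBall (b : Rn n) (5 * r b)) := by
        gcongr
        exact (measure_mono hsub).trans (measure_biUnion_le _ huc _)
    _ = lam * ∑' b : u, 5 ^ n * volume (closedBall (b : Rn n) (r b)) := by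
        congr 1
        apply tsum_congr
        intro b
        have hb := (hr b (hu b.2)).1.le
        rw [vol_cball _ hb, vol_cball _ (by positivity), mul_pow, ENNReal.ofReal_mul (by positivity),
          ENNReal.ofReal_pow (by norm_num)]
        simp [mul_assoc]
    _ = 5 ^ n * ∑' b : u, lam * volume (closedBall (b : Rn n) (r b)) := by
        rw [ENNReal.tsum_mul_left, ENNReal.tsum_mul_left]; ring
    _ ≤ 5 ^ n * ∑' b : u, ∫⁻ y in closedBall (b : Rn n) (r b), h y := by
        gcongr with b
        exact (hr b (hu b.2)).2
    _ = 5 ^ n * ∫⁻ y in ⋃ b ∈ u, closedBall (b : Rn n) (r b), h y := by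
        rw [lintegral_biUnion huc (fun b _ => measurableSet_closedBall) hd]
    _ ≤ _ := by
        gcongr
        exact Measure.restrict_le_self

/-- constant of the tail lemma -/
def Ctail (n : ℕ) (δ : ℝ) : ℝ≥0∞ :=
  2 ^ n * vB n * ∑' k : ℕ, ENNReal.ofReal ((2 : ℝ) ^ (-δ)) ^ k

lemma Ctail_top (n : ℕ) {δ : ℝ} (hδ : 0 < δ) : Ctail n δ ≠ ∞ := by
  unfold Ctail
  rw [ENNReal.tsum_geometric]
  refine ENNReal.mul_ne_top (ENNReal.mul_ne_top (by simp) (vB_top n)) ?_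
  rw [ENNReal.inv_ne_top]
  have : ENNReal.ofReal ((2 : ℝ) ^ (-δ)) < 1 := by
    rw [ENNReal.ofReal_lt_one]
    exact Real.rpow_lt_one_of_one_lt_of_neg (by norm_num) (by linarith)
  exact (tsub_pos_of_lt this).ne'

lemma tail_le (h : Rn n → ℝ≥0∞) (x : Rn n) {r δ : ℝ} (hr : 0 < r) (hδ : 0 < δ) :
    ∫⁻ y in {y | r ≤ dist x y}, ENNReal.ofReal (r ^ δ / dist x y ^ ((n : ℝ) + δ)) * h y
      ≤ Ctail n δ * Mc h x := by
  have hsub : {y | r ≤ dist x y} ⊆ ⋃ k : ℕ, {y | 2 ^ k * r ≤ dist x y ∧ dist x y ≤ 2 ^ (k + 1) * r} := by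
    intro y hy
    have hy' : r ≤ dist x y := hy
    have h1 : 1 ≤ dist x y / r := (one_le_div hr).2 hy'
    obtain ⟨k, hk1, hk2⟩ := exists_nat_pow_near h1 (by norm_num : (1 : ℝ) < 2)
    refine mem_iUnion.2 ⟨k, ?_, ?_⟩
    · exact (le_div_iff₀ hr).1 hk1
    · exact ((div_lt_iff₀ hr).1 hk2).le
  calc _ ≤ ∑' k : ℕ, ∫⁻ y in {y | 2 ^ k * r ≤ dist x y ∧ dist x y ≤ 2 ^ (k + 1) * r},
          ENNReal.ofReal (r ^ δ / dist x y ^ ((n : ℝ) + δ)) * h y :=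
        (lintegral_mono_set hsub).trans (lintegral_iUnion_le _ _)
    _ ≤ ∑' k : ℕ, (2 ^ n * vB n * Mc h x) * ENNReal.ofReal ((2 : ℝ) ^ (-δ)) ^ k := by
        refine ENNReal.tsum_le_tsum fun k => ?_
        calc ∫⁻ y in {y | 2 ^ k * r ≤ dist x y ∧ dist x y ≤ 2 ^ (k + 1) * r},
              ENNReal.ofReal (r ^ δ / dist x y ^ ((n : ℝ) + δ)) * h y
            ≤ ∫⁻ y in {y | 2 ^ k * r ≤ dist x y ∧ dist x y ≤ 2 ^ (k + 1) * r},
              ENNReal.ofReal (r ^ δ / (2 ^ k * r) ^ ((n : ℝ) + δ)) * h y := by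
              refine setLIntegral_mono_ae' ?_ ?_
              · apply MeasurableSet.inter
                · exact measurableSet_le measurable_const (measurable_const.dist measurable_id)
                · exact measurableSet_le (measurable_const.dist measurable_id) measurable_const
              · refine Filter.Eventually.of_forall fun y hy => ?_
                gcongr
                exact hy.1
          _ ≤ ENNReal.ofReal (r ^ δ / (2 ^ k * r) ^ ((n : ℝ) + δ)) * ∫⁻ y in closedBall x (2 ^ (k + 1) * r), h y := by
              rw [lintegral_const_mul' _ _ ENNReal.ofReal_ne_top]
              gcongr
              intro y hy
              rw [mem_closedBall, dist_comm]; exact hy.2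
          _ ≤ ENNReal.ofReal (r ^ δ / (2 ^ k * r) ^ ((n : ℝ) + δ)) * (ENNReal.ofReal ((2 ^ (k + 1) * r) ^ n) * vB n * Mc h x) := by
              gcongr
              rw [← vol_cball x (by positivity)]
              exact lint_le_Mc h x (by positivity)
          _ = _ := by
              have e1 : r ^ δ / (2 ^ k * r) ^ ((n : ℝ) + δ) * (2 ^ (k + 1) * r) ^ n = 2 ^ n * ((2 : ℝ) ^ (-δ)) ^ k := by
                have hr' := hr.ne'
                rw [Real.rpow_add (by positivity), Real.rpow_natCast, Real.mul_rpow (by positivity) hr.le,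
                  Real.rpow_neg (by norm_num), inv_pow]
                rw [← Real.rpow_natCast ((2:ℝ)^δ) k, ← Real.rpow_natCast (2:ℝ) k, ← Real.rpow_mul (by norm_num), ← Real.rpow_mul (by norm_num), mul_comm δ]
                rw [Real.rpow_natCast]
                have : (r:ℝ)^δ ≠ 0 := by positivity
                have : (2:ℝ)^((k:ℝ)*δ) ≠ 0 := by positivity
                field_simp
                rw [pow_succ, mul_pow, mul_pow, mul_pow]; ring
              rw [show ENNReal.ofReal (r ^ δ / (2 ^ k * r) ^ ((n : ℝ) + δ)) * (ENNReal.ofReal ((2 ^ (k + 1) * r) ^ n) * vB n * Mc h x)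
                = (ENNReal.ofReal (r ^ δ / (2 ^ k * r) ^ ((n : ℝ) + δ)) * ENNReal.ofReal ((2 ^ (k + 1) * r) ^ n)) * (vB n * Mc h x) by ring]
              rw [← ENNReal.ofReal_mul (by positivity), e1, ENNReal.ofReal_mul (by positivity),
                ENNReal.ofReal_pow (by norm_num), ENNReal.ofReal_pow (by positivity)]
              simp; ring
    _ = _ := by
        rw [ENNReal.tsum_mul_left, Ctail]; ring

end SparseCZ

namespace SparseCZ

open Metric

/-! ### Dyadic grids -/

variable {n : ℕ}

lemma side_le_of_subset [NeZero n] {P R : Cube n} (h : P.toSet ⊆ R.toSet) : P.side ≤ R.side := by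
  have h1 := measure_mono (μ := volume) h
  rw [P.volume_eq, R.volume_eq] at h1
  have h2 := (ENNReal.ofReal_le_ofReal_iff (by have := R.side_pos; positivity)).1 h1
  exact (pow_le_pow_iff_left₀ P.side_pos.le R.side_pos.le (NeZero.ne n)).1 h2

lemma grid_eq_of_side {D : Set (Cube n)} (hD : IsDyadicGrid D) {P R : Cube n} (hP : P ∈ D)
    (hR : R ∈ D) (hs : P.side = R.side) {x : Rn n} (hx : x ∈ P.toSet) (hx' : x ∈ R.toSet) : P = R := by
  obtain ⟨k, hk⟩ := hD.1 P hP
  exact (hD.2.2 k x).unique ⟨hP, hk, hx⟩ ⟨hR, hs ▸ hk, hx'⟩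

lemma grid_subset [NeZero n] {D : Set (Cube n)} (hD : IsDyadicGrid D) {P R : Cube n} (hP : P ∈ D)
    (hR : R ∈ D) (hs : P.side ≤ R.side) {x : Rn n} (hx : x ∈ P.toSet) (hx' : x ∈ R.toSet) :
    P.toSet ⊆ R.toSet := by
  rcases hD.2.1 P hP R hR with h | h | h
  · exact inter_eq_left.1 h
  · have h1 : R.toSet ⊆ P.toSet := inter_eq_right.1 h
    have := grid_eq_of_side hD hP hR (le_antisymm hs (side_le_of_subset h1)) hx hx'
    rw [this]
  · exact absurd (show x ∈ P.toSet ∩ R.toSet from ⟨hx, hx'⟩) (by rw [h]; exact notMem_empty x)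

lemma grid_eq_of_toSet [NeZero n] {D : Set (Cube n)} (hD : IsDyadicGrid D) {P R : Cube n}
    (hP : P ∈ D) (hR : R ∈ D) (h : P.toSet = R.toSet) : P = R :=
  grid_eq_of_side hD hP hR (le_antisymm (side_le_of_subset h.subset) (side_le_of_subset h.symm.subset))
    P.pt_mem (h ▸ P.pt_mem)

lemma grid_parent [NeZero n] {D : Set (Cube n)} (hD : IsDyadicGrid D) {P : Cube n} (hP : P ∈ D) :
    ∃ R ∈ D, R.side = 2 * P.side ∧ P.toSet ⊆ R.toSet ∧ volume R.toSet = 2 ^ n * volume P.toSet := by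
  obtain ⟨k, hk⟩ := hD.1 P hP
  obtain ⟨R, ⟨hR, hs, hx⟩, -⟩ := hD.2.2 (k + 1) P.pt
  have h2 : R.side = 2 * P.side := by
    rw [hs, hk, zpow_add₀ (by norm_num)]; simp [mul_comm]
  refine ⟨R, hR, h2, grid_subset hD hP hR ?_ P.pt_mem hx, ?_⟩
  · have := P.side_pos; linarith
  · rw [R.volume_eq, P.volume_eq, h2, mul_pow, ENNReal.ofReal_mul (by positivity),
      ENNReal.ofReal_pow (by norm_num)]
    simp

lemma grid_countable {D : Set (Cube n)} (hD : IsDyadicGrid D) : D.Countable := by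
  have h : D ⊆ ⋃ k : ℤ, {P | P ∈ D ∧ P.side = 2 ^ k} := by
    intro P hP
    obtain ⟨k, hk⟩ := hD.1 P hP
    exact mem_iUnion.2 ⟨k, hP, hk⟩
  refine (countable_iUnion fun k => ?_).mono h
  refine PairwiseDisjoint.countable_of_nonempty_interior (s := Cube.toSet) ?_
    (fun P _ => P.interior_nonempty)
  intro P hP R hR hne
  rw [Function.onFun, Set.disjoint_left]
  intro x hx hxR
  exact hne (grid_eq_of_side hD hP.1 hR.1 (hP.2.trans hR.2.symm) hx hxR)

/-- maximal cubes of a family -/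
def maxFam (F : Set (Cube n)) : Set (Cube n) :=
  {P | P ∈ F ∧ ∀ R ∈ F, P.toSet ⊆ R.toSet → R = P}

lemma maxFam_exists [NeZero n] {D : Set (Cube n)} (hD : IsDyadicGrid D) {F : Set (Cube n)}
    (hF : F ⊆ D) {L : ℝ} (hL : ∀ P ∈ F, P.side ≤ L) {P : Cube n} (hP : P ∈ F) :
    ∃ R ∈ maxFam F, P.toSet ⊆ R.toSet := by
  have hb : ∃ b : ℤ, ∀ z : ℤ, (∃ R ∈ F, P.toSet ⊆ R.toSet ∧ R.side = 2 ^ z) → z ≤ b := by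
    obtain ⟨m, hm⟩ := pow_unbounded_of_one_lt L (by norm_num : (1 : ℝ) < 2)
    refine ⟨m, ?_⟩
    rintro z ⟨R, hR, -, hs⟩
    have h1 := (hL R hR).trans_lt hm
    rw [hs, ← zpow_natCast] at h1
    exact ((zpow_lt_zpow_iff_right₀ (by norm_num : (1 : ℝ) < 2)).1 h1).le
  obtain ⟨k, hk⟩ := hD.1 P (hF hP)
  obtain ⟨z, ⟨R, hR, hPR, hs⟩, hz⟩ := Int.exists_greatest_of_bdd hb ⟨k, P, hP, Subset.rfl, hk⟩
  refine ⟨R, ⟨hR, ?_⟩, hPR⟩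
  intro R' hR' hRR'
  obtain ⟨z', hz'⟩ := hD.1 R' (hF hR')
  have h1 := hz z' ⟨R', hR', hPR.trans hRR', hz'⟩
  have h2 : R'.side ≤ R.side := by
    rw [hz', hs]; exact zpow_le_zpow_right₀ (by norm_num) h1
  exact (grid_eq_of_side hD (hF hR) (hF hR') (le_antisymm (side_le_of_subset hRR') h2) R.pt_mem
    (hRR' R.pt_mem)).symm

lemma maxFam_disjoint [NeZero n] {D : Set (Cube n)} (hD : IsDyadicGrid D) {F : Set (Cube n)}
    (hF : F ⊆ D) : (maxFam F).PairwiseDisjoint Cube.toSet := by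
  intro P hP R hR hne
  rw [Function.onFun, Set.disjoint_left]
  intro x hx hx'
  rcases le_total P.side R.side with h | h
  · exact hne (hP.2 R hR.1 (grid_subset hD (hF hP.1) (hF hR.1) h hx hx')).symm
  · exact hne (hR.2 P hP.1 (grid_subset hD (hF hR.1) (hF hP.1) h hx' hx))

/-- A point in an open set is contained in arbitrarily small cubes of the grid in this set. -/
lemma grid_small [NeZero n] {D : Set (Cube n)} (hD : IsDyadicGrid D) {x : Rn n} {ρ : ℝ} (hρ : 0 < ρ)
    : ∃ P ∈ D, x ∈ P.toSet ∧ P.side ≤ ρ ∧ P.toSet ⊆ ball x ρ := by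
  have hn : (0 : ℝ) < n := by exact_mod_cast Nat.pos_of_ne_zero (NeZero.ne n)
  have hn1 : (1 : ℝ) ≤ n := by exact_mod_cast Nat.pos_of_ne_zero (NeZero.ne n)
  obtain ⟨k, hk⟩ := exists_pow_lt_of_lt_one (show 0 < ρ / n by positivity) (by norm_num : (1 / 2 : ℝ) < 1)
  obtain ⟨P, ⟨hP, hs, hx⟩, -⟩ := hD.2.2 (-(k : ℤ)) x
  have hs' : P.side < ρ / n := by
    rw [hs]; simpa using hk
  have h3 : n * P.side < ρ := by rw [lt_div_iff₀ hn] at hs'; linarith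
  refine ⟨P, hP, hx, ?_, ?_⟩
  · have := P.side_pos; nlinarith
  · intro y hy
    rw [mem_ball]
    have := P.dist_le hy hx
    linarith

end SparseCZ

namespace SparseCZ

open Metric

/-! ### Kernels and their truncations -/

variable {n : ℕ}

/-- Lipschitz cutoff. -/
def ph (ε t : ℝ) : ℝ := min 1 (max 0 (t / ε - 1))

lemma ph_nonneg (ε t : ℝ) : 0 ≤ ph ε t := le_min (by norm_num) (le_max_left _ _)

lemma ph_le_one (ε t : ℝ) : ph ε t ≤ 1 := min_le_left _ _

lemma ph_zero {ε t : ℝ} (hε : 0 < ε) (h : t ≤ ε) : ph ε t = 0 := by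
  have : t / ε - 1 ≤ 0 := by
    have := (div_le_one hε).2 h; linarith
  simp [ph, max_eq_left this]

lemma ph_one {ε t : ℝ} (hε : 0 < ε) (h : 2 * ε ≤ t) : ph ε t = 1 := by
  have : 2 ≤ t / ε := (le_div_iff₀ hε).2 h
  rw [ph, min_eq_left]
  exact le_max_of_le_right (by linarith)

lemma ph_lip_aux {ε t t' : ℝ} (hε : 0 < ε) (ht : 0 < t) (h : t ≤ t') :
    |ph ε t - ph ε t'| ≤ 2 * (t' - t) / t := by
  by_cases h1 : 2 * ε ≤ t
  · rw [ph_one hε h1, ph_one hε (h1.trans h)]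
    have : 0 ≤ t' - t := by linarith
    simp only [sub_self, abs_zero]; positivity
  · push Not at h1
    have h2 : |ph ε t - ph ε t'| ≤ |(t / ε - 1) - (t' / ε - 1)| := by
      unfold ph
      refine (abs_min_sub_min_le_max _ _ _ _).trans ?_
      simp only [sub_self, abs_zero]
      refine max_le (abs_nonneg _) ?_
      refine (abs_max_sub_max_le_max _ _ _ _).trans ?_
      simp
    refine h2.trans ?_
    have h3 : (t / ε - 1) - (t' / ε - 1) = -((t' - t) / ε) := by ring
    rw [h3, abs_neg, abs_of_nonneg (div_nonneg (by linarith) hε.le), div_le_div_iff₀ hε ht]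
    nlinarith

lemma ph_lip {ε t t' : ℝ} (hε : 0 < ε) (ht : 0 < t) (h : t / 2 ≤ t') :
    |ph ε t - ph ε t'| ≤ 4 * |t - t'| / t := by
  rcases le_total t t' with h1 | h1
  · refine (ph_lip_aux hε ht h1).trans ?_
    rw [abs_sub_comm, abs_of_nonneg (by linarith : 0 ≤ t' - t)]
    gcongr
    linarith
  · rw [abs_sub_comm]
    have ht' : 0 < t' := by linarith
    refine (ph_lip_aux hε ht' h1).trans ?_
    rw [abs_of_nonneg (by linarith : 0 ≤ t - t'), div_le_div_iff₀ ht' ht]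
    nlinarith

lemma continuous_ph (ε : ℝ) : Continuous (ph ε) := by
  unfold ph; fun_prop

/-- Truncated kernel. -/
def Ke (K : Rn n → Rn n → ℝ) (ε : ℝ) (x y : Rn n) : ℝ := K x y * ph ε (dist x y)

lemma ker_aux {n : ℕ} {a a' p p' c d t δ : ℝ} (hc : 0 < c) (ht : 0 < t) (hd : 0 ≤ d) (hdt : d ≤ t / 2)
    (hδ1 : δ ≤ 1)
    (h1 : |a - a'| ≤ c * d ^ δ / t ^ ((n : ℝ) + δ)) (h2 : |a| ≤ c / t ^ n)
    (hp0 : 0 ≤ p') (hp1 : p' ≤ 1) (h3 : |p - p'| ≤ 4 * d / t) :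
    |a * p - a' * p'| ≤ 5 * c * (d ^ δ / t ^ ((n : ℝ) + δ)) := by
  have e : a * p - a' * p' = (a - a') * p' + a * (p - p') := by ring
  have h4 : d / t ≤ d ^ δ / t ^ δ := by
    rw [← Real.div_rpow hd ht.le]
    have hx0 : 0 ≤ d / t := by positivity
    have hx1 : d / t ≤ 1 := by rw [div_le_one ht]; linarith
    rcases hx0.eq_or_lt with h | h
    · rw [← h]; exact Real.rpow_nonneg le_rfl _
    · calc d / t = (d / t) ^ (1 : ℝ) := (Real.rpow_one _).symm
        _ ≤ _ := Real.rpow_le_rpow_of_exponent_ge h hx1 hδ1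
  rw [e]
  calc |(a - a') * p' + a * (p - p')| ≤ |a - a'| * p' + |a| * |p - p'| := by
        refine (abs_add_le _ _).trans ?_
        rw [abs_mul, abs_mul, abs_of_nonneg hp0]
    _ ≤ c * d ^ δ / t ^ ((n : ℝ) + δ) * 1 + c / t ^ n * (4 * (d / t)) := by
        rw [← mul_div_assoc]
        gcongr
    _ ≤ c * d ^ δ / t ^ ((n : ℝ) + δ) * 1 + c / t ^ n * (4 * (d ^ δ / t ^ δ)) := by gcongr
    _ = _ := by
        rw [Real.rpow_add ht, Real.rpow_natCast]
        have : t ^ δ ≠ 0 := by positivity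
        field_simp; ring

section
variable {T : (Rn n → ℝ) → Rn n → ℝ} {K : Rn n → Rn n → ℝ} {c δ : ℝ}

lemma Ke_bound (hT : IsCZO n T K c δ) {ε : ℝ} (hε : 0 < ε) (x y : Rn n) :
    |Ke K ε x y| ≤ c / ε ^ n := by
  have hc := hT.c_pos
  by_cases h : dist x y ≤ ε
  · rw [Ke, ph_zero hε h, mul_zero, abs_zero]; positivity
  · push Not at h
    have hne : x ≠ y := by
      rintro rfl; rw [dist_self] at h; linarith
    rw [Ke, abs_mul, abs_of_nonneg (ph_nonneg _ _)]
    calc |K x y| * ph ε (dist x y) ≤ c / dist x y ^ n * 1 := by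
          gcongr
          · exact ph_nonneg _ _
          · exact hT.size x y hne
          · exact ph_le_one _ _
      _ ≤ _ := by rw [mul_one]; gcongr

lemma dist_ph {x x' y : Rn n} {ε : ℝ} (hε : 0 < ε) (hne : x ≠ y) (h : dist x x' ≤ dist x y / 2) :
    |ph ε (dist x y) - ph ε (dist x' y)| ≤ 4 * dist x x' / dist x y := by
  have ht : 0 < dist x y := dist_pos.2 hne
  have h1 : dist x y / 2 ≤ dist x' y := by
    have := dist_triangle x x' y; linarith
  refine (ph_lip hε ht h1).trans ?_
  gcongr
  exact abs_dist_sub_le x x' y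

lemma Ke_smooth1 (hT : IsCZO n T K c δ) {ε : ℝ} (hε : 0 < ε) {x x' y : Rn n} (hne : x ≠ y)
    (h : dist x x' ≤ dist x y / 2) :
    |Ke K ε x y - Ke K ε x' y| ≤ 5 * c * (dist x x' ^ δ / dist x y ^ ((n : ℝ) + δ)) := by
  refine ker_aux hT.c_pos (dist_pos.2 hne) dist_nonneg h hT.delta_le_one ?_
    (hT.size x y hne) (ph_nonneg _ _) (ph_le_one _ _) (dist_ph hε hne h)
  exact (le_add_of_nonneg_right (abs_nonneg _)).trans (hT.smooth x x' y hne h)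

lemma Ke_smooth2 (hT : IsCZO n T K c δ) {ε : ℝ} (hε : 0 < ε) {x x' y : Rn n} (hne : x ≠ y)
    (h : dist x x' ≤ dist x y / 2) :
    |Ke K ε y x - Ke K ε y x'| ≤ 5 * c * (dist x x' ^ δ / dist x y ^ ((n : ℝ) + δ)) := by
  have h2 := hT.size y x hne.symm
  have h3 := dist_ph hε hne h
  rw [dist_comm y x] at h2
  unfold Ke
  rw [dist_comm y x, dist_comm y x']
  refine ker_aux hT.c_pos (dist_pos.2 hne) dist_nonneg h hT.delta_le_one ?_
    h2 (ph_nonneg _ _) (ph_le_one _ _) h3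
  exact (le_add_of_nonneg_left (abs_nonneg _)).trans (hT.smooth x x' y hne h)

lemma K_smooth1 (hT : IsCZO n T K c δ) {x x' y : Rn n} (hne : x ≠ y)
    (h : dist x x' ≤ dist x y / 2) :
    |K x y - K x' y| ≤ c * (dist x x' ^ δ / dist x y ^ ((n : ℝ) + δ)) := by
  rw [← mul_div_assoc]
  exact (le_add_of_nonneg_right (abs_nonneg _)).trans (hT.smooth x x' y hne h)

lemma K_smooth2 (hT : IsCZO n T K c δ) {x x' y : Rn n} (hne : x ≠ y)
    (h : dist x x' ≤ dist x y / 2) :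
    |K y x - K y x'| ≤ c * (dist x x' ^ δ / dist x y ^ ((n : ℝ) + δ)) := by
  rw [← mul_div_assoc]
  exact (le_add_of_nonneg_left (abs_nonneg _)).trans (hT.smooth x x' y hne h)

lemma K_cont (hT : IsCZO n T K c δ) {x₀ y₀ : Rn n} (hne : x₀ ≠ y₀) :
    ContinuousAt (Function.uncurry K) (x₀, y₀) := by
  have hδ := hT.delta_pos
  have ht : 0 < dist x₀ y₀ := dist_pos.2 hne
  rw [ContinuousAt, tendsto_iff_dist_tendsto_zero]
  set B : Rn n × Rn n → ℝ := fun p => c * (dist x₀ p.1 ^ δ / dist x₀ p.2 ^ ((n : ℝ) + δ)) +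
    c * (dist y₀ p.2 ^ δ / dist y₀ x₀ ^ ((n : ℝ) + δ)) with hB
  have hBc : Tendsto B (𝓝 (x₀, y₀)) (𝓝 0) := by
    have h0 : B (x₀, y₀) = 0 := by simp [hB, Real.zero_rpow hδ.ne']
    rw [← h0]
    have : ContinuousAt B (x₀, y₀) := by
      rw [hB]
      refine ContinuousAt.add ?_ ?_
      · refine continuousAt_const.mul (ContinuousAt.div ?_ ?_ ?_)
        · exact (by fun_prop : ContinuousAt (fun p : Rn n × Rn n => dist x₀ p.1) _).rpow_const (Or.inr hδ.le)
        · exact (by fun_prop : ContinuousAt (fun p : Rn n × Rn n => dist x₀ p.2) _).rpow_const (Or.inl ht.ne')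
        · exact (Real.rpow_pos_of_pos ht _).ne'
      · refine continuousAt_const.mul (ContinuousAt.div_const ?_ _)
        exact (by fun_prop : ContinuousAt (fun p : Rn n × Rn n => dist y₀ p.2) _).rpow_const (Or.inr hδ.le)
    exact this
  refine tendsto_of_tendsto_of_tendsto_of_le_of_le' tendsto_const_nhds hBc
    (Eventually.of_forall fun _ => dist_nonneg) ?_
  have e1 : ∀ᶠ p : Rn n × Rn n in 𝓝 (x₀, y₀), dist x₀ p.1 < dist x₀ p.2 / 2 := by
    apply ContinuousAt.eventually_lt (by fun_prop) (by fun_prop)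
    simpa using hne
  have e2 : ∀ᶠ p : Rn n × Rn n in 𝓝 (x₀, y₀), dist y₀ p.2 < dist y₀ x₀ / 2 := by
    apply ContinuousAt.eventually_lt (by fun_prop) (by fun_prop)
    simpa using hne.symm
  have e3 : ∀ᶠ p : Rn n × Rn n in 𝓝 (x₀, y₀), 0 < dist x₀ p.2 := by
    apply ContinuousAt.eventually_lt (by fun_prop) (by fun_prop)
    exact ht
  filter_upwards [e1, e2, e3] with p h1 h2 h3
  rw [Real.dist_eq]
  have a1 := K_smooth1 hT (dist_pos.1 h3) h1.le
  have a2 := K_smooth2 hT hne.symm h2.le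
  simp only [Function.uncurry, hB]
  calc |K p.1 p.2 - K x₀ y₀| = |-(K x₀ p.2 - K p.1 p.2) + -(K x₀ y₀ - K x₀ p.2)| := by congr 1; ring
    _ ≤ |K x₀ p.2 - K p.1 p.2| + |K x₀ y₀ - K x₀ p.2| := by
        refine (abs_add_le _ _).trans ?_
        rw [abs_neg, abs_neg]
    _ ≤ _ := add_le_add a1 a2

open Classical in
/-- kernel set to zero on the diagonal -/
def K0 (K : Rn n → Rn n → ℝ) (x y : Rn n) : ℝ := if x = y then 0 else K x y

lemma K0_eq {x y : Rn n} (h : x ≠ y) : K0 K x y = K x y := by simp [K0, h]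

lemma K0_meas (hT : IsCZO n T K c δ) : Measurable (Function.uncurry (K0 K)) := by
  have hd : IsOpen {p : Rn n × Rn n | p.1 ≠ p.2} := isOpen_ne_fun continuous_fst continuous_snd
  have h := ContinuousOn.measurable_piecewise (f := Function.uncurry K) (g := fun _ => (0 : ℝ))
    (s := {p : Rn n × Rn n | p.1 ≠ p.2})
    (fun p hp => (K_cont hT (x₀ := p.1) (y₀ := p.2) hp).continuousWithinAt) continuousOn_const hd.measurableSet
  convert h using 1
  ext p
  by_cases hp : p.1 = p.2 <;> simp [Function.uncurry, K0, hp, Set.piecewise]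

lemma K0_meas_right (hT : IsCZO n T K c δ) (x : Rn n) : Measurable (K0 K x) :=
  (K0_meas hT).comp measurable_prodMk_left

lemma Ke_eq_K0 {ε : ℝ} (hε : 0 < ε) (x y : Rn n) : Ke K ε x y = K0 K x y * ph ε (dist x y) := by
  by_cases h : x = y
  · subst h; simp [Ke, K0, ph_zero hε hε.le]
  · rw [Ke, K0_eq h]

lemma Ke_meas (hT : IsCZO n T K c δ) {ε : ℝ} (hε : 0 < ε) (x : Rn n) : Measurable (Ke K ε x) := by
  have : Ke K ε x = fun y => K0 K x y * ph ε (dist x y) := funext fun y => Ke_eq_K0 hε x y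
  rw [this]
  exact (K0_meas_right hT x).mul ((continuous_ph ε).measurable.comp (measurable_const.dist measurable_id))

/-- one-sided smooth truncation -/
def Te (K : Rn n → Rn n → ℝ) (ε : ℝ) (f : Rn n → ℝ) (x : Rn n) : ℝ := ∫ y, Ke K ε x y * f y

/-- maximal one-sided smooth truncation -/
def Ts (K : Rn n → Rn n → ℝ) (f : Rn n → ℝ) (x : Rn n) : ℝ≥0∞ :=
  ⨆ (ε : ℝ) (_ : 0 < ε), ‖Te K ε f x‖ₑ

lemma Ke_integrable (hT : IsCZO n T K c δ) {ε : ℝ} (hε : 0 < ε) (x : Rn n) {f : Rn n → ℝ}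
    (hf : Integrable f) : Integrable (fun y => Ke K ε x y * f y) := by
  refine hf.bdd_mul (c := c / ε ^ n) (Ke_meas hT hε x).aestronglyMeasurable ?_
  exact Eventually.of_forall fun y => Ke_bound hT hε x y

end

end SparseCZ

namespace SparseCZ

open Metric

/-! ### The colouring argument: uniform `L²` bounds for a discretised operator -/

variable {n : ℕ}

/-- index of the grid cell of size `s` containing `x` -/
def cell (s : ℝ) (x : Rn n) : Fin n → ℤ := fun i => ⌊x i / s⌋

lemma cell_meas (s : ℝ) : Measurable (cell (n := n) s) := by
  refine measurable_pi_lambda _ fun i => ?_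
  have : Measurable fun x : Rn n => x i := by fun_prop
  exact Int.measurable_floor.comp (this.div_const s)

lemma meas_cell_mem (s : ℝ) (w : Set (Fin n → ℤ)) : MeasurableSet {y : Rn n | cell s y ∈ w} :=
  cell_meas s (Set.to_countable w).measurableSet

lemma cell_dist {s : ℝ} (hs : 0 < s) {x y : Rn n} (h : cell s x = cell s y) : dist x y ≤ n * s := by
  apply dist_le_of_coord hs.le
  intro i
  have h1 := congrFun h i
  simp only [cell] at h1
  have h2 := (Int.abs_sub_lt_one_of_floor_eq_floor h1).le
  rw [← sub_div, abs_div, abs_of_pos hs, div_le_one hs] at h2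
  exact h2

/-- points in the interior of their cells -/
def good (s : ℝ) (x : Rn n) : Prop := ∀ i, (⌊x i / s⌋ : ℝ) ≠ x i / s

lemma good_nhds {s : ℝ} {x : Rn n} (hx : good s x) : ∀ᶠ y in 𝓝 x, cell s y = cell s x := by
  have : ∀ᶠ y in 𝓝 x, ∀ i, ⌊y i / s⌋ = ⌊x i / s⌋ := by
    rw [Filter.eventually_all]
    intro i
    have hc : ContinuousAt (fun y : Rn n => y i / s) x := by fun_prop
    have h1 : (⌊x i / s⌋ : ℝ) < x i / s := lt_of_le_of_ne (Int.floor_le _) (hx i)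
    have h2 : x i / s < ⌊x i / s⌋ + 1 := Int.lt_floor_add_one _
    filter_upwards [hc.eventually (Ioo_mem_nhds h1 h2)] with y hy
    exact Int.floor_eq_iff.2 ⟨hy.1.le, hy.2⟩
  filter_upwards [this] with y hy
  exact funext hy

lemma good_ae {s : ℝ} (hs : 0 < s) : ∀ᵐ x : Rn n, good s x := by
  have h : ∀ i : Fin n, ∀ k : ℤ, ∀ᵐ x : Rn n, x i ≠ s * k := by
    intro i k
    rw [ae_iff]
    have e : {x : Rn n | ¬ x i ≠ s * k} =
        (WithLp.ofLp : Rn n → (Fin n → ℝ)) ⁻¹' {g | g i = s * k} := by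
      ext x; simp
    rw [e, (PiLp.volume_preserving_ofLp (Fin n)).measure_preimage]
    · rw [volume_pi]; exact Measure.pi_hyperplane _ i _
    · exact (measurableSet_eq_fun (measurable_pi_apply i) measurable_const).nullMeasurableSet
  have h' : ∀ᵐ x : Rn n, ∀ i : Fin n, ∀ k : ℤ, x i ≠ s * k := by
    rw [ae_all_iff]; intro i; rw [ae_all_iff]; exact h i
  filter_upwards [h'] with x hx i hi
  apply hx i ⌊x i / s⌋
  rw [hi]; field_simp

section
variable {T : (Rn n → ℝ) → Rn n → ℝ} {K : Rn n → Rn n → ℝ} {c δ : ℝ}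

/-- the discretised operator -/
def Us (K : Rn n → Rn n → ℝ) (s : ℝ) (f : Rn n → ℝ) (x : Rn n) : ℝ :=
  ∫ y, if cell s y = cell s x then 0 else K0 K x y * f y

lemma meas_cell_eq (s : ℝ) : MeasurableSet {p : Rn n × Rn n | cell s p.2 = cell s p.1} :=
  measurableSet_eq_fun ((cell_meas s).comp measurable_snd) ((cell_meas s).comp measurable_fst)

lemma Us_meas (hT : IsCZO n T K c δ) (s : ℝ) {f : Rn n → ℝ} (hf : Measurable f) :
    Measurable (Us K s f) := by
  have : Measurable (Function.uncurry fun x y : Rn n => if cell s y = cell s x then 0 else K0 K x y * f y) := by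
    refine Measurable.ite (meas_cell_eq s) measurable_const ?_
    exact (K0_meas hT).mul (hf.comp measurable_snd)
  exact (this.stronglyMeasurable.integral_prod_right).measurable

lemma Us_integrable (hT : IsCZO n T K c δ) {s : ℝ} {f : Rn n → ℝ}
    (hf : Integrable f) {x : Rn n} (hx : good s x) :
    Integrable (fun y => if cell s y = cell s x then 0 else K0 K x y * f y) := by
  obtain ⟨ρ, hρ, h⟩ := Metric.eventually_nhds_iff.1 (good_nhds hx)
  have hc := hT.c_pos
  have : Integrable (fun y => (if cell s y = cell s x then 0 else K0 K x y) * f y) := by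
    refine hf.bdd_mul (c := c / ρ ^ n) ?_ ?_
    · exact (Measurable.ite (meas_cell_mem s {cell s x}) measurable_const (K0_meas_right hT x)).aestronglyMeasurable
    · refine Eventually.of_forall fun y => ?_
      split_ifs with h1
      · simp; positivity
      · have hd : ρ ≤ dist x y := by
          by_contra h2
          push Not at h2
          exact h1 (h (by rwa [dist_comm]))
        have hne : x ≠ y := by rintro rfl; exact h1 rfl
        rw [K0_eq hne, Real.norm_eq_abs]
        refine (hT.size x y hne).trans ?_
        gcongr
  refine this.congr (Eventually.of_forall fun y => ?_)
  simp only [ite_mul, zero_mul]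

/-- coloured pieces -/
def Gw (K : Rn n → Rn n → ℝ) (s : ℝ) (f : Rn n → ℝ) (w : Finset (Fin n → ℤ)) (x : Rn n) : ℝ :=
  if cell s x ∈ w then 0 else ∫ y, if cell s y ∈ w then K0 K x y * f y else 0

lemma Gw_meas (hT : IsCZO n T K c δ) (s : ℝ) {f : Rn n → ℝ} (hf : Measurable f)
    (w : Finset (Fin n → ℤ)) : Measurable (Gw K s f w) := by
  have h1 : Measurable (Function.uncurry fun x y : Rn n => if cell s y ∈ w then K0 K x y * f y else 0) := by
    refine Measurable.ite ?_ ?_ measurable_const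
    · exact measurable_snd (meas_cell_mem s (w : Set (Fin n → ℤ)))
    · exact (K0_meas hT).mul (hf.comp measurable_snd)
  exact Measurable.ite (meas_cell_mem s (w : Set (Fin n → ℤ))) measurable_const
    (h1.stronglyMeasurable.integral_prod_right).measurable

lemma eLpNorm_two_sq (f : Rn n → ℝ) : eLpNorm f 2 volume ^ 2 = ∫⁻ x, ‖f x‖ₑ ^ 2 := by
  rw [eLpNorm_eq_lintegral_rpow_enorm_toReal (by norm_num) (by norm_num)]
  simp only [ENNReal.toReal_ofNat, one_div]
  rw [← ENNReal.rpow_natCast, ← ENNReal.rpow_mul]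
  simp

lemma Gw_L2 (hT : IsCZO n T K c δ) {A : ℝ≥0∞} (hA : ∀ f, eLpNorm (T f) 2 volume ≤ A * eLpNorm f 2 volume)
    {s : ℝ} (hs : 0 < s) {f : Rn n → ℝ} (hf : Integrable f) (w : Finset (Fin n → ℤ)) :
    ∫⁻ x, ‖Gw K s f w x‖ₑ ^ 2 ≤ A ^ 2 * ∫⁻ x, ‖f x‖ₑ ^ 2 := by
  set fw : Rn n → ℝ := fun y => if cell s y ∈ w then f y else 0 with hfw
  have hfwi : Integrable fw := by
    have := hf.indicator (meas_cell_mem s (w : Set (Fin n → ℤ)))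
    refine this.congr (Eventually.of_forall fun y => ?_)
    simp [hfw, Set.indicator]
  calc ∫⁻ x, ‖Gw K s f w x‖ₑ ^ 2 ≤ ∫⁻ x, ‖T fw x‖ₑ ^ 2 := by
        refine lintegral_mono_ae ?_
        filter_upwards [good_ae hs] with x hx
        by_cases hxw : cell s x ∈ w
        · simp [Gw, hxw]
        · have hsupp : x ∉ tsupport fw := by
            rw [notMem_tsupport_iff_eventuallyEq]
            filter_upwards [good_nhds hx] with y hy
            simp [hfw, hy, hxw]
          rw [hT.repr fw hfwi x hsupp]
          have : Gw K s f w x = ∫ y, K x y * fw y := by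
            simp only [Gw, hxw, if_false]
            congr 1
            ext y
            by_cases hy : cell s y ∈ w
            · have hne : x ≠ y := by rintro rfl; exact hxw hy
              simp [hfw, hy, K0_eq hne]
            · simp [hfw, hy]
          rw [this]
    _ = eLpNorm (T fw) 2 volume ^ 2 := (eLpNorm_two_sq _).symm
    _ ≤ (A * eLpNorm fw 2 volume) ^ 2 := by gcongr; exact hA fw
    _ = A ^ 2 * ∫⁻ x, ‖fw x‖ₑ ^ 2 := by rw [mul_pow, eLpNorm_two_sq]
    _ ≤ _ := by
        gcongr with x
        simp only [hfw]
        split_ifs <;> simp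

lemma count_lem {ι : Type*} [DecidableEq ι] (F : Finset ι) {a b : ι} (hb : b ∈ F) (hab : b ≠ a) :
    ∑ w ∈ F.powerset, (if a ∈ w then (0 : ℝ) else if b ∈ w then 1 else 0) = 2 ^ ((F.erase a).card - 1) := by
  have h1 : ∀ w ∈ F.powerset, (if a ∈ w then (0 : ℝ) else if b ∈ w then 1 else 0) =
      if (a ∉ w ∧ b ∈ w) then 1 else 0 := by
    intro w _
    by_cases ha : a ∈ w <;> simp [ha]
  rw [Finset.sum_congr rfl h1, Finset.sum_boole]
  have hbe : b ∈ F.erase a := Finset.mem_erase.2 ⟨hab, hb⟩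
  rw [← Finset.card_erase_of_mem hbe]
  have : (F.powerset.filter fun w => a ∉ w ∧ b ∈ w).card = (((F.erase a).erase b).powerset).card := by
    refine Finset.card_nbij' (fun w => w.erase b) (fun w => insert b w) ?_ ?_ ?_ ?_
    · intro w hw
      simp only [Finset.coe_filter, Finset.mem_powerset, mem_setOf_eq] at hw
      simp only [Finset.coe_powerset, mem_preimage, mem_powerset_iff, Finset.coe_subset]
      intro z hz
      obtain ⟨hz1, hz2⟩ := Finset.mem_erase.1 hz
      refine Finset.mem_erase.2 ⟨hz1, Finset.mem_erase.2 ⟨?_, hw.1 hz2⟩⟩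
      rintro rfl; exact hw.2.1 hz2
    · intro w hw
      simp only [Finset.coe_powerset, mem_preimage, mem_powerset_iff, Finset.coe_subset] at hw
      simp only [Finset.coe_filter, Finset.mem_powerset, mem_setOf_eq]
      refine ⟨?_, ?_, Finset.mem_insert_self _ _⟩
      · intro z hz
        rcases Finset.mem_insert.1 hz with rfl | hz
        · exact hb
        · exact Finset.mem_of_mem_erase (Finset.mem_of_mem_erase (hw hz))
      · intro h
        rcases Finset.mem_insert.1 h with h | h
        · exact hab h.symm
        · exact (Finset.mem_erase.1 (Finset.mem_of_mem_erase (hw h))).1 rfl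
    · intro w hw
      simp only [Finset.coe_filter, Finset.mem_powerset, mem_setOf_eq] at hw
      exact Finset.insert_erase hw.2.2
    · intro w hw
      simp only [Finset.coe_powerset, mem_preimage, mem_powerset_iff, Finset.coe_subset] at hw
      apply Finset.erase_insert
      intro h
      exact (Finset.mem_erase.1 (hw h)).1 rfl
  rw [this, Finset.card_powerset]; push_cast; rfl

lemma Gw_sum (hT : IsCZO n T K c δ) {s : ℝ} {f : Rn n → ℝ} (hf : Integrable f)
    (F : Finset (Fin n → ℤ)) (hF : ∀ y, f y ≠ 0 → cell s y ∈ F) {x : Rn n} (hx : good s x) :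
    ∑ w ∈ F.powerset, Gw K s f w x = 2 ^ ((F.erase (cell s x)).card - 1) * Us K s f x := by
  have hU := Us_integrable hT hf hx
  set u : Rn n → ℝ := fun y => if cell s y = cell s x then 0 else K0 K x y * f y with hu
  have h1 : ∀ w ∈ F.powerset, Gw K s f w x =
      ∫ y, (if cell s x ∈ w then (0 : ℝ) else if cell s y ∈ w then 1 else 0) * u y := by
    intro w _
    by_cases hw : cell s x ∈ w
    · simp [Gw, hw]
    · simp only [Gw, hw, if_false]
      congr 1
      ext y
      by_cases hy : cell s y ∈ w
      · have hne : cell s y ≠ cell s x := by intro h; rw [h] at hy; exact hw hy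
        simp [hu, hy, hne]
      · simp [hy]
  rw [Finset.sum_congr rfl h1, ← integral_finsetSum, Us, ← integral_const_mul]
  · congr 1
    ext y
    rw [← Finset.sum_mul]
    by_cases hy : cell s y = cell s x
    · simp [hu, hy]
    · by_cases hfy : f y = 0
      · simp [hu, hfy]
      · rw [count_lem F (hF y hfy) hy]
  · intro w _
    refine hU.bdd_mul (c := 1) ?_ ?_
    · refine Measurable.aestronglyMeasurable ?_
      split_ifs
      · exact measurable_const
      · exact Measurable.ite (meas_cell_mem s (w : Set (Fin n → ℤ))) measurable_const measurable_const
    · refine Eventually.of_forall fun y => ?_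
      split_ifs <;> simp

/-- bounded support -/
def BddSupp (f : Rn n → ℝ) : Prop := ∃ R : ℝ, ∀ y, f y ≠ 0 → ‖y‖ ≤ R

lemma exists_cells {s : ℝ} (hs : 0 < s) {f : Rn n → ℝ} (hf : BddSupp f) :
    ∃ F : Finset (Fin n → ℤ), ∀ y, f y ≠ 0 → cell s y ∈ F := by
  obtain ⟨R, hR⟩ := hf
  refine ⟨Fintype.piFinset fun _ => Finset.Icc ⌊-R / s⌋ ⌊R / s⌋, fun y hy => ?_⟩
  rw [Fintype.mem_piFinset]
  intro i
  have h1 := (PiLp.norm_apply_le y i).trans (hR y hy)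
  rw [Real.norm_eq_abs, abs_le] at h1
  rw [Finset.mem_Icc]
  constructor
  · exact Int.floor_le_floor (by gcongr; exact h1.1)
  · exact Int.floor_le_floor (by gcongr; exact h1.2)

theorem Us_L2 (hT : IsCZO n T K c δ) : ∃ B : ℝ≥0∞, B ≠ ∞ ∧ ∀ s : ℝ, 0 < s → ∀ f : Rn n → ℝ,
    Measurable f → Integrable f → BddSupp f →
    ∫⁻ x, ‖Us K s f x‖ₑ ^ 2 ≤ B * ∫⁻ x, ‖f x‖ₑ ^ 2 := by
  obtain ⟨A, hAt, hA⟩ := hT.l2_bounded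
  refine ⟨16 * A ^ 2, ENNReal.mul_ne_top (by simp) (ENNReal.pow_ne_top hAt), ?_⟩
  intro s hs f hfm hfi hfb
  obtain ⟨F, hF⟩ := exists_cells hs hfb
  have key : ∀ᵐ x : Rn n, (2 : ℝ≥0∞) ^ F.card * ‖Us K s f x‖ₑ ^ 2 ≤
      16 * ∑ w ∈ F.powerset, ‖Gw K s f w x‖ₑ ^ 2 := by
    filter_upwards [good_ae hs] with x hx
    have h1 := Gw_sum hT hfi F hF hx
    have h2 := sq_sum_le_card_mul_sum_sq (s := F.powerset) (f := fun w => Gw K s f w x)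
    rw [h1, Finset.card_powerset] at h2
    set N := (F.erase (cell s x)).card - 1
    have hN : F.card ≤ N + 2 := by
      have := Finset.pred_card_le_card_erase (s := F) (a := cell s x)
      omega
    have h3 : (2 : ℝ) ^ F.card ≤ 4 * 2 ^ N := by
      calc (2 : ℝ) ^ F.card ≤ 2 ^ (N + 2) := pow_le_pow_right₀ (by norm_num) hN
        _ = _ := by rw [pow_add]; ring
    have h4 : (2 : ℝ) ^ F.card * Us K s f x ^ 2 ≤ 16 * ∑ w ∈ F.powerset, Gw K s f w x ^ 2 := by
      have hp : (0 : ℝ) < 2 ^ F.card := by positivity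
      refine le_of_mul_le_mul_left ?_ hp
      calc (2 : ℝ) ^ F.card * (2 ^ F.card * Us K s f x ^ 2) = (2 ^ F.card) ^ 2 * Us K s f x ^ 2 := by ring
        _ ≤ (4 * 2 ^ N) ^ 2 * Us K s f x ^ 2 := by gcongr
        _ = 16 * (2 ^ N * Us K s f x) ^ 2 := by ring
        _ ≤ 16 * (((2 ^ F.card : ℕ) : ℝ) * ∑ w ∈ F.powerset, Gw K s f w x ^ 2) := by gcongr
        _ = _ := by push_cast; ring
    have e : ∀ r : ℝ, ‖r‖ₑ ^ 2 = ENNReal.ofReal (r ^ 2) := by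
      intro r
      rw [Real.enorm_eq_ofReal_abs, ← ENNReal.ofReal_pow (abs_nonneg _), sq_abs]
    have h5 := ENNReal.ofReal_le_ofReal h4
    rw [ENNReal.ofReal_mul (by positivity), ENNReal.ofReal_mul (by positivity),
      ENNReal.ofReal_sum_of_nonneg (fun _ _ => sq_nonneg _), ENNReal.ofReal_pow (by norm_num)] at h5
    simp only [e]
    simpa using h5
  have h6 := lintegral_mono_ae key
  rw [lintegral_const_mul' _ _ (by simp), lintegral_const_mul' _ _ (by simp),
    lintegral_finsetSum _ (fun w _ => ((Gw_meas hT s hfm w).enorm).pow_const 2)] at h6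
  have h7 : (2 : ℝ≥0∞) ^ F.card * ∫⁻ x, ‖Us K s f x‖ₑ ^ 2 ≤ 2 ^ F.card * (16 * A ^ 2 * ∫⁻ x, ‖f x‖ₑ ^ 2) := by
    refine h6.trans ?_
    calc 16 * ∑ w ∈ F.powerset, ∫⁻ x, ‖Gw K s f w x‖ₑ ^ 2
        ≤ 16 * ∑ _w ∈ F.powerset, A ^ 2 * ∫⁻ x, ‖f x‖ₑ ^ 2 := by
          gcongr with w hw
          exact Gw_L2 hT hA hs hfi w
      _ = _ := by
          rw [Finset.sum_const, Finset.card_powerset, nsmul_eq_mul]; push_cast; ring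
  exact (ENNReal.mul_le_mul_iff_right (by simp) (by simp)).1 h7

end

end SparseCZ

namespace SparseCZ
open Metric
variable {n : ℕ}
variable {T : (Rn n → ℝ) → Rn n → ℝ} {K : Rn n → Rn n → ℝ} {c δ : ℝ}

lemma Mc_weak_mul [NeZero n] (h : Rn n → ℝ≥0∞) (lam C : ℝ≥0∞) (hC : C ≠ ∞) :
    lam * volume {x | lam < C * Mc h x} ≤ C * 5 ^ n * ∫⁻ y, h y := by
  by_cases hC0 : C = 0
  · simp [hC0]
  have e : {x | lam < C * Mc h x} = {x | lam / C < Mc h x} := by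
    ext x
    simp only [mem_ofPred_eq]
    rw [ENNReal.div_lt_iff (Or.inl hC0) (Or.inl hC), mul_comm]
  rw [e]
  have := Mc_weak h (lam / C)
  calc lam * volume {x | lam / C < Mc h x} = C * (lam / C * volume {x | lam / C < Mc h x}) := by
        rw [← mul_assoc, ENNReal.mul_div_cancel hC0 hC]
    _ ≤ C * (5 ^ n * ∫⁻ y, h y) := by gcongr
    _ = _ := by ring

lemma near_far {h : Rn n → ℝ≥0∞} (hh : AEMeasurable h) (x : Rn n) {r δ : ℝ} (hr : 0 < r)
    (hδ : 0 < δ) (a b : ℝ≥0∞) :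
    ∫⁻ y, ((closedBall x r).indicator (fun y => a * h y) y +
        {y | r ≤ dist x y}.indicator (fun y => b *
          (ENNReal.ofReal (r ^ δ / dist x y ^ ((n : ℝ) + δ)) * h y)) y) ≤
      (a * volume (closedBall x r) + b * Ctail n δ) * Mc h x := by
  have hm2 : MeasurableSet {y : Rn n | r ≤ dist x y} :=
    measurableSet_le measurable_const (measurable_const.dist measurable_id)
  have hm3 : Measurable fun y : Rn n => ENNReal.ofReal (r ^ δ / dist x y ^ ((n : ℝ) + δ)) := by
    fun_prop
  rw [lintegral_add_left' ((hh.const_mul a).indicator measurableSet_closedBall),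
    lintegral_indicator measurableSet_closedBall, lintegral_indicator hm2,
    lintegral_const_mul'' _ hh.restrict,
    lintegral_const_mul'' b (f := fun y => ENNReal.ofReal (r ^ δ / dist x y ^ ((n : ℝ) + δ)) * h y)
      (hm3.aemeasurable.mul hh.restrict), add_mul, mul_assoc, mul_assoc]
  gcongr
  · exact lint_le_Mc h x hr
  · exact tail_le h x hr hδ

/-- Cotlar constant -/
def Ccot (n : ℕ) (c δ : ℝ) : ℝ≥0∞ := ENNReal.ofReal c * (2 ^ n * vB n + Ctail n δ)

lemma Ccot_top (n : ℕ) (c : ℝ) {δ : ℝ} (hδ : 0 < δ) : Ccot n c δ ≠ ∞ := by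
  refine ENNReal.mul_ne_top ENNReal.ofReal_ne_top (ENNReal.add_ne_top.2 ⟨?_, Ctail_top n hδ⟩)
  exact ENNReal.mul_ne_top (by simp) (vB_top n)

lemma cotlar_pt (hT : IsCZO n T K c δ) {s ε : ℝ} (hs : 0 < s) (hε : 0 < ε) (hse : n * s ≤ ε)
    {g : Rn n → ℝ} (hg : Integrable g) {x x' : Rn n} (hx' : good s x')
    (hd : dist x x' ≤ ε / 2) :
    ‖Te K ε g x‖ₑ ≤ Ccot n c δ * Mc (fun y => ‖g y‖ₑ) x + ‖Us K s g x'‖ₑ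
      + ‖Us K s ((ball x (2 * ε)).indicator g) x'‖ₑ := by
  classical
  have hc := hT.c_pos
  have hδ := hT.delta_pos
  set B := ball x (2 * ε) with hB
  set u : Rn n → ℝ := fun y => if cell s y = cell s x' then 0 else K0 K x' y * g y with hu
  set v : Rn n → ℝ := fun y => if cell s y = cell s x' then 0 else K0 K x' y * B.indicator g y with hv
  have hui : Integrable u := Us_integrable hT hg hx'
  have hvi : Integrable v := Us_integrable hT (hg.indicator measurableSet_ball) hx'
  have hki := Ke_integrable hT hε x hg
  have key : Te K ε g x = (∫ y, (Ke K ε x y * g y - (u y - v y))) + Us K s g x'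
      - Us K s (B.indicator g) x' := by
    have e1 := integral_sub hki (hui.sub hvi)
    have e2 := integral_sub hui hvi
    simp only [Pi.sub_apply] at e1
    rw [e1, e2]
    simp only [Te, Us, hu, hv]
    ring
  have hbd : ‖∫ y, (Ke K ε x y * g y - (u y - v y))‖ₑ ≤ Ccot n c δ * Mc (fun y => ‖g y‖ₑ) x := by
    refine (enorm_integral_le_lintegral_enorm _).trans ?_
    have hpt : ∀ y, ‖Ke K ε x y * g y - (u y - v y)‖ₑ ≤
        (closedBall x (2 * ε)).indicator (fun y => ENNReal.ofReal (c / ε ^ n) * ‖g y‖ₑ) y +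
        {y | 2 * ε ≤ dist x y}.indicator (fun y => ENNReal.ofReal c *
          (ENNReal.ofReal ((2 * ε) ^ δ / dist x y ^ ((n : ℝ) + δ)) * ‖g y‖ₑ)) y := by
      intro y
      by_cases hy : y ∈ B
      · have h1 : u y - v y = 0 := by simp [hu, hv, hy]
        have h2 : y ∈ closedBall x (2 * ε) := ball_subset_closedBall hy
        rw [h1, sub_zero, indicator_of_mem h2]
        refine le_trans ?_ le_self_add
        rw [enorm_mul]
        gcongr
        rw [Real.enorm_eq_ofReal_abs]
        exact ENNReal.ofReal_le_ofReal (Ke_bound hT hε x y)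
      · have hy2 : 2 * ε ≤ dist x y := by
          simpa [hB, mem_ball, dist_comm] using hy
        have hne : x ≠ y := by
          rintro rfl; simp at hy2; linarith
        have hd' : 3 / 2 * ε ≤ dist x' y := by
          have := dist_triangle x x' y
          linarith
        have hne' : x' ≠ y := by
          rintro rfl; simp at hd'; linarith
        have hcell : cell s y ≠ cell s x' := by
          intro h
          have := cell_dist hs h
          rw [dist_comm] at this
          linarith
        have h1 : u y - v y = K x' y * g y := by
          simp [hu, hv, hy, hcell, K0_eq hne']
        have hm : y ∈ {y | 2 * ε ≤ dist x y} := hy2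
        rw [h1, indicator_of_mem hm]
        refine le_trans ?_ le_add_self
        have h3 : Ke K ε x y = K x y := by rw [Ke, ph_one hε hy2, mul_one]
        rw [h3, ← sub_mul, enorm_mul, ← mul_assoc]
        gcongr
        rw [Real.enorm_eq_ofReal_abs, ← ENNReal.ofReal_mul hc.le]
        refine ENNReal.ofReal_le_ofReal ((K_smooth1 hT hne (by linarith)).trans ?_)
        have h0 : 0 < dist x y := by linarith
        gcongr
        linarith
    refine (lintegral_mono hpt).trans ?_
    refine (near_far hg.enorm.aemeasurable x (by positivity) hδ _ _).trans ?_
    gcongr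
    rw [vol_cball x (by positivity), ← mul_assoc, ← ENNReal.ofReal_mul (by positivity), Ccot, mul_add,
      ← mul_assoc]
    gcongr
    have : c / ε ^ n * (2 * ε) ^ n = c * 2 ^ n := by
      have := hε.ne'
      rw [mul_pow]; field_simp
    rw [this, ENNReal.ofReal_mul hc.le, ENNReal.ofReal_pow (by norm_num)]
    simp
  rw [key]
  calc _ ≤ ‖(∫ y, (Ke K ε x y * g y - (u y - v y))) + Us K s g x'‖ₑ + ‖Us K s (B.indicator g) x'‖ₑ :=
        enorm_sub_le
    _ ≤ _ := by
        gcongr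
        refine (enorm_add_le _ _).trans ?_
        gcongr

lemma sq_cases {a b l : ℝ≥0∞} (h : 2 * l < a + b) : l ^ 2 ≤ a ^ 2 + b ^ 2 := by
  by_cases h1 : l ≤ a
  · exact le_add_right (by gcongr)
  · by_cases h2 : l ≤ b
    · exact le_add_left (by gcongr)
    · exfalso
      push Not at h1 h2
      have : a + b ≤ l + l := add_le_add h1.le h2.le
      rw [two_mul] at h
      exact absurd h (not_lt.2 this)

lemma cotlar_sq (hT : IsCZO n T K c δ) {B : ℝ≥0∞} (hB : ∀ s : ℝ, 0 < s → ∀ f : Rn n → ℝ,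
    Measurable f → Integrable f → BddSupp f →
    ∫⁻ x, ‖Us K s f x‖ₑ ^ 2 ≤ B * ∫⁻ x, ‖f x‖ₑ ^ 2)
    {s ε : ℝ} (hs : 0 < s) (hε : 0 < ε) (hse : n * s ≤ ε)
    {g : Rn n → ℝ} (hgm : Measurable g) (hg : Integrable g) (hgb : BddSupp g) {x : Rn n}
    {lam : ℝ≥0∞} (hl : 3 * lam < ‖Te K ε g x‖ₑ)
    (hM : Ccot n c δ * Mc (fun y => ‖g y‖ₑ) x ≤ lam) :
    lam ^ 2 ≤ Mc (fun y => ‖Us K s g y‖ₑ ^ 2) x + B * 4 ^ n * Mc (fun y => ‖g y‖ₑ ^ 2) x := by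
  set gB := (ball x (2 * ε)).indicator g with hgB
  set A := closedBall x (ε / 2) with hA
  have hlt : lam ≠ ∞ := by
    rintro rfl
    rw [ENNReal.mul_top (by norm_num)] at hl
    exact not_top_lt hl
  have hae : ∀ᵐ x' ∂(volume.restrict A), lam ^ 2 ≤ ‖Us K s g x'‖ₑ ^ 2 + ‖Us K s gB x'‖ₑ ^ 2 := by
    rw [ae_restrict_iff' measurableSet_closedBall]
    filter_upwards [good_ae hs] with x' hx' hxA
    have h1 := cotlar_pt hT hs hε hse hg hx' (x := x) (by rw [dist_comm]; exact hxA)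
    apply sq_cases
    have h2 : 3 * lam < lam + (‖Us K s g x'‖ₑ + ‖Us K s gB x'‖ₑ) := by
      refine hl.trans_le (h1.trans ?_)
      rw [add_assoc]
      gcongr
    have h3 : 3 * lam = lam + 2 * lam := by ring
    rw [h3] at h2
    exact (ENNReal.add_lt_add_iff_left hlt).1 h2
  have hmU := (Us_meas hT s hgm).enorm.pow_const 2
  have hgBm : Measurable gB := hgm.indicator measurableSet_ball
  have hgBb : BddSupp gB := by
    obtain ⟨R, hR⟩ := hgb
    refine ⟨R, fun y hy => hR y fun h => hy ?_⟩
    simp [hgB, h, indicator]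
  have h4 : volume A * lam ^ 2 ≤ volume A * Mc (fun y => ‖Us K s g y‖ₑ ^ 2) x +
      B * (volume (closedBall x (2 * ε)) * Mc (fun y => ‖g y‖ₑ ^ 2) x) := by
    calc volume A * lam ^ 2 = ∫⁻ x' in A, lam ^ 2 := by rw [setLIntegral_const, mul_comm]
      _ ≤ ∫⁻ x' in A, (‖Us K s g x'‖ₑ ^ 2 + ‖Us K s gB x'‖ₑ ^ 2) := lintegral_mono_ae hae
      _ = (∫⁻ x' in A, ‖Us K s g x'‖ₑ ^ 2) + ∫⁻ x' in A, ‖Us K s gB x'‖ₑ ^ 2 :=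
          lintegral_add_left hmU _
      _ ≤ volume A * Mc (fun y => ‖Us K s g y‖ₑ ^ 2) x + ∫⁻ x', ‖Us K s gB x'‖ₑ ^ 2 := by
          gcongr
          · exact lint_le_Mc _ x (by positivity)
          · exact Measure.restrict_le_self
      _ ≤ _ := by
          gcongr
          refine (hB s hs gB hgBm (hg.indicator measurableSet_ball) hgBb).trans ?_
          gcongr
          refine le_trans ?_ (lint_le_Mc _ x (by positivity))
          rw [← lintegral_indicator measurableSet_closedBall]
          refine lintegral_mono fun y => ?_
          by_cases hy : y ∈ ball x (2 * ε)
          · simp [hgB, hy, ball_subset_closedBall hy]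
          · simp [hgB, hy]
  have h5 : volume (closedBall x (2 * ε)) = 4 ^ n * volume A := by
    rw [hA, vol_cball x (by positivity), vol_cball x (by positivity), ← mul_assoc]
    congr 1
    have : 2 * ε = 4 * (ε / 2) := by ring
    rw [this, mul_pow, ENNReal.ofReal_mul (by positivity), ENNReal.ofReal_pow (by norm_num)]
    simp
  rw [h5] at h4
  have h6 : volume A * lam ^ 2 ≤ volume A * (Mc (fun y => ‖Us K s g y‖ₑ ^ 2) x +
      B * 4 ^ n * Mc (fun y => ‖g y‖ₑ ^ 2) x) := by
    refine h4.trans (le_of_eq ?_)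
    ring
  refine (ENNReal.mul_le_mul_iff_right ?_ ?_).1 h6
  · exact (measure_closedBall_pos volume x (by positivity)).ne'
  · exact measure_closedBall_lt_top.ne

lemma cotlar_set [NeZero n] (hT : IsCZO n T K c δ) {B : ℝ≥0∞} (hBt : B ≠ ∞)
    (hB : ∀ s : ℝ, 0 < s → ∀ f : Rn n → ℝ,
    Measurable f → Integrable f → BddSupp f →
    ∫⁻ x, ‖Us K s f x‖ₑ ^ 2 ≤ B * ∫⁻ x, ‖f x‖ₑ ^ 2)
    {s : ℝ} (hs : 0 < s)
    {g : Rn n → ℝ} (hgm : Measurable g) (hg : Integrable g) (hgb : BddSupp g)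
    {lam : ℝ≥0∞} :
    lam ^ 2 * volume {x | ∃ ε, 0 < ε ∧ n * s ≤ ε ∧ 3 * lam < ‖Te K ε g x‖ₑ} ≤
      (Ccot n c δ * 5 ^ n + 3 * 5 ^ n * B + 3 * (B * 4 ^ n * 5 ^ n)) *
      (lam * (∫⁻ y, ‖g y‖ₑ) + ∫⁻ y, ‖g y‖ₑ ^ 2) := by
  by_cases hl0 : lam = 0
  · simp [hl0]
  by_cases hlt : lam = ∞
  · have : {x | ∃ ε, 0 < ε ∧ n * s ≤ ε ∧ 3 * lam < ‖Te K ε g x‖ₑ} = ∅ := by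
      ext x
      simp [hlt, ENNReal.mul_top]
    rw [this]; simp
  set A1 := {x | lam < Ccot n c δ * Mc (fun y => ‖g y‖ₑ) x}
  set A2 := {x | lam ^ 2 / 3 < Mc (fun y => ‖Us K s g y‖ₑ ^ 2) x}
  set A3 := {x | lam ^ 2 / 3 < B * 4 ^ n * Mc (fun y => ‖g y‖ₑ ^ 2) x}
  have hsub : {x | ∃ ε, 0 < ε ∧ n * s ≤ ε ∧ 3 * lam < ‖Te K ε g x‖ₑ} ⊆ A1 ∪ (A2 ∪ A3) := by
    rintro x ⟨ε, hε, hse, h⟩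
    by_contra hx
    simp only [A1, A2, A3, mem_union, mem_ofPred_eq, not_or, not_lt] at hx
    obtain ⟨h1, h2, h3⟩ := hx
    have := cotlar_sq hT hB hs hε hse hgm hg hgb h h1
    have h4 : lam ^ 2 ≤ lam ^ 2 / 3 + lam ^ 2 / 3 := this.trans (add_le_add h2 h3)
    have h5 : lam ^ 2 = lam ^ 2 / 3 + lam ^ 2 / 3 + lam ^ 2 / 3 := (ENNReal.add_thirds _).symm
    have h6 : lam ^ 2 / 3 + lam ^ 2 / 3 < lam ^ 2 / 3 + lam ^ 2 / 3 + lam ^ 2 / 3 := by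
      apply ENNReal.lt_add_right
      · simp [ENNReal.div_eq_top, hlt]
      · simp [hl0]
    rw [← h5] at h6
    exact absurd h6 (not_lt.2 h4)
  have a1 : lam ^ 2 * volume A1 ≤ Ccot n c δ * 5 ^ n * (lam * ∫⁻ y, ‖g y‖ₑ) := by
    have := Mc_weak_mul (fun y => ‖g y‖ₑ) lam (Ccot n c δ) (Ccot_top n c hT.delta_pos)
    calc lam ^ 2 * volume A1 = lam * (lam * volume A1) := by ring
      _ ≤ lam * (Ccot n c δ * 5 ^ n * ∫⁻ y, ‖g y‖ₑ) := by gcongr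
      _ = _ := by ring
  have e3 : ∀ v : ℝ≥0∞, lam ^ 2 * v = 3 * (lam ^ 2 / 3 * v) := by
    intro v
    rw [← mul_assoc, ENNReal.mul_div_cancel (by norm_num) (by norm_num)]
  have a2 : lam ^ 2 * volume A2 ≤ 3 * 5 ^ n * B * ∫⁻ y, ‖g y‖ₑ ^ 2 := by
    have := Mc_weak (fun y => ‖Us K s g y‖ₑ ^ 2) (lam ^ 2 / 3)
    rw [e3]
    calc 3 * (lam ^ 2 / 3 * volume A2) ≤ 3 * (5 ^ n * (B * ∫⁻ y, ‖g y‖ₑ ^ 2)) := by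
          refine mul_le_mul_right (this.trans ?_) _
          gcongr
          exact hB s hs g hgm hg hgb
      _ = _ := by ring
  have a3 : lam ^ 2 * volume A3 ≤ 3 * (B * 4 ^ n * 5 ^ n) * ∫⁻ y, ‖g y‖ₑ ^ 2 := by
    have := Mc_weak_mul (fun y => ‖g y‖ₑ ^ 2) (lam ^ 2 / 3) (B * 4 ^ n)
      (ENNReal.mul_ne_top hBt (by simp))
    rw [e3, mul_assoc 3]
    gcongr
  calc _ ≤ lam ^ 2 * (volume A1 + (volume A2 + volume A3)) := by
        gcongr
        refine (measure_mono hsub).trans ((measure_union_le _ _).trans ?_)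
        gcongr
        exact measure_union_le _ _
    _ = lam ^ 2 * volume A1 + (lam ^ 2 * volume A2 + lam ^ 2 * volume A3) := by ring
    _ ≤ Ccot n c δ * 5 ^ n * (lam * ∫⁻ y, ‖g y‖ₑ) + (3 * 5 ^ n * B * (∫⁻ y, ‖g y‖ₑ ^ 2) +
        3 * (B * 4 ^ n * 5 ^ n) * ∫⁻ y, ‖g y‖ₑ ^ 2) := by gcongr
    _ ≤ Ccot n c δ * 5 ^ n * (lam * (∫⁻ y, ‖g y‖ₑ) + ∫⁻ y, ‖g y‖ₑ ^ 2) +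
        (3 * 5 ^ n * B * (lam * (∫⁻ y, ‖g y‖ₑ) + ∫⁻ y, ‖g y‖ₑ ^ 2) +
        3 * (B * 4 ^ n * 5 ^ n) * (lam * (∫⁻ y, ‖g y‖ₑ) + ∫⁻ y, ‖g y‖ₑ ^ 2)) := by
        gcongr
        · exact le_self_add
        · exact le_add_self
        · exact le_add_self
    _ = _ := by ring

theorem Ts_weak2 [NeZero n] (hT : IsCZO n T K c δ) : ∃ C : ℝ≥0∞, C ≠ ∞ ∧
    ∀ g : Rn n → ℝ, Measurable g → Integrable g → BddSupp g → ∀ lam : ℝ≥0∞,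
    lam ^ 2 * volume {x | 3 * lam < Ts K g x} ≤
      C * (lam * (∫⁻ y, ‖g y‖ₑ) + ∫⁻ y, ‖g y‖ₑ ^ 2) := by
  obtain ⟨B, hBt, hB⟩ := Us_L2 hT
  refine ⟨Ccot n c δ * 5 ^ n + 3 * 5 ^ n * B + 3 * (B * 4 ^ n * 5 ^ n), ?_, ?_⟩
  · have := Ccot_top n c hT.delta_pos
    refine ENNReal.add_ne_top.2 ⟨ENNReal.add_ne_top.2 ⟨?_, ?_⟩, ?_⟩
    · exact ENNReal.mul_ne_top this (by simp)
    · exact ENNReal.mul_ne_top (by finiteness) hBt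
    · finiteness
  intro g hgm hg hgb lam
  have e : {x | 3 * lam < Ts K g x} = ⋃ k : ℕ, {x | ∃ ε, 0 < ε ∧ n * (1 / ((k : ℝ) + 1)) ≤ ε ∧
      3 * lam < ‖Te K ε g x‖ₑ} := by
    ext x
    simp only [Ts, mem_ofPred_eq, mem_iUnion, lt_iSup_iff]
    constructor
    · rintro ⟨ε, hε, h⟩
      obtain ⟨k, hk⟩ := exists_nat_one_div_lt (show 0 < ε / (n + 1) by positivity)
      refine ⟨k, ε, hε, ?_, h⟩
      have hn : (0 : ℝ) ≤ n := by positivity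
      rw [lt_div_iff₀ (by positivity)] at hk
      have : (0 : ℝ) < 1 / ((k : ℝ) + 1) := by positivity
      nlinarith
    · rintro ⟨k, ε, hε, _, h⟩
      exact ⟨ε, hε, h⟩
  have hmono : Monotone fun k : ℕ => {x | ∃ ε, 0 < ε ∧ n * (1 / ((k : ℝ) + 1)) ≤ ε ∧
      3 * lam < ‖Te K ε g x‖ₑ} := by
    rintro k l hkl x ⟨ε, hε, h1, h2⟩
    refine ⟨ε, hε, le_trans ?_ h1, h2⟩
    gcongr
  rw [e, hmono.measure_iUnion, ENNReal.mul_iSup]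
  refine iSup_le fun k => ?_
  exact cotlar_set hT hBt hB (by positivity) hgm hg hgb

end SparseCZ

namespace SparseCZ
open Metric
variable {n : ℕ}
variable {T : (Rn n → ℝ) → Rn n → ℝ} {K : Rn n → Rn n → ℝ} {c δ : ℝ}

lemma leb_le [NeZero n] {D : Set (Cube n)} (hD : IsDyadicGrid D) {f : Rn n → ℝ} (hf : Integrable f)
    (lam : ℝ≥0∞) : ∀ᵐ x, (∀ P ∈ D, x ∈ P.toSet → ∫⁻ y in P.toSet, ‖f y‖ₑ ≤ lam * volume P.toSet) →
      ‖f x‖ₑ ≤ lam := by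
  filter_upwards [(IsUnifLocDoublingMeasure.vitaliFamily (volume : Measure (Rn n)) 1).ae_tendsto_lintegral_enorm_sub_div
    hf.locallyIntegrable] with x hx hP
  have hn : (0 : ℝ) < n := by exact_mod_cast Nat.pos_of_ne_zero (NeZero.ne n)
  have hδ : Tendsto (fun j : ℕ => (n : ℝ) * (1 / 2) ^ j) atTop (𝓝[>] 0) := by
    rw [tendsto_nhdsWithin_iff]
    constructor
    · have := (tendsto_pow_atTop_nhds_zero_of_lt_one (r := (1 / 2 : ℝ)) (by norm_num) (by norm_num)).const_mul (n : ℝ)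
      simpa using this
    · exact Eventually.of_forall fun j => by simp only [mem_Ioi]; positivity
  have ht := hx.comp (IsUnifLocDoublingMeasure.tendsto_closedBall_filterAt volume (K := 1) (x := x)
    (fun _ => x) _ hδ (Eventually.of_forall fun j => by
      refine mem_closedBall_self ?_
      positivity))
  set κ : ℝ≥0∞ := ENNReal.ofReal ((n : ℝ) ^ n) * vB n with hκ
  have hκt : κ ≠ ∞ := ENNReal.mul_ne_top ENNReal.ofReal_ne_top (vB_top n)
  have hb : ∀ j : ℕ, ‖f x‖ₑ ≤ κ * ((∫⁻ y in closedBall x ((n : ℝ) * (1 / 2) ^ j), ‖f y - f x‖ₑ) /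
      volume (closedBall x ((n : ℝ) * (1 / 2) ^ j))) + lam := by
    intro j
    obtain ⟨P, ⟨hPD, hPs, hxP⟩, -⟩ := hD.2.2 (-(j : ℤ)) x
    have hPs' : P.side = (1 / 2) ^ j := by rw [hPs]; simp
    have h1 := hP P hPD hxP
    set A := closedBall x ((n : ℝ) * (1 / 2) ^ j) with hA
    have hPA : P.toSet ⊆ A := by
      intro y hy
      have := P.dist_le hy hxP
      rw [hPs'] at this
      exact this
    have hvA : volume A = κ * volume P.toSet := by
      rw [hA, vol_cball x (by positivity), P.volume_eq, hκ, hPs', mul_pow, ENNReal.ofReal_mul (by positivity)]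
      ring
    have h2 : ‖f x‖ₑ * volume P.toSet ≤ (∫⁻ y in A, ‖f y - f x‖ₑ) + lam * volume P.toSet := by
      calc ‖f x‖ₑ * volume P.toSet = ∫⁻ y in P.toSet, ‖f x‖ₑ := by rw [setLIntegral_const]
        _ ≤ ∫⁻ y in P.toSet, (‖f y - f x‖ₑ + ‖f y‖ₑ) := by
            refine lintegral_mono fun y => ?_
            have : f x = - (f y - f x) + f y := by ring
            calc ‖f x‖ₑ = ‖- (f y - f x) + f y‖ₑ := by rw [← this]
              _ ≤ _ := by
                refine (enorm_add_le _ _).trans ?_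
                rw [enorm_neg]
        _ = (∫⁻ y in P.toSet, ‖f y - f x‖ₑ) + ∫⁻ y in P.toSet, ‖f y‖ₑ :=
            lintegral_add_right' _ hf.enorm.aemeasurable.restrict
        _ ≤ _ := by
            gcongr
    have hp0 := P.volume_ne_zero
    have hpt := P.volume_ne_top
    have hA0 : volume A ≠ 0 := (measure_closedBall_pos volume x (by positivity)).ne'
    have hAt : volume A ≠ ∞ := measure_closedBall_lt_top.ne
    rw [← ENNReal.mul_le_mul_iff_left hp0 hpt, add_mul]
    refine h2.trans (le_of_eq ?_)
    congr 1
    calc ∫⁻ y in A, ‖f y - f x‖ₑ = volume A * ((∫⁻ y in A, ‖f y - f x‖ₑ) / volume A) :=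
          (ENNReal.mul_div_cancel hA0 hAt).symm
      _ = κ * volume P.toSet * ((∫⁻ y in A, ‖f y - f x‖ₑ) / volume A) := by rw [← hvA]
      _ = _ := by ring
  have hlim := (ENNReal.Tendsto.const_mul ht (Or.inr hκt)).add (tendsto_const_nhds (x := lam))
  rw [mul_zero, zero_add] at hlim
  exact ge_of_tendsto' hlim hb

structure CZdec (D : Set (Cube n)) (f : Rn n → ℝ) (lam : ℝ≥0∞) (M : Set (Cube n)) (g : Rn n → ℝ) : Prop where
  sub : M ⊆ D
  disj : M.PairwiseDisjoint Cube.toSet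
  big : ∀ P ∈ M, lam * volume P.toSet ≤ ∫⁻ y in P.toSet, ‖f y‖ₑ
  gm : Measurable g
  mean : ∀ P ∈ M, ∫ y in P.toSet, (f y - g y) = 0
  off : ∀ x, x ∉ (⋃ P ∈ M, Cube.toSet P) → g x = f x
  bdd : ∀ᵐ x, ‖g x‖ₑ ≤ 2 ^ n * lam
  norm : ∀ P ∈ M, ∫⁻ y in P.toSet, ‖g y‖ₑ ≤ ∫⁻ y in P.toSet, ‖f y‖ₑ
  supp : BddSupp g

lemma CZ_exists [NeZero n] {D : Set (Cube n)} (hD : IsDyadicGrid D) {f : Rn n → ℝ} (hfm : Measurable f)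
    (hf : Integrable f) (hfb : BddSupp f) {lam : ℝ≥0∞} (hl0 : lam ≠ 0) (hlt : lam ≠ ∞) :
    ∃ M g, CZdec D f lam M g := by
  classical
  set F : Set (Cube n) := {P | P ∈ D ∧ lam * volume P.toSet < ∫⁻ y in P.toSet, ‖f y‖ₑ} with hF
  have hFD : F ⊆ D := fun P hP => hP.1
  have hfin : ∫⁻ y, ‖f y‖ₑ ≠ ∞ := hf.hasFiniteIntegral.ne
  obtain ⟨L, hL⟩ : ∃ L : ℝ, ∀ P ∈ F, P.side ≤ L := by
    refine ⟨max 1 ((∫⁻ y, ‖f y‖ₑ) / lam).toReal, fun P hP => ?_⟩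
    by_cases h1 : P.side ≤ 1
    · exact le_max_of_le_left h1
    · push Not at h1
      refine le_max_of_le_right ?_
      have h2 : volume P.toSet ≤ (∫⁻ y, ‖f y‖ₑ) / lam := by
        rw [ENNReal.le_div_iff_mul_le (Or.inl hl0) (Or.inl hlt), mul_comm]
        exact hP.2.le.trans (setLIntegral_le_lintegral _ _)
      have h3 : ENNReal.ofReal P.side ≤ (∫⁻ y, ‖f y‖ₑ) / lam := by
        refine le_trans ?_ h2
        rw [P.volume_eq]
        exact ENNReal.ofReal_le_ofReal (le_self_pow₀ h1.le (NeZero.ne n))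
      exact (ENNReal.ofReal_le_iff_le_toReal (ENNReal.div_ne_top hfin hl0)).1 h3
  set M := maxFam F with hM
  have hMF : M ⊆ F := fun P hP => hP.1
  have hMc : M.Countable := (grid_countable hD).mono (hMF.trans hFD)
  have hdisj : M.PairwiseDisjoint Cube.toSet := maxFam_disjoint hD hFD
  haveI : Countable M := hMc.to_subtype
  set Ω : Set (Rn n) := ⋃ P ∈ M, Cube.toSet P with hΩ
  have hΩm : MeasurableSet Ω := MeasurableSet.biUnion hMc fun P _ => P.measurableSet
  have hup : ∀ P ∈ M, ∫⁻ y in P.toSet, ‖f y‖ₑ ≤ 2 ^ n * lam * volume P.toSet := by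
    intro P hP
    obtain ⟨R, hR, hs, hsub, hv⟩ := grid_parent hD (hFD (hMF hP))
    have hRF : R ∉ F := by
      intro h
      have := hP.2 R h hsub
      rw [this] at hs
      have := P.side_pos
      linarith
    have h1 : ∫⁻ y in R.toSet, ‖f y‖ₑ ≤ lam * volume R.toSet := by
      by_contra h
      exact hRF ⟨hR, not_le.1 h⟩
    calc ∫⁻ y in P.toSet, ‖f y‖ₑ ≤ ∫⁻ y in R.toSet, ‖f y‖ₑ := lintegral_mono_set hsub
      _ ≤ _ := h1
      _ = _ := by rw [hv]; ring
  obtain ⟨g, hgm, hg⟩ := exists_measurable_piecewise (ι := Option M)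
    (fun o => o.elim Ωᶜ fun P => P.1.toSet)
    (by rintro (_ | P); exacts [hΩm.compl, P.1.measurableSet])
    (fun o => o.elim f fun P => fun _ => (volume.real P.1.toSet)⁻¹ * ∫ y in P.1.toSet, f y)
    (by rintro (_ | P); exacts [hfm, measurable_const])
    (by
      rintro (_ | P) (_ | R) hne
      · exact absurd rfl hne
      · rintro x ⟨h1, h2⟩
        exact absurd (mem_biUnion R.2 h2) h1
      · rintro x ⟨h1, h2⟩
        exact absurd (mem_biUnion P.2 h1) h2
      · rintro x ⟨h1, h2⟩
        have : P.1 ≠ R.1 := fun h => hne (by rw [Subtype.ext h])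
        exact absurd h2 (disjoint_left.1 (hdisj P.2 R.2 this) h1))
  have hgo : ∀ x, x ∉ Ω → g x = f x := fun x hx => hg none hx
  have hgP : ∀ P ∈ M, ∀ x ∈ P.toSet, g x = (volume.real P.toSet)⁻¹ * ∫ y in P.toSet, f y :=
    fun P hP x hx => hg (some ⟨P, hP⟩) hx
  have hgn : ∀ P ∈ M, ∀ x ∈ P.toSet, ‖g x‖ₑ * volume P.toSet ≤ ∫⁻ y in P.toSet, ‖f y‖ₑ := by
    intro P hP x hx
    have h1 : volume.real P.toSet ≠ 0 := by
      simp [Measure.real, ENNReal.toReal_eq_zero_iff, P.volume_ne_zero, P.volume_ne_top]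
    have h2 : ‖g x‖ₑ * volume P.toSet = ‖∫ y in P.toSet, f y‖ₑ := by
      have : ∫ y in P.toSet, f y = g x * volume.real P.toSet := by
        rw [hgP P hP x hx]; field_simp
      rw [this, enorm_mul]
      congr 1
      rw [Real.enorm_eq_ofReal measureReal_nonneg, Measure.real, ENNReal.ofReal_toReal P.volume_ne_top]
    rw [h2]
    exact enorm_integral_le_lintegral_enorm _
  refine ⟨M, g, ⟨hMF.trans hFD, hdisj, fun P hP => (hMF hP).2.le, hgm, ?_, hgo, ?_, ?_, ?_⟩⟩
  · intro P hP
    have e : ∀ y ∈ P.toSet, g y = (volume.real P.toSet)⁻¹ * ∫ y in P.toSet, f y := hgP P hP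
    have h1 : volume.real P.toSet ≠ 0 := by
      simp [Measure.real, ENNReal.toReal_eq_zero_iff, P.volume_ne_zero, P.volume_ne_top]
    rw [setIntegral_congr_fun P.measurableSet (g := fun y => f y - (volume.real P.toSet)⁻¹ * ∫ y in P.toSet, f y)
      (fun y hy => by simp only [e y hy])]
    rw [integral_sub hf.integrableOn]
    · rw [setIntegral_const, smul_eq_mul]
      field_simp
      ring
    · exact integrableOn_const P.volume_ne_top
  · filter_upwards [leb_le hD hf lam] with x hx
    by_cases h : x ∈ Ω
    · obtain ⟨P, hP, hxP⟩ := mem_iUnion₂.1 h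
      have := (hgn P hP x hxP).trans (hup P hP)
      exact (ENNReal.mul_le_mul_iff_left P.volume_ne_zero P.volume_ne_top).1 this
    · rw [hgo x h]
      refine (hx ?_).trans ?_
      · intro P hP hxP
        by_contra h'
        obtain ⟨R, hR, hPR⟩ := maxFam_exists hD hFD hL (P := P) ⟨hP, not_le.1 h'⟩
        exact h (mem_biUnion hR (hPR hxP))
      · have : (1 : ℝ≥0∞) ≤ 2 ^ n := one_le_pow₀ (by norm_num)
        calc lam = 1 * lam := (one_mul _).symm
          _ ≤ _ := by gcongr
  · intro P hP
    have h1 := hgn P hP P.pt P.pt_mem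
    calc ∫⁻ y in P.toSet, ‖g y‖ₑ = ∫⁻ y in P.toSet, ‖g P.pt‖ₑ := by
          refine setLIntegral_congr_fun P.measurableSet fun y hy => ?_
          simp only [hgP P hP y hy, hgP P hP P.pt P.pt_mem]
      _ = ‖g P.pt‖ₑ * volume P.toSet := by rw [setLIntegral_const]
      _ ≤ _ := h1
  · obtain ⟨R, hR⟩ := hfb
    refine ⟨R + n * max L 0, fun y hy => ?_⟩
    by_cases h : y ∈ Ω
    · obtain ⟨P, hP, hyP⟩ := mem_iUnion₂.1 h
      obtain ⟨z, hz, hfz⟩ : ∃ z ∈ P.toSet, f z ≠ 0 := by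
        by_contra hcon
        push Not at hcon
        have h1 := (hMF hP).2
        rw [setLIntegral_congr_fun P.measurableSet (g := fun _ => 0)
          (fun y hy => by simp [hcon y hy])] at h1
        simp at h1
      have h2 := P.dist_le hyP hz
      have h3 : ‖y‖ ≤ ‖z‖ + dist y z := by
        rw [dist_eq_norm]
        have := norm_add_le z (y - z)
        simpa using this
      have h4 : (n : ℝ) * P.side ≤ n * max L 0 := by
        gcongr
        exact le_max_of_le_left (hL P (hMF hP))
      linarith [hR z hfz]
    · rw [hgo y h] at hy
      have : (0 : ℝ) ≤ n * max L 0 := by positivity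
      linarith [hR y hy]

end SparseCZ

namespace SparseCZ
open Metric
variable {n : ℕ}
variable {T : (Rn n → ℝ) → Rn n → ℝ} {K : Rn n → Rn n → ℝ} {c δ : ℝ}

lemma bad_pt [NeZero n] (hT : IsCZO n T K c δ) {ε : ℝ} (hε : 0 < ε) (P : Cube n) {b : Rn n → ℝ}
    (hb : Integrable b) (hb0 : ∫ y in P.toSet, b y = 0) {x : Rn n}
    (hx : 2 * n * P.side ≤ dist P.pt x) :
    ‖∫ y in P.toSet, Ke K ε x y * b y‖ₑ ≤ ENNReal.ofReal (5 * c) *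
      (ENNReal.ofReal ((2 * n * P.side) ^ δ / dist P.pt x ^ ((n : ℝ) + δ)) *
        ∫⁻ y in P.toSet, ‖b y‖ₑ) := by
  have hn : (0 : ℝ) < n := by exact_mod_cast Nat.pos_of_ne_zero (NeZero.ne n)
  have hs := P.side_pos
  have hc := hT.c_pos
  have hδ := hT.delta_pos
  have hpos : 0 < dist P.pt x := lt_of_lt_of_le (by positivity) hx
  have e : ∫ y in P.toSet, Ke K ε x y * b y = ∫ y in P.toSet, (Ke K ε x y - Ke K ε x P.pt) * b y := by
    simp only [sub_mul]
    rw [integral_sub (Ke_integrable hT hε x hb).integrableOn (hb.const_mul _).integrableOn,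
      integral_const_mul, hb0]
    simp
  rw [e]
  refine (enorm_integral_le_lintegral_enorm _).trans ?_
  rw [← mul_assoc, ← lintegral_const_mul'' _ hb.enorm.aemeasurable.restrict]
  refine setLIntegral_mono' P.measurableSet fun y hy => ?_
  rw [enorm_mul]
  gcongr
  rw [Real.enorm_eq_ofReal_abs, ← ENNReal.ofReal_mul (by positivity)]
  refine ENNReal.ofReal_le_ofReal ?_
  have hd := P.dist_le P.pt_mem hy
  rw [abs_sub_comm]
  refine (Ke_smooth2 hT hε (dist_pos.1 hpos) (x' := y) (by linarith)).trans ?_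
  gcongr
  nlinarith

lemma bad_int (x : Rn n) {r δ : ℝ} (hr : 0 < r) (hδ : 0 < δ) :
    ∫⁻ y in {y | r ≤ dist x y}, ENNReal.ofReal (r ^ δ / dist x y ^ ((n : ℝ) + δ)) ≤ Ctail n δ := by
  have := tail_le (fun _ => 1) x hr hδ
  simp only [mul_one] at this
  refine this.trans ?_
  calc Ctail n δ * Mc (fun _ => 1) x ≤ Ctail n δ * 1 := by gcongr; exact Mc_one_le x
    _ = _ := mul_one _

/-- constant for the bad part -/
def Cbad (n : ℕ) (c δ : ℝ) : ℝ≥0∞ :=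
  ENNReal.ofReal ((2 * n) ^ n) * vB n + ENNReal.ofReal (5 * c) * Ctail n δ * 2

lemma Cbad_top (n : ℕ) (c : ℝ) {δ : ℝ} (hδ : 0 < δ) : Cbad n c δ ≠ ∞ := by
  have := Ctail_top n hδ
  have := vB_top n
  unfold Cbad
  finiteness

lemma bad_weak [NeZero n] (hT : IsCZO n T K c δ) {D : Set (Cube n)} (hD : IsDyadicGrid D)
    {f : Rn n → ℝ} (hf : Integrable f) {lam : ℝ≥0∞}
    {M : Set (Cube n)} {g : Rn n → ℝ} (h : CZdec D f lam M g) (hg : Integrable g) :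
    lam * volume {x | lam < Ts K (fun y => f y - g y) x} ≤ Cbad n c δ * ∫⁻ y, ‖f y‖ₑ := by
  have hn : (0 : ℝ) < n := by exact_mod_cast Nat.pos_of_ne_zero (NeZero.ne n)
  have hMc : M.Countable := (grid_countable hD).mono h.sub
  have : Countable M := hMc.to_subtype
  set b : Rn n → ℝ := fun y => f y - g y with hb
  have hbi : Integrable b := hf.sub hg
  have hδ := hT.delta_pos
  have hdis : Pairwise (Function.onFun Disjoint fun P : M => P.1.toSet) := by
    intro P R hne
    exact h.disj P.2 R.2 (fun e => hne (Subtype.ext e))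
  set r : M → ℝ := fun P => 2 * n * P.1.side with hr
  have hr0 : ∀ P, 0 < r P := fun P => by have := P.1.side_pos; simp only [hr]; positivity
  set Φ : Rn n → ℝ≥0∞ := fun x => ∑' P : M, {x | r P ≤ dist P.1.pt x}.indicator (fun x =>
    ENNReal.ofReal (5 * c) * (ENNReal.ofReal (r P ^ δ / dist P.1.pt x ^ ((n : ℝ) + δ)) *
        ∫⁻ y in P.1.toSet, ‖b y‖ₑ)) x with hΦ
  have hms : ∀ P : M, MeasurableSet {x : Rn n | r P ≤ dist P.1.pt x} := fun P =>
    measurableSet_le measurable_const (measurable_const.dist measurable_id)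
  have hmi : ∀ P : M, Measurable fun x : Rn n => ENNReal.ofReal (r P ^ δ / dist P.1.pt x ^ ((n : ℝ) + δ)) := by
    intro P
    fun_prop
  have hmt : ∀ P : M, Measurable ({x | r P ≤ dist P.1.pt x}.indicator (fun x =>
      ENNReal.ofReal (5 * c) * (ENNReal.ofReal (r P ^ δ / dist P.1.pt x ^ ((n : ℝ) + δ)) *
        ∫⁻ y in P.1.toSet, ‖b y‖ₑ))) := fun P =>
    (((hmi P).mul_const _).const_mul _).indicator (hms P)
  have hΦm : Measurable Φ := Measurable.tsum hmt
  have hsum : ∑' P : M, ∫⁻ y in P.1.toSet, ‖f y‖ₑ ≤ ∫⁻ y, ‖f y‖ₑ := by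
    rw [← lintegral_iUnion (fun P : M => P.1.measurableSet) hdis]
    exact setLIntegral_le_lintegral _ _
  have hbP : ∀ P : M, ∫⁻ y in P.1.toSet, ‖b y‖ₑ ≤ 2 * ∫⁻ y in P.1.toSet, ‖f y‖ₑ := by
    intro P
    calc ∫⁻ y in P.1.toSet, ‖b y‖ₑ ≤ ∫⁻ y in P.1.toSet, (‖f y‖ₑ + ‖g y‖ₑ) :=
          lintegral_mono fun y => enorm_sub_le
      _ = (∫⁻ y in P.1.toSet, ‖f y‖ₑ) + ∫⁻ y in P.1.toSet, ‖g y‖ₑ :=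
          lintegral_add_left' hf.enorm.aemeasurable.restrict _
      _ ≤ (∫⁻ y in P.1.toSet, ‖f y‖ₑ) + ∫⁻ y in P.1.toSet, ‖f y‖ₑ := by
          gcongr 1
          exact h.norm P.1 P.2
      _ = _ := (two_mul _).symm
  have hΦi : ∫⁻ x, Φ x ≤ ENNReal.ofReal (5 * c) * Ctail n δ * 2 * ∫⁻ y, ‖f y‖ₑ := by
    rw [hΦ, lintegral_tsum fun P => (hmt P).aemeasurable]
    calc _ ≤ ∑' P : M, ENNReal.ofReal (5 * c) * Ctail n δ * 2 * ∫⁻ y in P.1.toSet, ‖f y‖ₑ := by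
          refine ENNReal.tsum_le_tsum fun P => ?_
          rw [lintegral_indicator (hms P), lintegral_const_mul _ ((hmi P).mul_const _),
            lintegral_mul_const _ (hmi P)]
          calc _ ≤ ENNReal.ofReal (5 * c) * (Ctail n δ * (2 * ∫⁻ y in P.1.toSet, ‖f y‖ₑ)) := by
                gcongr
                · exact bad_int _ (hr0 P) hδ
                · exact hbP P
            _ = _ := by ring
      _ = _ := ENNReal.tsum_mul_left
      _ ≤ _ := by gcongr
  have hsub : {x | lam < Ts K b x} ⊆ (⋃ P : M, closedBall P.1.pt (r P)) ∪ {x | lam ≤ Φ x} := by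
    intro x hx
    by_cases hxU : x ∈ ⋃ P : M, closedBall P.1.pt (r P)
    · exact Or.inl hxU
    right
    have hx' : lam < Ts K b x := hx
    refine hx'.le.trans ?_
    have hfar : ∀ P : M, r P ≤ dist P.1.pt x := by
      intro P
      simp only [mem_iUnion, mem_closedBall, not_exists, not_le] at hxU
      rw [dist_comm]
      exact (hxU P).le
    refine iSup₂_le fun ε hε => ?_
    have hKi := Ke_integrable hT hε x hbi
    have e1 : Te K ε b x = ∫ y in ⋃ P : M, P.1.toSet, Ke K ε x y * b y := by
      rw [Te, setIntegral_eq_integral_of_forall_compl_eq_zero]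
      intro y hy
      have : g y = f y := h.off y (by
        simpa [iUnion_coe_set] using hy)
      simp [hb, this]
    rw [e1, integral_iUnion (fun P : M => P.1.measurableSet) hdis hKi.integrableOn]
    refine enorm_tsum_le_tsum_enorm.trans ?_
    refine ENNReal.tsum_le_tsum fun P => ?_
    rw [indicator_of_mem (show x ∈ {x | r P ≤ dist P.1.pt x} from hfar P)]
    exact bad_pt hT hε P.1 hbi (h.mean P.1 P.2) (hfar P)
  have hU : lam * volume (⋃ P : M, closedBall P.1.pt (r P)) ≤
      ENNReal.ofReal ((2 * n) ^ n) * vB n * ∫⁻ y, ‖f y‖ₑ := by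
    calc _ ≤ lam * ∑' P : M, volume (closedBall P.1.pt (r P)) := by
          gcongr
          exact measure_iUnion_le _
      _ = ∑' P : M, ENNReal.ofReal ((2 * n) ^ n) * vB n * (lam * volume P.1.toSet) := by
          rw [← ENNReal.tsum_mul_left]
          refine tsum_congr fun P => ?_
          rw [vol_cball _ (hr0 P).le, P.1.volume_eq, hr]
          simp only []
          rw [mul_pow, ENNReal.ofReal_mul (by positivity)]
          ring
      _ ≤ ∑' P : M, ENNReal.ofReal ((2 * n) ^ n) * vB n * ∫⁻ y in P.1.toSet, ‖f y‖ₑ := by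
          refine ENNReal.tsum_le_tsum fun P => ?_
          gcongr 1
          exact h.big P.1 P.2
      _ = _ := ENNReal.tsum_mul_left
      _ ≤ _ := by gcongr
  calc lam * volume {x | lam < Ts K b x} ≤ lam * (volume (⋃ P : M, closedBall P.1.pt (r P)) +
        volume {x | lam ≤ Φ x}) := by
        gcongr
        exact (measure_mono hsub).trans (measure_union_le _ _)
    _ = lam * volume (⋃ P : M, closedBall P.1.pt (r P)) + lam * volume {x | lam ≤ Φ x} := mul_add _ _ _
    _ ≤ _ := by
        rw [Cbad, add_mul]
        gcongr ?_ + ?_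
        exact (mul_meas_ge_le_lintegral hΦm lam).trans hΦi

lemma Ts_add_le (hT : IsCZO n T K c δ) {f g : Rn n → ℝ} (hf : Integrable f) (hg : Integrable g) (x : Rn n) :
    Ts K f x ≤ Ts K g x + Ts K (fun y => f y - g y) x := by
  refine iSup₂_le fun ε hε => ?_
  have e : Te K ε f x = Te K ε g x + Te K ε (fun y => f y - g y) x := by
    simp only [Te]
    have h2 := integral_add (Ke_integrable hT hε x hg) (Ke_integrable hT hε x (hf.sub hg))
    simp only [Pi.sub_apply] at h2
    rw [← h2]
    congr 1
    ext y
    ring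
  rw [e]
  refine (enorm_add_le _ _).trans ?_
  gcongr
  · exact le_iSup₂_of_le ε hε le_rfl
  · exact le_iSup₂_of_le ε hε le_rfl

theorem Ts_weak1 [NeZero n] (hT : IsCZO n T K c δ) : ∃ C : ℝ≥0∞, C ≠ ∞ ∧
    ∀ D : Set (Cube n), IsDyadicGrid D →
    ∀ f : Rn n → ℝ, Measurable f → Integrable f → BddSupp f → ∀ lam : ℝ≥0∞,
    lam * volume {x | lam < Ts K f x} ≤ C * ∫⁻ y, ‖f y‖ₑ := by
  obtain ⟨C2, hC2t, hC2⟩ := Ts_weak2 hT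
  refine ⟨4 * (C2 * (1 + 2 ^ n) + Cbad n c δ), ?_, ?_⟩
  · have := Cbad_top n c hT.delta_pos
    finiteness
  intro D hD f hfm hf hfb lam'
  by_cases hl0' : lam' = 0
  · simp [hl0']
  by_cases hlt' : lam' = ∞
  · simp [hlt']
  obtain ⟨lam, hlam⟩ : ∃ lam : ℝ≥0∞, lam = lam' / 4 := ⟨_, rfl⟩
  have hl4 : lam' = 4 * lam := by rw [hlam, ENNReal.mul_div_cancel (by norm_num) (by norm_num)]
  have hl0 : lam ≠ 0 := by rintro rfl; simp at hl4; exact hl0' hl4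
  have hlt : lam ≠ ∞ := by rintro rfl; simp at hl4; exact hlt' hl4
  obtain ⟨M, g, h⟩ := CZ_exists hD hfm hf hfb hl0 hlt
  have hMc : M.Countable := (grid_countable hD).mono h.sub
  have hΩm : MeasurableSet (⋃ P ∈ M, Cube.toSet P) := MeasurableSet.biUnion hMc fun P _ => P.measurableSet
  have hgf : ∫⁻ y, ‖g y‖ₑ ≤ ∫⁻ y, ‖f y‖ₑ := by
    rw [← lintegral_add_compl _ hΩm, ← lintegral_add_compl (fun y => ‖f y‖ₑ) hΩm]
    gcongr ?_ + ?_
    · rw [lintegral_biUnion hMc (fun P _ => P.measurableSet) h.disj,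
        lintegral_biUnion hMc (fun P _ => P.measurableSet) h.disj]
      exact ENNReal.tsum_le_tsum fun P => h.norm P.1 P.2
    · refine le_of_eq (setLIntegral_congr_fun hΩm.compl fun y hy => ?_)
      simp only [h.off y hy]
  have hgi : Integrable g := ⟨h.gm.aestronglyMeasurable, lt_of_le_of_lt hgf hf.hasFiniteIntegral⟩
  have hg2 : ∫⁻ y, ‖g y‖ₑ ^ 2 ≤ 2 ^ n * lam * ∫⁻ y, ‖f y‖ₑ := by
    calc ∫⁻ y, ‖g y‖ₑ ^ 2 ≤ ∫⁻ y, 2 ^ n * lam * ‖g y‖ₑ := by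
          refine lintegral_mono_ae ?_
          filter_upwards [h.bdd] with y hy
          rw [sq]
          gcongr
      _ = 2 ^ n * lam * ∫⁻ y, ‖g y‖ₑ := lintegral_const_mul _ h.gm.enorm
      _ ≤ _ := by gcongr
  have a1 : lam * volume {x | 3 * lam < Ts K g x} ≤ C2 * (1 + 2 ^ n) * ∫⁻ y, ‖f y‖ₑ := by
    have := hC2 g h.gm hgi h.supp lam
    rw [← ENNReal.mul_le_mul_iff_right hl0 hlt]
    calc lam * (lam * volume {x | 3 * lam < Ts K g x}) = lam ^ 2 * volume {x | 3 * lam < Ts K g x} := by ring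
      _ ≤ _ := this
      _ ≤ C2 * (lam * (∫⁻ y, ‖f y‖ₑ) + 2 ^ n * lam * ∫⁻ y, ‖f y‖ₑ) := by gcongr
      _ = _ := by ring
  have a2 := bad_weak hT hD hf h hgi
  have hsub : {x | lam' < Ts K f x} ⊆ {x | 3 * lam < Ts K g x} ∪ {x | lam < Ts K (fun y => f y - g y) x} := by
    intro x hx
    by_contra hcon
    simp only [mem_union, mem_ofPred_eq, not_or, not_lt] at hcon
    have h1 : Ts K f x ≤ 3 * lam + lam := (Ts_add_le hT hf hgi x).trans (add_le_add hcon.1 hcon.2)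
    have h2 : 3 * lam + lam = lam' := by rw [hl4]; ring
    rw [h2] at h1
    exact absurd hx (not_lt.2 h1)
  calc lam' * volume {x | lam' < Ts K f x} ≤ lam' * (volume {x | 3 * lam < Ts K g x} +
        volume {x | lam < Ts K (fun y => f y - g y) x}) := by
        gcongr
        exact (measure_mono hsub).trans (measure_union_le _ _)
    _ = 4 * (lam * volume {x | 3 * lam < Ts K g x} +
        lam * volume {x | lam < Ts K (fun y => f y - g y) x}) := by rw [hl4]; ring
    _ ≤ 4 * (C2 * (1 + 2 ^ n) * (∫⁻ y, ‖f y‖ₑ) + Cbad n c δ * ∫⁻ y, ‖f y‖ₑ) := by gcongr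
    _ = _ := by ring

end SparseCZ

namespace SparseCZ
open Metric
variable {n : ℕ}
variable {T : (Rn n → ℝ) → Rn n → ℝ} {K : Rn n → Rn n → ℝ} {c δ : ℝ}

/-- pairs of truncation radii -/
abbrev TI := {e : ℝ × ℝ // 0 < e.1 ∧ e.1 < e.2}

lemma TI.pos2 (e : TI) : 0 < e.1.2 := e.2.1.trans e.2.2

/-- smooth two-sided truncation of the kernel -/
def kk (K : Rn n → Rn n → ℝ) (e : TI) (x y : Rn n) : ℝ := Ke K e.1.1 x y - Ke K e.1.2 x y

/-- smooth two-sided truncated operator -/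
def Ff (K : Rn n → Rn n → ℝ) (f : Rn n → ℝ) (e : TI) (x : Rn n) : ℝ := ∫ y, kk K e x y * f y

/-- the local coefficient -/
def aQ (δ : ℝ) (h : Rn n → ℝ≥0∞) (Q : Cube n) : ℝ≥0∞ :=
  ∑' m : ℕ, ENNReal.ofReal ((2 : ℝ) ^ (-(m : ℝ) * δ)) * avgE (Q.dilatePow m).toSet h

lemma avg_le_aQ (δ : ℝ) (h : Rn n → ℝ≥0∞) (Q : Cube n) (m : ℕ) :
    ENNReal.ofReal ((2 : ℝ) ^ (-(m : ℝ) * δ)) * avgE (Q.dilatePow m).toSet h ≤ aQ δ h Q :=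
  ENNReal.le_tsum m

lemma lint_le_aQ (δ : ℝ) (h : Rn n → ℝ≥0∞) (Q : Cube n) (m : ℕ) :
    ∫⁻ y in (Q.dilatePow m).toSet, h y ≤
      2 ^ (m * n) * ENNReal.ofReal ((2 : ℝ) ^ ((m : ℝ) * δ)) * volume Q.toSet * aQ δ h Q := by
  have h1 := avg_le_aQ δ h Q m
  set V := (Q.dilatePow m).toSet
  have hv0 : volume V ≠ 0 := (Q.dilatePow m).volume_ne_zero
  have hvt : volume V ≠ ∞ := (Q.dilatePow m).volume_ne_top
  have e : ENNReal.ofReal ((2 : ℝ) ^ ((m : ℝ) * δ)) * ENNReal.ofReal ((2 : ℝ) ^ (-(m : ℝ) * δ)) = 1 := by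
    rw [← ENNReal.ofReal_mul (by positivity), ← Real.rpow_add (by norm_num)]
    simp
  calc ∫⁻ y in V, h y = volume V * avgE V h := by
        rw [avgE, ← mul_assoc, ENNReal.mul_inv_cancel hv0 hvt, one_mul]
    _ = (ENNReal.ofReal ((2 : ℝ) ^ ((m : ℝ) * δ)) * ENNReal.ofReal ((2 : ℝ) ^ (-(m : ℝ) * δ))) *
        (volume V * avgE V h) := by rw [e, one_mul]
    _ = ENNReal.ofReal ((2 : ℝ) ^ ((m : ℝ) * δ)) * volume V *
        (ENNReal.ofReal ((2 : ℝ) ^ (-(m : ℝ) * δ)) * avgE V h) := by ring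
    _ ≤ ENNReal.ofReal ((2 : ℝ) ^ ((m : ℝ) * δ)) * volume V * aQ δ h Q := by gcongr
    _ = _ := by rw [Q.dilate_volume m]; ring

lemma mem_dilate (Q : Cube n) (y : Rn n) : ∃ m, y ∈ (Q.dilatePow m).toSet := by
  have hs := Q.side_pos
  obtain ⟨m, hm⟩ := pow_unbounded_of_one_lt (2 * dist Q.pt y / Q.side + 1) (one_lt_two (α := ℝ))
  refine ⟨m, Q.ball_subset_dilate m Q.pt_mem ?_⟩
  have : 2 * dist Q.pt y / Q.side < 2 ^ m - 1 := by linarith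
  rw [div_lt_iff₀ hs] at this
  linarith

/-- tail constant for dilates -/
def CtQ (n : ℕ) (δ : ℝ) : ℝ := (n : ℝ) ^ δ * 8 ^ ((n : ℝ) + δ)

lemma tail_pt [NeZero n] (hδ : 0 < δ) (Q : Cube n) {m0 : ℕ} (hm0 : 1 ≤ m0) {y : Rn n}
    (hy : y ∉ (Q.dilatePow m0).toSet) : 
    ENNReal.ofReal ((n * Q.side) ^ δ / dist Q.pt y ^ ((n : ℝ) + δ)) ≤
      ∑' m : ℕ, ENNReal.ofReal (CtQ n δ) * ENNReal.ofReal ((2 : ℝ) ^ (-(m : ℝ) * δ)) *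
        ((volume (Q.dilatePow m).toSet)⁻¹ * (Q.dilatePow m).toSet.indicator (fun _ => 1) y) := by
  classical
  have hs := Q.side_pos
  have hn : (0 : ℝ) < n := by exact_mod_cast Nat.pos_of_ne_zero (NeZero.ne n)
  have hex : ∃ k, y ∈ (Q.dilatePow (m0 + k)).toSet := by
    obtain ⟨m, hm⟩ := mem_dilate Q y
    refine ⟨m, ?_⟩
    intro i
    have h1 := hm i
    simp only [Cube.dilatePow] at h1 ⊢
    have h2 : (2 : ℝ) ^ m * Q.side ≤ 2 ^ (m0 + m) * Q.side := by
      gcongr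
      · norm_num
      · omega
    constructor <;> linarith [h1.1, h1.2]
  have hk := Nat.find_spec hex
  have hk' := fun j => Nat.find_min hex (m := j)
  set k := Nat.find hex with hkdef
  have hk0 : k ≠ 0 := by
    intro h
    rw [h] at hk
    exact hy hk
  obtain ⟨j, hj⟩ := Nat.exists_eq_succ_of_ne_zero hk0
  have hyj : y ∉ (Q.dilatePow (m0 + j)).toSet := hk' j (by omega)
  have hd : (2 ^ (m0 + j) - 1) / 2 * Q.side ≤ dist Q.pt y := by
    by_contra h
    exact hyj (Q.ball_subset_dilate _ Q.pt_mem (not_le.1 h))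
  set m := m0 + k with hm
  have hmj : m = m0 + j + 1 := by omega
  have h2 : (2 : ℝ) ≤ 2 ^ (m0 + j) := by
    calc (2 : ℝ) = 2 ^ 1 := by norm_num
      _ ≤ _ := by
        gcongr
        · norm_num
        · omega
  have hd2 : 2 ^ m * Q.side / 8 ≤ dist Q.pt y := by
    refine le_trans ?_ hd
    rw [hmj, pow_succ]
    nlinarith
  refine le_trans ?_ (ENNReal.le_tsum m)
  rw [indicator_of_mem hk, mul_one, (Q.dilatePow m).volume_eq, ← ENNReal.ofReal_inv_of_pos
    (by have := (Q.dilatePow m).side_pos; positivity), ← ENNReal.ofReal_mul (by unfold CtQ; positivity),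
    ← ENNReal.ofReal_mul (by unfold CtQ; positivity)]
  refine ENNReal.ofReal_le_ofReal ?_
  calc (n * Q.side) ^ δ / dist Q.pt y ^ ((n : ℝ) + δ) ≤ (n * Q.side) ^ δ / (2 ^ m * Q.side / 8) ^ ((n : ℝ) + δ) := by
        gcongr
    _ = _ := by
        simp only [CtQ, Cube.dilatePow]
        rw [Real.div_rpow (by positivity) (by norm_num), Real.mul_rpow hn.le hs.le,
          Real.rpow_add (by positivity : (0 : ℝ) < 2 ^ m * Q.side), Real.rpow_natCast,
          Real.mul_rpow (by positivity) hs.le, neg_mul, Real.rpow_neg (by norm_num),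
          Real.rpow_mul (by norm_num), Real.rpow_natCast]
        have : (0 : ℝ) < Q.side ^ δ := by positivity
        have : (0 : ℝ) < ((2 : ℝ) ^ m) ^ δ := by positivity
        field_simp

lemma tail_Q [NeZero n] (hδ : 0 < δ) (Q : Cube n) {m0 : ℕ} (hm0 : 1 ≤ m0) {h : Rn n → ℝ≥0∞}
    (hh : Measurable h) :
    ∫⁻ y in ((Q.dilatePow m0).toSet)ᶜ, ENNReal.ofReal ((n * Q.side) ^ δ / dist Q.pt y ^ ((n : ℝ) + δ)) * h y ≤
      ENNReal.ofReal (CtQ n δ) * aQ δ h Q := by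
  calc _ ≤ ∫⁻ y in ((Q.dilatePow m0).toSet)ᶜ, ∑' m : ℕ, ENNReal.ofReal (CtQ n δ) * ENNReal.ofReal ((2 : ℝ) ^ (-(m : ℝ) * δ)) *
        ((volume (Q.dilatePow m).toSet)⁻¹ * (Q.dilatePow m).toSet.indicator h y) := by
        refine setLIntegral_mono' (Q.dilatePow m0).measurableSet.compl fun y hy => ?_
        refine (mul_le_mul_left (tail_pt hδ Q hm0 hy) _).trans (le_of_eq ?_)
        rw [← ENNReal.tsum_mul_right]
        refine tsum_congr fun m => ?_
        by_cases hy : y ∈ (Q.dilatePow m).toSet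
        · simp only [indicator_of_mem hy]; ring
        · simp only [indicator_of_notMem hy]; ring
    _ ≤ ∫⁻ y, ∑' m : ℕ, ENNReal.ofReal (CtQ n δ) * ENNReal.ofReal ((2 : ℝ) ^ (-(m : ℝ) * δ)) *
        ((volume (Q.dilatePow m).toSet)⁻¹ * (Q.dilatePow m).toSet.indicator h y) :=
        setLIntegral_le_lintegral _ _
    _ = ∑' m : ℕ, ENNReal.ofReal (CtQ n δ) * ENNReal.ofReal ((2 : ℝ) ^ (-(m : ℝ) * δ)) *
        ((volume (Q.dilatePow m).toSet)⁻¹ * ∫⁻ y in (Q.dilatePow m).toSet, h y) := by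
        have hm : ∀ m, Measurable ((Q.dilatePow m).toSet.indicator h) := fun m =>
          hh.indicator (Q.dilatePow m).measurableSet
        rw [lintegral_tsum fun m => (((hm m).const_mul _).const_mul _).aemeasurable]
        refine tsum_congr fun m => ?_
        rw [lintegral_const_mul _ ((hm m).const_mul _), lintegral_const_mul _ (hm m),
          lintegral_indicator (Q.dilatePow m).measurableSet]
    _ = _ := by
        rw [aQ, ← ENNReal.tsum_mul_left]
        refine tsum_congr fun m => ?_
        rw [avgE, mul_assoc]

end SparseCZ

namespace SparseCZ
open Metric
variable {n : ℕ}
variable {T : (Rn n → ℝ) → Rn n → ℝ} {K : Rn n → Rn n → ℝ} {c δ : ℝ}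

lemma kk_zero (e : TI) {x y : Rn n} (h : 2 * e.1.2 ≤ dist x y) : kk K e x y = 0 := by
  have h1 := e.2.1
  have h2 := e.2.2
  rw [kk, Ke, Ke, ph_one h1 (by linarith), ph_one e.pos2 h, sub_self]

lemma kk_bound (hT : IsCZO n T K c δ) (e : TI) (x y : Rn n) : |kk K e x y| ≤ 2 * (c / e.1.1 ^ n) := by
  have hc := hT.c_pos
  have h1 := e.2.1
  have h2 := e.2.2
  have a1 := Ke_bound hT h1 x y
  have a2 := Ke_bound hT e.pos2 x y
  have a3 : c / e.1.2 ^ n ≤ c / e.1.1 ^ n := by gcongr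
  rw [kk]
  refine (abs_sub _ _).trans ?_
  linarith

lemma kk_meas (hT : IsCZO n T K c δ) (e : TI) (x : Rn n) : Measurable (kk K e x) :=
  (Ke_meas hT e.2.1 x).sub (Ke_meas hT e.pos2 x)

lemma kk_integrable (hT : IsCZO n T K c δ) (e : TI) (x : Rn n) {f : Rn n → ℝ}
    (hf : LocallyIntegrable f) : Integrable (fun y => kk K e x y * f y) := by
  have h1 : IntegrableOn f (closedBall x (2 * e.1.2)) := hf.integrableOn_isCompact (isCompact_closedBall _ _)
  have h2 : IntegrableOn (fun y => kk K e x y * f y) (closedBall x (2 * e.1.2)) := by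
    refine h1.bdd_mul (c := 2 * (c / e.1.1 ^ n)) (kk_meas hT e x).aestronglyMeasurable ?_
    exact Eventually.of_forall fun y => kk_bound hT e x y
  refine h2.integrable_of_forall_notMem_eq_zero fun y hy => ?_
  rw [kk_zero e, zero_mul]
  rw [mem_closedBall, not_le, dist_comm] at hy
  exact hy.le

lemma kk_smooth (hT : IsCZO n T K c δ) (e : TI) {x x' y : Rn n} (hne : x ≠ y)
    (h : dist x x' ≤ dist x y / 2) :
    |kk K e x y - kk K e x' y| ≤ 10 * c * (dist x x' ^ δ / dist x y ^ ((n : ℝ) + δ)) := by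
  have a1 := Ke_smooth1 hT e.2.1 hne h
  have a2 := Ke_smooth1 hT e.pos2 hne h
  have : kk K e x y - kk K e x' y = (Ke K e.1.1 x y - Ke K e.1.1 x' y) - (Ke K e.1.2 x y - Ke K e.1.2 x' y) := by
    simp only [kk]; ring
  rw [this]
  refine (abs_sub _ _).trans ?_
  linarith

lemma Ff_le_Ts (hT : IsCZO n T K c δ) {f : Rn n → ℝ} (hf : Integrable f) (e : TI) (x : Rn n) :
    ‖Ff K f e x‖ₑ ≤ 2 * Ts K f x := by
  have e1 : Ff K f e x = Te K e.1.1 f x - Te K e.1.2 f x := by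
    simp only [Ff, Te, kk]
    rw [← integral_sub (Ke_integrable hT e.2.1 x hf) (Ke_integrable hT e.pos2 x hf)]
    congr 1
    ext y
    ring
  rw [e1, two_mul]
  refine enorm_sub_le.trans ?_
  gcongr
  · exact le_iSup₂_of_le e.1.1 e.2.1 le_rfl
  · exact le_iSup₂_of_le e.1.2 e.pos2 le_rfl

lemma locInt_of_aQ {f : Rn n → ℝ} (hfm : Measurable f) (Q : Cube n)
    (ha : aQ δ (fun y => ‖f y‖ₑ) Q ≠ ∞) : LocallyIntegrable f := by
  have hi : ∀ m, IntegrableOn f (Q.dilatePow m).toSet := fun m =>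
    ⟨hfm.aestronglyMeasurable, lt_of_le_of_lt (lint_le_aQ δ _ Q m) (by
      have := Q.volume_ne_top
      exact lt_top_iff_ne_top.2 (by finiteness))⟩
  intro x
  have hs := Q.side_pos
  obtain ⟨m, hm⟩ := pow_unbounded_of_one_lt (2 * (dist Q.pt x + 1) / Q.side + 1) (one_lt_two (α := ℝ))
  refine ⟨ball x 1, ball_mem_nhds x one_pos, (hi m).mono_set fun y hy => ?_⟩
  refine Q.ball_subset_dilate m Q.pt_mem ?_
  have h1 : 2 * (dist Q.pt x + 1) / Q.side < 2 ^ m - 1 := by linarith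
  rw [div_lt_iff₀ hs] at h1
  have h2 := dist_triangle Q.pt x y
  rw [mem_ball, dist_comm] at hy
  linarith

/-- the reference constants on a cube -/
def cQ (K : Rn n → Rn n → ℝ) (f : Rn n → ℝ) (m0 : ℕ) (Q : Cube n) (e : TI) : ℝ :=
  Ff K (((Q.dilatePow m0).toSet)ᶜ.indicator f) e Q.pt

lemma locInt_indicator {f : Rn n → ℝ} (hf : LocallyIntegrable f) {s : Set (Rn n)} (hs : MeasurableSet s) :
    LocallyIntegrable (s.indicator f) := by
  intro x
  obtain ⟨u, hu, h⟩ := hf x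
  exact ⟨u, hu, IntegrableOn.indicator h hs⟩

lemma osc_pt [NeZero n] (hT : IsCZO n T K c δ) {f : Rn n → ℝ} (hfm : Measurable f)
    (hf : LocallyIntegrable f) (Q : Cube n) {m0 : ℕ} (hm0 : (2 : ℝ) * n ≤ (2 ^ m0 - 1) / 2)
    {x : Rn n} (hx : x ∈ Q.toSet) (e : TI) :
    ‖Ff K f e x - cQ K f m0 Q e‖ₑ ≤ 2 * Ts K ((Q.dilatePow m0).toSet.indicator f) x +
      ENNReal.ofReal (10 * c) * (ENNReal.ofReal (CtQ n δ) * aQ δ (fun y => ‖f y‖ₑ) Q) := by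
  have hc := hT.c_pos
  have hδ := hT.delta_pos
  have hs := Q.side_pos
  have hn : (0 : ℝ) < n := by exact_mod_cast Nat.pos_of_ne_zero (NeZero.ne n)
  set V := (Q.dilatePow m0).toSet with hV
  have hVm : MeasurableSet V := (Q.dilatePow m0).measurableSet
  have hm1 : 1 ≤ m0 := by
    rcases Nat.eq_zero_or_pos m0 with h | h
    · rw [h] at hm0; norm_num at hm0; linarith
    · exact h
  have hVc : ∃ r, V ⊆ closedBall Q.pt r := ⟨n * (Q.dilatePow m0).side + dist (Q.dilatePow m0).pt Q.pt, fun y hy => by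
    have := (Q.dilatePow m0).dist_le hy (Q.dilatePow m0).pt_mem
    have := dist_triangle y (Q.dilatePow m0).pt Q.pt
    rw [mem_closedBall]; linarith⟩
  have hf1 : Integrable (V.indicator f) := by
    obtain ⟨r, hr⟩ := hVc
    rw [integrable_indicator_iff hVm]
    exact (hf.integrableOn_isCompact (isCompact_closedBall Q.pt r)).mono_set hr
  have hf2 := locInt_indicator hf hVm.compl
  have e1 : Ff K f e x - cQ K f m0 Q e = Ff K (V.indicator f) e x +
      ∫ y, (kk K e x y - kk K e Q.pt y) * (Vᶜ.indicator f) y := by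
    have a1 : Ff K f e x = Ff K (V.indicator f) e x + Ff K (Vᶜ.indicator f) e x := by
      simp only [Ff]
      rw [← integral_add (kk_integrable hT e x hf1.locallyIntegrable) (kk_integrable hT e x hf2)]
      congr 1
      ext y
      rw [← mul_add]
      congr 1
      exact (congrFun (indicator_self_add_compl V f) y).symm
    rw [a1, cQ, ← hV]
    simp only [sub_mul]
    rw [integral_sub (kk_integrable hT e x hf2) (kk_integrable hT e Q.pt hf2)]
    simp only [Ff]
    ring
  rw [e1]
  refine (enorm_add_le _ _).trans ?_
  gcongr
  · exact Ff_le_Ts hT hf1 e x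
  · refine (enorm_integral_le_lintegral_enorm _).trans ?_
    have hmm : Measurable fun y => ENNReal.ofReal ((n * Q.side) ^ δ / dist Q.pt y ^ ((n : ℝ) + δ)) * ‖f y‖ₑ := by
      have : Measurable fun y : Rn n => ENNReal.ofReal ((n * Q.side) ^ δ / dist Q.pt y ^ ((n : ℝ) + δ)) := by
        fun_prop
      exact this.mul hfm.enorm
    calc _ ≤ ∫⁻ y in Vᶜ, ENNReal.ofReal (10 * c) * (ENNReal.ofReal ((n * Q.side) ^ δ / dist Q.pt y ^ ((n : ℝ) + δ)) * ‖f y‖ₑ) := by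
          rw [← lintegral_indicator hVm.compl]
          refine lintegral_mono fun y => ?_
          by_cases hy : y ∈ Vᶜ
          · rw [indicator_of_mem hy, indicator_of_mem hy, enorm_mul, ← mul_assoc]
            gcongr
            have hd : (2 ^ m0 - 1) / 2 * Q.side ≤ dist Q.pt y := by
              by_contra h
              exact hy (Q.ball_subset_dilate _ Q.pt_mem (not_le.1 h))
            have hd2 : 2 * n * Q.side ≤ dist Q.pt y := le_trans (by gcongr) hd
            have hd3 := Q.dist_le Q.pt_mem hx
            have hpos : 0 < dist Q.pt y := lt_of_lt_of_le (by positivity) hd2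
            rw [Real.enorm_eq_ofReal_abs, ← ENNReal.ofReal_mul (by positivity), abs_sub_comm]
            refine ENNReal.ofReal_le_ofReal ((kk_smooth hT e (dist_pos.1 hpos) (by linarith)).trans ?_)
            gcongr
          · rw [indicator_of_notMem hy, indicator_of_notMem hy]; simp
      _ = ENNReal.ofReal (10 * c) * ∫⁻ y in Vᶜ, (ENNReal.ofReal ((n * Q.side) ^ δ / dist Q.pt y ^ ((n : ℝ) + δ)) * ‖f y‖ₑ) :=
          lintegral_const_mul _ hmm
      _ ≤ _ := by
          gcongr
          exact tail_Q hδ Q hm1 hfm.enorm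

lemma Ts_zero {g : Rn n → ℝ} (hg : g =ᵐ[volume] 0) (x : Rn n) : Ts K g x = 0 := by
  simp only [Ts, ENNReal.iSup_eq_zero, enorm_eq_zero]
  intro ε _
  rw [Te, integral_eq_zero_of_ae]
  filter_upwards [hg] with y hy
  simp [hy]

theorem osc [NeZero n] (hT : IsCZO n T K c δ) {m0 : ℕ} (hm0 : (2 : ℝ) * n ≤ (2 ^ m0 - 1) / 2)
    {η : ℝ≥0∞} (hη : η ≠ 0) : ∃ C : ℝ≥0∞, C ≠ ∞ ∧ C ≠ 0 ∧
    ∀ D : Set (Cube n), IsDyadicGrid D → ∀ f : Rn n → ℝ, Measurable f → ∀ Q : Cube n,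
      volume {x | x ∈ Q.toSet ∧ C * aQ δ (fun y => ‖f y‖ₑ) Q < ⨆ e : TI, ‖Ff K f e x - cQ K f m0 Q e‖ₑ} ≤
        η * volume Q.toSet := by
  by_cases hηt : η = ∞
  · refine ⟨1, by simp, by simp, fun D _ f _ Q => ?_⟩
    rw [hηt, ENNReal.top_mul Q.volume_ne_zero]
    exact le_top
  obtain ⟨C3, hC3t, hC3⟩ := Ts_weak1 hT
  set Λ : ℝ≥0∞ := C3 * (2 ^ (m0 * n) * ENNReal.ofReal ((2 : ℝ) ^ ((m0 : ℝ) * δ))) / η + 1 with hΛ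
  have hΛt : Λ ≠ ∞ := by
    refine ENNReal.add_ne_top.2 ⟨ENNReal.div_ne_top ?_ hη, by simp⟩
    finiteness
  have hΛ0 : Λ ≠ 0 := by simp [hΛ]
  refine ⟨2 * Λ + ENNReal.ofReal (10 * c) * ENNReal.ofReal (CtQ n δ), by finiteness, by simp [hΛ0], ?_⟩
  intro D hD f hfm Q
  set a := aQ δ (fun y => ‖f y‖ₑ) Q with ha
  by_cases hat : a = ∞
  · have : {x | x ∈ Q.toSet ∧ (2 * Λ + ENNReal.ofReal (10 * c) * ENNReal.ofReal (CtQ n δ)) * a < ⨆ e : TI, ‖Ff K f e x - cQ K f m0 Q e‖ₑ} = ∅ := by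
      ext x
      simp only [mem_ofPred_eq, mem_empty_iff_false, iff_false, not_and, not_lt]
      intro _
      rw [hat, ENNReal.mul_top (by simp [hΛ0])]
      exact le_top
    rw [this]; simp
  have hf := locInt_of_aQ hfm Q hat
  set V := (Q.dilatePow m0).toSet with hV
  have hVm : MeasurableSet V := (Q.dilatePow m0).measurableSet
  have hlV := lint_le_aQ δ (fun y => ‖f y‖ₑ) Q m0
  rw [← hV, ← ha] at hlV
  have hle : ∀ y, ‖V.indicator f y‖ₑ = V.indicator (fun y => ‖f y‖ₑ) y := by
    intro y
    by_cases hy : y ∈ V <;> simp [hy]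
  have hlV' : ∫⁻ y, ‖V.indicator f y‖ₑ = ∫⁻ y in V, ‖f y‖ₑ := by
    simp only [hle]
    rw [lintegral_indicator hVm]
  have hsub : {x | x ∈ Q.toSet ∧ (2 * Λ + ENNReal.ofReal (10 * c) * ENNReal.ofReal (CtQ n δ)) * a < ⨆ e : TI, ‖Ff K f e x - cQ K f m0 Q e‖ₑ}
      ⊆ {x | Λ * a < Ts K (V.indicator f) x} := by
    rintro x ⟨hx, hlt⟩
    by_contra hcon
    have hcon' : Ts K (V.indicator f) x ≤ Λ * a := not_lt.1 hcon
    refine absurd hlt (not_lt.2 (iSup_le fun e => (osc_pt hT hfm hf Q hm0 hx e).trans ?_))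
    rw [add_mul, mul_assoc, mul_assoc (ENNReal.ofReal (10 * c))]
    gcongr
  refine (measure_mono hsub).trans ?_
  have hQt := Q.volume_ne_top
  by_cases ha0 : a = 0
  · have hz : V.indicator f =ᵐ[volume] 0 := by
      rw [ha0, mul_zero, ← hlV', nonpos_iff_eq_zero, lintegral_eq_zero_iff (hfm.indicator hVm).enorm] at hlV
      filter_upwards [hlV] with y hy
      simpa using hy
    have : {x | Λ * a < Ts K (V.indicator f) x} = ∅ := by
      ext x
      simp [Ts_zero hz, ha0]
    rw [this]; simp
  have hVi : Integrable (V.indicator f) := by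
    refine ⟨(hfm.indicator hVm).aestronglyMeasurable, ?_⟩
    rw [HasFiniteIntegral, hlV']
    exact lt_of_le_of_lt hlV (lt_top_iff_ne_top.2 (by finiteness))
  have hVb : BddSupp (V.indicator f) := by
    refine ⟨n * (Q.dilatePow m0).side + ‖(Q.dilatePow m0).pt‖, fun y hy => ?_⟩
    have hyV : y ∈ V := by
      by_contra h
      exact hy (indicator_of_notMem h f)
    have h1 := (Q.dilatePow m0).dist_le hyV (Q.dilatePow m0).pt_mem
    rw [dist_eq_norm] at h1
    have h2 := norm_add_le (y - (Q.dilatePow m0).pt) (Q.dilatePow m0).pt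
    rw [sub_add_cancel] at h2
    linarith
  have hw := hC3 D hD _ (hfm.indicator hVm) hVi hVb (Λ * a)
  rw [hlV'] at hw
  have hΛη : C3 * (2 ^ (m0 * n) * ENNReal.ofReal ((2 : ℝ) ^ ((m0 : ℝ) * δ))) ≤ Λ * η := by
    rw [hΛ, add_mul, ENNReal.div_mul_cancel hη hηt]
    exact le_self_add
  have h0 : Λ * a ≠ 0 := mul_ne_zero hΛ0 ha0
  have ht : Λ * a ≠ ∞ := ENNReal.mul_ne_top hΛt hat
  rw [← ENNReal.mul_le_mul_iff_right h0 ht]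
  calc _ ≤ _ := hw
    _ ≤ C3 * (2 ^ (m0 * n) * ENNReal.ofReal ((2 : ℝ) ^ ((m0 : ℝ) * δ)) * volume Q.toSet * a) := by gcongr
    _ = C3 * (2 ^ (m0 * n) * ENNReal.ofReal ((2 : ℝ) ^ ((m0 : ℝ) * δ))) * (volume Q.toSet * a) := by ring
    _ ≤ Λ * η * (volume Q.toSet * a) := by gcongr
    _ = _ := by ring

end SparseCZ

namespace SparseCZ
open Metric
variable {n : ℕ}

/-- candidates for the children of a cube -/
def candG (D : Set (Cube n)) (O : Cube n → Set (Rn n)) (Q : Cube n) : Set (Cube n) :=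
  {P | P ∈ D ∧ P.toSet ⊆ Q.toSet ∧ volume P.toSet < 2 ^ (n + 1) * volume (P.toSet ∩ O Q)}

/-- children of a cube -/
def chG (D : Set (Cube n)) (O : Cube n → Set (Rn n)) (Q : Cube n) : Set (Cube n) := maxFam (candG D O Q)

/-- generations -/
def lev (D : Set (Cube n)) (O : Cube n → Set (Rn n)) (Q₀ : Cube n) : ℕ → Set (Cube n)
  | 0 => {Q₀}
  | k + 1 => ⋃ Q ∈ lev D O Q₀ k, chG D O Q

variable {D : Set (Cube n)} {O : Cube n → Set (Rn n)} {Q₀ : Cube n}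

lemma candG_sub (Q : Cube n) : candG D O Q ⊆ D := fun _ h => h.1

lemma chG_sub (Q : Cube n) : chG D O Q ⊆ D := fun _ h => h.1.1

lemma chG_subset {P Q : Cube n} (h : P ∈ chG D O Q) : P.toSet ⊆ Q.toSet := h.1.2.1

lemma chG_ne {P Q : Cube n} (hO : 2 ^ (n + 2) * volume (O Q) ≤ volume Q.toSet) (h : P ∈ chG D O Q) : P ≠ Q := by
  rintro rfl
  have h1 := h.1.2.2
  have h2 : (2 : ℝ≥0∞) ^ (n + 1) * volume (P.toSet ∩ O P) ≤ volume P.toSet := by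
    refine le_trans ?_ hO
    gcongr
    · norm_num
    · omega
    · exact inter_subset_right
  exact absurd h1 (not_lt.2 h2)

lemma chG_side [NeZero n] (hD : IsDyadicGrid D) {P Q : Cube n} (hQ : Q ∈ D)
    (hO : 2 ^ (n + 2) * volume (O Q) ≤ volume Q.toSet) (h : P ∈ chG D O Q) : 2 * P.side ≤ Q.side := by
  have h1 := side_le_of_subset (chG_subset h)
  have hne := chG_ne hO h
  have h2 : P.side ≠ Q.side := fun e =>
    hne (grid_eq_of_side hD (chG_sub Q h) hQ e P.pt_mem (chG_subset h P.pt_mem))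
  obtain ⟨k, hk⟩ := hD.1 P (chG_sub Q h)
  obtain ⟨l, hl⟩ := hD.1 Q hQ
  have h3 : P.side < Q.side := lt_of_le_of_ne h1 h2
  rw [hk, hl] at h3 ⊢
  have h4 : k < l := (zpow_lt_zpow_iff_right₀ (by norm_num)).1 h3
  calc (2 : ℝ) * 2 ^ k = 2 ^ (k + 1) := by rw [zpow_add_one₀ (by norm_num)]; ring
    _ ≤ 2 ^ l := zpow_le_zpow_right₀ (by norm_num) (by omega)

lemma chG_half [NeZero n] (hD : IsDyadicGrid D) {P Q : Cube n} (hQ : Q ∈ D)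
    (hO : 2 ^ (n + 2) * volume (O Q) ≤ volume Q.toSet) (h : P ∈ chG D O Q) :
    2 * volume (P.toSet ∩ O Q) ≤ volume P.toSet := by
  obtain ⟨R, hR, hs, hsub, hv⟩ := grid_parent hD (chG_sub Q h)
  have hRQ : R.toSet ⊆ Q.toSet :=
    grid_subset hD hR hQ (by rw [hs]; exact chG_side hD hQ hO h) (hsub P.pt_mem) (chG_subset h P.pt_mem)
  have hRn : R ∉ candG D O Q := by
    intro hR'
    have := h.2 R hR' hsub
    rw [this] at hs
    linarith [P.side_pos]
  have h1 : 2 ^ (n + 1) * volume (R.toSet ∩ O Q) ≤ volume R.toSet := by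
    by_contra hc
    exact hRn ⟨hR, hRQ, not_le.1 hc⟩
  rw [hv] at h1
  have h2 : (2 : ℝ≥0∞) ^ n * (2 * volume (P.toSet ∩ O Q)) ≤ 2 ^ n * volume P.toSet := by
    refine le_trans ?_ h1
    rw [pow_succ, mul_assoc]
    gcongr
  exact (ENNReal.mul_le_mul_iff_right (by simp) (by simp)).1 h2

lemma chG_pt [NeZero n] (hD : IsDyadicGrid D) {P Q : Cube n} (hQ : Q ∈ D)
    (hO : 2 ^ (n + 2) * volume (O Q) ≤ volume Q.toSet)
    (hO' : 2 ^ (n + 2) * volume (O P) ≤ volume P.toSet) (h : P ∈ chG D O Q) :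
    ∃ y ∈ P.toSet, y ∉ O Q ∧ y ∉ O P := by
  by_contra hcon
  push Not at hcon
  have h1 := chG_half hD hQ hO h
  have hsub : P.toSet ⊆ (P.toSet ∩ O Q) ∪ O P := by
    intro y hy
    by_cases hyQ : y ∈ O Q
    · exact Or.inl ⟨hy, hyQ⟩
    · exact Or.inr (hcon y hy hyQ)
  have h2 := (measure_mono (μ := volume) hsub).trans (measure_union_le _ _)
  have h3 : 4 * volume (O P) ≤ volume P.toSet := by
    refine le_trans ?_ hO'
    gcongr
    calc (4 : ℝ≥0∞) = 2 ^ 2 := by norm_num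
      _ ≤ _ := by
        gcongr
        · norm_num
        · omega
  have h4 : 4 * volume P.toSet ≤ 3 * volume P.toSet := by
    calc 4 * volume P.toSet ≤ 4 * (volume (P.toSet ∩ O Q) + volume (O P)) := by gcongr
      _ = 2 * (2 * volume (P.toSet ∩ O Q)) + 4 * volume (O P) := by ring
      _ ≤ 2 * volume P.toSet + volume P.toSet := by gcongr
      _ = _ := by ring
  rw [ENNReal.mul_le_mul_iff_left P.volume_ne_zero P.volume_ne_top] at h4
  norm_num at h4

lemma chG_vol [NeZero n] (hD : IsDyadicGrid D) {Q : Cube n} (hOo : IsOpen (O Q))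
    (hO : 2 ^ (n + 2) * volume (O Q) ≤ volume Q.toSet) :
    2 * volume (⋃ P ∈ chG D O Q, Cube.toSet P) ≤ volume Q.toSet := by
  have hc : (chG D O Q).Countable := (grid_countable hD).mono (chG_sub Q)
  have : Countable (chG D O Q) := hc.to_subtype
  have hdisj : (chG D O Q).PairwiseDisjoint Cube.toSet := maxFam_disjoint hD (candG_sub Q)
  rw [measure_biUnion hc hdisj fun P _ => P.measurableSet]
  have h1 : ∑' P : chG D O Q, volume P.1.toSet ≤ 2 ^ (n + 1) * volume (O Q) := by
    calc _ ≤ ∑' P : chG D O Q, 2 ^ (n + 1) * volume (P.1.toSet ∩ O Q) :=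
          ENNReal.tsum_le_tsum fun P => P.2.1.2.2.le
      _ = 2 ^ (n + 1) * ∑' P : chG D O Q, volume (P.1.toSet ∩ O Q) := ENNReal.tsum_mul_left
      _ = 2 ^ (n + 1) * volume (⋃ P ∈ chG D O Q, (Cube.toSet P ∩ O Q)) := by
          rw [measure_biUnion hc _ fun P _ => P.measurableSet.inter hOo.measurableSet]
          intro P hP R hR hne
          exact (hdisj hP hR hne).mono inter_subset_left inter_subset_left
      _ ≤ _ := by
          gcongr
          exact iUnion₂_subset fun P _ => inter_subset_right
  calc _ ≤ 2 * (2 ^ (n + 1) * volume (O Q)) := by gcongr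
    _ = 2 ^ (n + 2) * volume (O Q) := by ring
    _ ≤ _ := hO

lemma chG_cover [NeZero n] (hD : IsDyadicGrid D) {Q : Cube n} (hQ : Q ∈ D) (hOo : IsOpen (O Q))
    {x : Rn n} (hx : x ∈ Q.toSet) (hxO : x ∈ O Q) : ∃ P ∈ chG D O Q, x ∈ P.toSet := by
  obtain ⟨ρ, hρ, hb⟩ := Metric.isOpen_iff.1 hOo x hxO
  obtain ⟨P, hP, hxP, hs, hsub⟩ := grid_small hD (x := x) (lt_min hρ Q.side_pos)
  have hPQ : P.toSet ⊆ Q.toSet := grid_subset hD hP hQ (hs.trans (min_le_right _ _)) hxP hx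
  have hPO : P.toSet ⊆ O Q := (hsub.trans (ball_subset_ball (min_le_left _ _))).trans hb
  have hc : P ∈ candG D O Q := by
    refine ⟨hP, hPQ, ?_⟩
    rw [inter_eq_left.2 hPO]
    calc volume P.toSet = 1 * volume P.toSet := (one_mul _).symm
      _ < _ := by
        apply ENNReal.mul_lt_mul_left P.volume_ne_zero P.volume_ne_top
        exact one_lt_pow₀ (by norm_num) (by omega)
  obtain ⟨R, hR, hPR⟩ := maxFam_exists hD (candG_sub Q) (L := Q.side)
    (fun R hR => side_le_of_subset hR.2.1) hc
  exact ⟨R, hR, hPR hxP⟩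

lemma lev_sub (hQ₀ : Q₀ ∈ D) (k : ℕ) : lev D O Q₀ k ⊆ D := by
  cases k with
  | zero => simp only [lev]; exact singleton_subset_iff.2 hQ₀
  | succ k => exact iUnion₂_subset fun Q _ => chG_sub Q

lemma lev_disj [NeZero n] (hD : IsDyadicGrid D) (k : ℕ) : (lev D O Q₀ k).PairwiseDisjoint Cube.toSet := by
  induction k with
  | zero => simp only [lev]; exact pairwiseDisjoint_singleton _ _
  | succ k ih =>
    intro P hP R hR hne
    obtain ⟨Q, hQ, hPQ⟩ := mem_iUnion₂.1 hP
    obtain ⟨Q', hQ', hRQ'⟩ := mem_iUnion₂.1 hR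
    by_cases h : Q = Q'
    · subst h
      exact maxFam_disjoint hD (candG_sub Q) hPQ hRQ' hne
    · exact (ih hQ hQ' h).mono (chG_subset hPQ) (chG_subset hRQ')

lemma lev_anc (k i : ℕ) {P : Cube n} (hP : P ∈ lev D O Q₀ (k + i)) :
    ∃ R ∈ lev D O Q₀ k, P.toSet ⊆ R.toSet := by
  induction i generalizing P with
  | zero => exact ⟨P, hP, subset_rfl⟩
  | succ i ih =>
    obtain ⟨Q, hQ, hPQ⟩ := mem_iUnion₂.1 (show P ∈ ⋃ Q ∈ lev D O Q₀ (k + i), chG D O Q from hP)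
    obtain ⟨R, hR, hs⟩ := ih hQ
    exact ⟨R, hR, (chG_subset hPQ).trans hs⟩

lemma lev_sparse [NeZero n] (hD : IsDyadicGrid D) (hQ₀ : Q₀ ∈ D) (hOo : ∀ Q, IsOpen (O Q))
    (hO : ∀ Q, 2 ^ (n + 2) * volume (O Q) ≤ volume Q.toSet) : IsSparse (⋃ k, lev D O Q₀ k) := by
  intro Q hQ
  obtain ⟨k, hk⟩ := mem_iUnion.1 hQ
  have hsub : (⋃ P ∈ {P | P ∈ (⋃ k, lev D O Q₀ k) ∧ P.toSet ⊂ Q.toSet}, Cube.toSet P) ⊆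
      ⋃ P ∈ chG D O Q, Cube.toSet P := by
    refine iUnion₂_subset fun P hP => ?_
    obtain ⟨hPS, hPQ⟩ := hP
    obtain ⟨j, hj⟩ := mem_iUnion.1 hPS
    by_cases hkj : k < j
    · obtain ⟨i, rfl⟩ : ∃ i, j = (k + 1) + i := ⟨j - (k + 1), by omega⟩
      obtain ⟨R', hR', hs⟩ := lev_anc (k + 1) i hj
      obtain ⟨R, hR, hR'R⟩ := mem_iUnion₂.1 hR'
      have hRQ : R = Q := by
        by_contra hne
        exact disjoint_left.1 (lev_disj hD k hR hk hne) (chG_subset hR'R (hs P.pt_mem)) (hPQ.1 P.pt_mem)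
      subst hRQ
      exact fun y hy => mem_biUnion hR'R (hs hy)
    · exfalso
      obtain ⟨i, rfl⟩ : ∃ i, k = j + i := ⟨k - j, by omega⟩
      obtain ⟨R, hR, hs⟩ := lev_anc j i hk
      have hRP : R = P := by
        by_contra hne
        exact disjoint_left.1 (lev_disj hD j hR hj hne) (hs (hPQ.1 P.pt_mem)) P.pt_mem
      subst hRP
      exact hPQ.2 hs
  rw [ENNReal.le_div_iff_mul_le (by simp) (by simp), mul_comm]
  exact le_trans (by gcongr) (chG_vol hD (hOo Q) (hO Q))

lemma lev_vol [NeZero n] (hD : IsDyadicGrid D) (hQ₀ : Q₀ ∈ D) (hOo : ∀ Q, IsOpen (O Q))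
    (hO : ∀ Q, 2 ^ (n + 2) * volume (O Q) ≤ volume Q.toSet) (k : ℕ) :
    volume (⋃ Q ∈ lev D O Q₀ k, Cube.toSet Q) ≤ (1 / 2) ^ k * volume Q₀.toSet := by
  induction k with
  | zero => simp [lev]
  | succ k ih =>
    have hc : (lev D O Q₀ k).Countable := (grid_countable hD).mono (lev_sub hQ₀ k)
    have : Countable (lev D O Q₀ k) := hc.to_subtype
    have h1 : (⋃ P ∈ lev D O Q₀ (k + 1), Cube.toSet P) ⊆ ⋃ Q : lev D O Q₀ k, ⋃ P ∈ chG D O Q.1, Cube.toSet P := by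
      intro x hx
      obtain ⟨P, hP, hxP⟩ := mem_iUnion₂.1 hx
      obtain ⟨Q, hQ, hPQ⟩ := mem_iUnion₂.1 hP
      exact mem_iUnion.2 ⟨⟨Q, hQ⟩, mem_biUnion hPQ hxP⟩
    calc _ ≤ ∑' Q : lev D O Q₀ k, volume (⋃ P ∈ chG D O Q.1, Cube.toSet P) :=
          (measure_mono h1).trans (measure_iUnion_le _)
      _ ≤ ∑' Q : lev D O Q₀ k, (1 / 2) * volume Q.1.toSet := by
          refine ENNReal.tsum_le_tsum fun Q => ?_
          have := chG_vol (Q := Q.1) hD (hOo Q.1) (hO Q.1)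
          rw [one_div, ← ENNReal.div_eq_inv_mul, ENNReal.le_div_iff_mul_le (by simp) (by simp), mul_comm]
          exact this
      _ = (1 / 2) * volume (⋃ Q ∈ lev D O Q₀ k, Cube.toSet Q) := by
          rw [ENNReal.tsum_mul_left, measure_biUnion hc (lev_disj hD k) fun P _ => P.measurableSet]
      _ ≤ (1 / 2) * ((1 / 2) ^ k * volume Q₀.toSet) := by gcongr
      _ = _ := by rw [pow_succ]; ring

lemma lev_ae [NeZero n] (hD : IsDyadicGrid D) (hQ₀ : Q₀ ∈ D) (hOo : ∀ Q, IsOpen (O Q))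
    (hO : ∀ Q, 2 ^ (n + 2) * volume (O Q) ≤ volume Q.toSet) :
    ∀ᵐ x : Rn n, ∃ k, x ∉ ⋃ Q ∈ lev D O Q₀ k, Cube.toSet Q := by
  rw [ae_iff]
  have hsub : ∀ k, {x : Rn n | ¬ ∃ k, x ∉ ⋃ Q ∈ lev D O Q₀ k, Cube.toSet Q} ⊆ ⋃ Q ∈ lev D O Q₀ k, Cube.toSet Q := by
    intro k x hx
    by_contra h
    exact hx ⟨k, h⟩
  have hle := fun k => (measure_mono (μ := volume) (hsub k)).trans (lev_vol hD hQ₀ hOo hO k)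
  have ht : Tendsto (fun k : ℕ => ((1 / 2 : ℝ≥0∞)) ^ k * volume Q₀.toSet) atTop (𝓝 0) := by
    have h1 := ENNReal.tendsto_pow_atTop_nhds_zero_of_lt_one (r := (1 / 2 : ℝ≥0∞)) (by
      rw [one_div]; exact ENNReal.inv_lt_one.2 (by norm_num))
    have := ENNReal.Tendsto.mul_const h1 (Or.inr Q₀.volume_ne_top)
    simpa using this
  exact le_antisymm (ge_of_tendsto' ht hle) bot_le

theorem sparse_exists [NeZero n] (hD : IsDyadicGrid D) (hQ₀ : Q₀ ∈ D)
    (φ : Rn n → Cube n → ℝ≥0∞) (A : Cube n → ℝ≥0∞)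
    (hφ : ∀ x y P Q, φ x Q ≤ φ x P + φ y P + φ y Q)
    (hE : ∀ Q : Cube n, volume {x | x ∈ Q.toSet ∧ A Q < φ x Q} ≤ (2 ^ (n + 3))⁻¹ * volume Q.toSet) :
    ∃ S ⊆ D, IsSparse S ∧ Q₀ ∈ S ∧ ∀ᵐ x, x ∈ Q₀.toSet →
      φ x Q₀ ≤ 2 * ∑' Q : S, Q.1.toSet.indicator (fun _ => A Q.1) x := by
  classical
  have hOex : ∀ Q : Cube n, ∃ U : Set (Rn n), {x | x ∈ Q.toSet ∧ A Q < φ x Q} ⊆ U ∧ IsOpen U ∧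
      2 ^ (n + 2) * volume U ≤ volume Q.toSet := by
    intro Q
    have h1 : volume {x | x ∈ Q.toSet ∧ A Q < φ x Q} < (2 ^ (n + 2))⁻¹ * volume Q.toSet := by
      refine lt_of_le_of_lt (hE Q) ?_
      apply ENNReal.mul_lt_mul_left Q.volume_ne_zero Q.volume_ne_top
      rw [ENNReal.inv_lt_inv]
      exact_mod_cast (Nat.pow_lt_pow_right (by norm_num) (by omega) : 2 ^ (n + 2) < 2 ^ (n + 3))
    obtain ⟨U, hU, hUo, hUv⟩ := Set.exists_isOpen_lt_of_lt _ _ h1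
    refine ⟨U, hU, hUo, ?_⟩
    calc 2 ^ (n + 2) * volume U ≤ 2 ^ (n + 2) * ((2 ^ (n + 2))⁻¹ * volume Q.toSet) := by gcongr
      _ = _ := by rw [← mul_assoc, ENNReal.mul_inv_cancel (by simp) (by simp), one_mul]
  choose O hEO hOo hO using hOex
  set S : Set (Cube n) := ⋃ k, lev D O Q₀ k with hS
  have hSD : S ⊆ D := iUnion_subset fun k => lev_sub hQ₀ k
  refine ⟨S, hSD, lev_sparse hD hQ₀ hOo hO, mem_iUnion.2 ⟨0, by simp [lev]⟩, ?_⟩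
  filter_upwards [lev_ae (Q₀ := Q₀) hD hQ₀ hOo hO] with x hx hxQ
  obtain ⟨k0, hk0⟩ := hx
  set t : Cube n → S → ℝ≥0∞ := fun Q R => if R.1.toSet ⊆ Q.toSet ∧ x ∈ R.1.toSet then A R.1 else 0 with ht
  have hchain : ∀ j k Q, Q ∈ lev D O Q₀ k → x ∈ Q.toSet → x ∉ (⋃ Q ∈ lev D O Q₀ (k + j), Cube.toSet Q) →
      φ x Q + A Q ≤ 2 * ∑' R : S, t Q R := by
    intro j
    induction j with
    | zero =>
      intro k Q hQ hxQ hx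
      exact absurd (mem_biUnion hQ hxQ) hx
    | succ j ih =>
      intro k Q hQ hxQ hx
      have hQD := lev_sub hQ₀ k hQ
      have hQS : Q ∈ S := mem_iUnion.2 ⟨k, hQ⟩
      by_cases hxc : ∃ P ∈ chG D O Q, x ∈ P.toSet
      · obtain ⟨P, hP, hxP⟩ := hxc
        have hPl : P ∈ lev D O Q₀ (k + 1) := mem_biUnion hQ hP
        have h1 := ih (k + 1) P hPl hxP (by rwa [show k + 1 + j = k + (j + 1) by omega])
        obtain ⟨y, hyP, hyQ, hyP'⟩ := chG_pt hD hQD (hO Q) (hO P) hP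
        have h2 : φ y P ≤ A P := by
          by_contra h
          exact hyP' (hEO P ⟨hyP, not_le.1 h⟩)
        have h3 : φ y Q ≤ A Q := by
          by_contra h
          exact hyQ (hEO Q ⟨chG_subset hP hyP, not_le.1 h⟩)
        have h4 : A Q + ∑' R : S, t P R ≤ ∑' R : S, t Q R := by
          have e : A Q = ∑' R : S, if R = ⟨Q, hQS⟩ then A Q else 0 := by
            rw [tsum_ite_eq]
          rw [e, ← ENNReal.tsum_add]
          refine ENNReal.tsum_le_tsum fun R => ?_
          by_cases hR : R = ⟨Q, hQS⟩
          · subst hR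
            have hnot : ¬ Q.toSet ⊆ P.toSet := by
              intro hc
              exact chG_ne (hO Q) hP (grid_eq_of_toSet hD (chG_sub Q hP) hQD
                (subset_antisymm (chG_subset hP) hc))
            simp [ht, hnot, hxQ]
          · simp only [hR, if_false, zero_add, ht]
            split_ifs with a1 a2 a2
            · exact le_rfl
            · exact absurd ⟨a1.1.trans (chG_subset hP), a1.2⟩ a2
            · exact bot_le
            · exact le_rfl
        calc φ x Q + A Q ≤ (φ x P + φ y P + φ y Q) + A Q := by gcongr; exact hφ x y P Q
          _ ≤ (φ x P + A P + A Q) + A Q := by gcongr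
          _ = (φ x P + A P) + 2 * A Q := by ring
          _ ≤ 2 * (∑' R : S, t P R) + 2 * A Q := by gcongr
          _ = 2 * (A Q + ∑' R : S, t P R) := by ring
          _ ≤ _ := by gcongr
      · have h1 : φ x Q ≤ A Q := by
          by_contra h
          exact hxc (chG_cover hD hQD (hOo Q) hxQ (hEO Q ⟨hxQ, not_le.1 h⟩))
        have h2 : A Q ≤ ∑' R : S, t Q R := by
          refine le_trans ?_ (ENNReal.le_tsum ⟨Q, hQS⟩)
          simp [ht, hxQ]
        calc φ x Q + A Q ≤ A Q + A Q := by gcongr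
          _ = 2 * A Q := by ring
          _ ≤ _ := by gcongr
  have hfin := hchain k0 0 Q₀ (by simp [lev]) hxQ (by simpa using hk0)
  refine (le_self_add.trans hfin).trans ?_
  gcongr with R
  simp only [ht]
  split_ifs with h
  · rw [indicator_of_mem h.2]
  · exact bot_le

end SparseCZ

namespace SparseCZ
open Metric
variable {n : ℕ} {T : (Rn n → ℝ) → Rn n → ℝ} {K : Rn n → Rn n → ℝ} {c δ : ℝ}

lemma median_mem {g : Rn n → ℝ} (hg : Measurable g) (Q : Cube n) {N R : ℝ}
    (hb : volume {x | x ∈ Q.toSet ∧ R < |g x - N|} < volume Q.toSet / 2) :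
    |median g Q - N| ≤ R := by
  have hQt := Q.volume_ne_top
  have hgood : ∀ s : Set (Rn n), {x | x ∈ Q.toSet ∧ |g x - N| ≤ R} ⊆ s →
      ¬ volume s ≤ volume Q.toSet / 2 := by
    intro s hs hle
    have h1 : volume Q.toSet ≤ volume {x | x ∈ Q.toSet ∧ R < |g x - N|} + volume s := by
      refine (measure_mono ?_).trans (measure_union_le _ _)
      intro x hx
      by_cases h : R < |g x - N|
      · exact Or.inl ⟨hx, h⟩
      · exact Or.inr (hs ⟨hx, not_lt.1 h⟩)
    have h2 : volume {x | x ∈ Q.toSet ∧ R < |g x - N|} + volume s < volume Q.toSet / 2 + volume Q.toSet / 2 :=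
      ENNReal.add_lt_add_of_lt_of_le (ne_top_of_le_ne_top (by finiteness) hle) hb hle
    rw [ENNReal.add_halves] at h2
    exact absurd h1 (not_le.2 h2)
  have hup : ∀ l, volume {x ∈ Q.toSet | g x < l} ≤ volume Q.toSet / 2 → l ≤ N + R := by
    intro l hl
    by_contra hc
    refine hgood _ ?_ hl
    rintro x ⟨hx, hx2⟩
    exact ⟨hx, by have := (abs_le.1 hx2).2; linarith⟩
  have hlo : ∀ l, volume {x ∈ Q.toSet | l < g x} ≤ volume Q.toSet / 2 → N - R ≤ l := by
    intro l hl
    by_contra hc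
    refine hgood _ ?_ hl
    rintro x ⟨hx, hx2⟩
    exact ⟨hx, by have := (abs_le.1 hx2).1; linarith⟩
  set A : Set ℝ := {l | volume {x ∈ Q.toSet | g x < l} ≤ volume Q.toSet / 2} with hA
  have hAne : N - R ∈ A := by
    refine (measure_mono ?_).trans hb.le
    rintro x ⟨hx, hx2⟩
    refine ⟨hx, lt_abs.2 (Or.inr (by linarith))⟩
  have hAb : BddAbove A := ⟨N + R, fun l hl => hup l hl⟩
  set L : Set ℝ := {l : ℝ | volume {x ∈ Q.toSet | l < g x} ≤ volume Q.toSet / 2 ∧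
                volume {x ∈ Q.toSet | g x < l} ≤ volume Q.toSet / 2} with hL
  have hl0 : sSup A ∈ L := by
    constructor
    · have e : {x ∈ Q.toSet | sSup A < g x} = ⋃ k : ℕ, {x ∈ Q.toSet | sSup A + 1 / ((k : ℝ) + 1) ≤ g x} := by
        ext x
        simp only [mem_iUnion, mem_ofPred_eq]
        constructor
        · rintro ⟨hx, h⟩
          obtain ⟨k, hk⟩ := exists_nat_one_div_lt (sub_pos.2 h)
          exact ⟨k, hx, by linarith⟩
        · rintro ⟨k, hx, h⟩
          have : 0 < 1 / ((k : ℝ) + 1) := Nat.one_div_pos_of_nat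
          exact ⟨hx, by linarith⟩
      rw [e]
      have hmono : Monotone fun k : ℕ => {x ∈ Q.toSet | sSup A + 1 / ((k : ℝ) + 1) ≤ g x} := by
        intro i j hij x hx
        exact ⟨hx.1, le_trans (by gcongr) hx.2⟩
      rw [hmono.measure_iUnion]
      refine iSup_le fun k => ?_
      have hk : 0 < 1 / ((k : ℝ) + 1) := Nat.one_div_pos_of_nat
      have hn : sSup A + 1 / ((k : ℝ) + 1) ∉ A := fun h => by
        have := le_csSup hAb h; linarith
      have hn' : volume Q.toSet / 2 < volume {x ∈ Q.toSet | g x < sSup A + 1 / ((k : ℝ) + 1)} := not_le.1 hn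
      by_contra hc
      push Not at hc
      have h2 := ENNReal.add_lt_add hc hn'
      rw [ENNReal.add_halves, ← measure_union] at h2
      · refine absurd (measure_mono ?_) (not_le.2 h2)
        rintro x (hx | hx) <;> exact hx.1
      · rw [Set.disjoint_left]
        intro x hx hx2
        exact absurd hx.2 (not_le.2 hx2.2)
      · exact Q.measurableSet.inter (measurableSet_lt hg measurable_const)
    · have e : {x ∈ Q.toSet | g x < sSup A} = ⋃ k : ℕ, {x ∈ Q.toSet | g x < sSup A - 1 / ((k : ℝ) + 1)} := by
        ext x
        simp only [mem_iUnion, mem_ofPred_eq]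
        constructor
        · rintro ⟨hx, h⟩
          obtain ⟨k, hk⟩ := exists_nat_one_div_lt (sub_pos.2 h)
          exact ⟨k, hx, by linarith⟩
        · rintro ⟨k, hx, h⟩
          have : 0 < 1 / ((k : ℝ) + 1) := Nat.one_div_pos_of_nat
          exact ⟨hx, by linarith⟩
      rw [e]
      have hmono : Monotone fun k : ℕ => {x ∈ Q.toSet | g x < sSup A - 1 / ((k : ℝ) + 1)} := by
        intro i j hij x hx
        exact ⟨hx.1, lt_of_lt_of_le hx.2 (by gcongr)⟩
      rw [hmono.measure_iUnion]
      refine iSup_le fun k => ?_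
      have hk : 0 < 1 / ((k : ℝ) + 1) := Nat.one_div_pos_of_nat
      obtain ⟨l, hl, hl2⟩ := exists_lt_of_lt_csSup ⟨_, hAne⟩ (show sSup A - 1 / ((k : ℝ) + 1) < sSup A by linarith)
      refine le_trans (measure_mono ?_) hl
      rintro x ⟨hx, hx2⟩
      exact ⟨hx, hx2.trans hl2⟩
  have hm : median g Q = sSup L := rfl
  rw [hm, abs_le]
  have h1 := hlo _ hl0.1
  have h2 : sSup A ≤ sSup L := le_csSup ⟨N + R, fun l hl => hup l hl.2⟩ hl0
  have h3 : sSup L ≤ N + R := csSup_le ⟨_, hl0⟩ fun l hl => hup l hl.2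
  constructor <;> linarith

lemma sup_diff {ι : Type*} [Nonempty ι] (u v : ι → ℝ) :
    ENNReal.ofReal |(⨆ i, |u i|) - (⨆ i, |v i|)| ≤ ⨆ i, ‖u i - v i‖ₑ := by
  by_cases hS : (⨆ i, ‖u i - v i‖ₑ) = ∞
  · rw [hS]; exact le_top
  set B := (⨆ i, ‖u i - v i‖ₑ).toReal with hB
  have hb : ∀ i, |u i - v i| ≤ B := by
    intro i
    have := ENNReal.toReal_mono hS (le_iSup (fun i => ‖u i - v i‖ₑ) i)
    rwa [Real.enorm_eq_ofReal_abs, ENNReal.toReal_ofReal (abs_nonneg _)] at this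
  rw [← ENNReal.ofReal_toReal hS]
  apply ENNReal.ofReal_le_ofReal
  rw [← hB]
  have hB0 : 0 ≤ B := ENNReal.toReal_nonneg
  have huv : ∀ i, |u i| ≤ |v i| + B := fun i => by
    have := hb i; have := abs_sub_abs_le_abs_sub (u i) (v i); linarith
  have hvu : ∀ i, |v i| ≤ |u i| + B := fun i => by
    have := hb i; have := abs_sub_abs_le_abs_sub (v i) (u i); rw [abs_sub_comm] at this; linarith
  by_cases hu : BddAbove (range fun i => |u i|)
  · have hv : BddAbove (range fun i => |v i|) := by
      obtain ⟨M, hM⟩ := hu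
      refine ⟨M + B, ?_⟩
      rintro _ ⟨i, rfl⟩
      have := hM ⟨i, rfl⟩
      have := hvu i
      simp only at *
      linarith
    have a1 : (⨆ i, |u i|) ≤ (⨆ i, |v i|) + B := ciSup_le fun i => (huv i).trans (by gcongr; exact le_ciSup hv i)
    have a2 : (⨆ i, |v i|) ≤ (⨆ i, |u i|) + B := ciSup_le fun i => (hvu i).trans (by gcongr; exact le_ciSup hu i)
    rw [abs_le]; constructor <;> linarith
  · have hv : ¬ BddAbove (range fun i => |v i|) := by
      rintro ⟨M, hM⟩
      refine hu ⟨M + B, ?_⟩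
      rintro _ ⟨i, rfl⟩
      have := hM ⟨i, rfl⟩
      have := huv i
      simp only at *
      linarith
    rw [Real.iSup_of_not_bddAbove hu, Real.iSup_of_not_bddAbove hv]
    simpa using hB0

/-- rough truncation -/
def Rr (K : Rn n → Rn n → ℝ) (f : Rn n → ℝ) (e : TI) (x : Rn n) : ℝ :=
  ∫ y in {y | e.1.1 < dist x y ∧ dist x y < e.1.2}, K x y * f y

lemma ann_meas (x : Rn n) (a b : ℝ) : MeasurableSet {y : Rn n | a < dist x y ∧ dist x y < b} := by
  have : Measurable fun y : Rn n => dist x y := by fun_prop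
  exact (measurableSet_lt measurable_const this).inter (measurableSet_lt this measurable_const)

/-- rough truncation of the kernel -/
def kr (K : Rn n → Rn n → ℝ) (e : TI) (x y : Rn n) : ℝ :=
  {y | e.1.1 < dist x y ∧ dist x y < e.1.2}.indicator (K0 K x) y

lemma Rr_eq (e : TI) (f : Rn n → ℝ) (x : Rn n) : Rr K f e x = ∫ y, kr K e x y * f y := by
  rw [Rr, ← integral_indicator (ann_meas _ _ _)]
  congr 1
  ext y
  simp only [kr, indicator]
  split_ifs with h
  · rw [K0_eq]
    rintro rfl
    have := h.1
    rw [dist_self] at this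
    exact absurd e.2.1 (not_lt.2 this.le)
  · simp

lemma kr_meas (hT : IsCZO n T K c δ) (e : TI) (x : Rn n) : Measurable (kr K e x) :=
  (K0_meas_right hT x).indicator (ann_meas _ _ _)

lemma kr_bound (hT : IsCZO n T K c δ) (e : TI) (x y : Rn n) : |kr K e x y| ≤ c / e.1.1 ^ n := by
  have hc := hT.c_pos
  have h1 := e.2.1
  simp only [kr, indicator]
  split_ifs with h
  · have hd : 0 < dist x y := h1.trans h.1
    rw [K0_eq (dist_pos.1 hd)]
    refine (hT.size x y (dist_pos.1 hd)).trans ?_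
    gcongr
    exact h.1.le
  · simp; positivity

lemma kr_integrable (hT : IsCZO n T K c δ) (e : TI) (x : Rn n) {f : Rn n → ℝ}
    (hf : LocallyIntegrable f) : Integrable (fun y => kr K e x y * f y) := by
  have h1 : IntegrableOn f (closedBall x e.1.2) := hf.integrableOn_isCompact (isCompact_closedBall _ _)
  have h2 : IntegrableOn (fun y => kr K e x y * f y) (closedBall x e.1.2) := by
    refine h1.bdd_mul (c := c / e.1.1 ^ n) (kr_meas hT e x).aestronglyMeasurable ?_
    exact Eventually.of_forall fun y => kr_bound hT e x y
  refine h2.integrable_of_forall_notMem_eq_zero fun y hy => ?_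
  have : ¬ dist x y < e.1.2 := fun h => hy (by rw [mem_closedBall, dist_comm]; exact h.le)
  simp [kr, indicator, this]

lemma kr_sub_kk (hT : IsCZO n T K c δ) (e : TI) (x y : Rn n) :
    |kr K e x y - kk K e x y| ≤ (closedBall x (2 * e.1.1)).indicator (fun _ => c / e.1.1 ^ n) y +
      (closedBall x (2 * e.1.2)).indicator (fun _ => c / e.1.2 ^ n) y := by
  have hc := hT.c_pos
  have h1 := e.2.1
  have h12 := e.2.2
  have h2 := e.pos2
  have hn1 : 0 ≤ (closedBall x (2 * e.1.1)).indicator (fun _ => c / e.1.1 ^ n) y :=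
    indicator_nonneg (fun _ _ => by positivity) _
  have hn2 : 0 ≤ (closedBall x (2 * e.1.2)).indicator (fun _ => c / e.1.2 ^ n) y :=
    indicator_nonneg (fun _ _ => by positivity) _
  have i1 : dist x y ≤ 2 * e.1.1 → (closedBall x (2 * e.1.1)).indicator (fun _ => c / e.1.1 ^ n) y = c / e.1.1 ^ n :=
    fun h => indicator_of_mem (by rwa [mem_closedBall, dist_comm]) _
  have i2 : dist x y ≤ 2 * e.1.2 → (closedBall x (2 * e.1.2)).indicator (fun _ => c / e.1.2 ^ n) y = c / e.1.2 ^ n :=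
    fun h => indicator_of_mem (by rwa [mem_closedBall, dist_comm]) _
  by_cases ha : dist x y ≤ e.1.1
  · have : kr K e x y = 0 := by simp [kr, indicator, not_lt.2 ha]
    rw [this, kk, Ke, Ke, ph_zero h1 ha, ph_zero h2 (by linarith)]
    simp only [mul_zero, sub_self, abs_zero]
    positivity
  push Not at ha
  have hd : 0 < dist x y := h1.trans ha
  have hne := dist_pos.1 hd
  have hK := hT.size x y hne
  by_cases hb : dist x y < e.1.2
  · have : kr K e x y = K x y := by simp [kr, indicator, ha, hb, K0_eq hne]
    rw [this, kk, Ke, Ke, ph_zero h2 hb.le]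
    by_cases hd2 : dist x y ≤ 2 * e.1.1
    · rw [i1 hd2]
      have : |K x y - (K x y * ph e.1.1 (dist x y) - K x y * 0)| ≤ c / e.1.1 ^ n := by
        rw [show K x y - (K x y * ph e.1.1 (dist x y) - K x y * 0) = K x y * (1 - ph e.1.1 (dist x y)) by ring,
          abs_mul, abs_of_nonneg (show 0 ≤ 1 - ph e.1.1 (dist x y) by linarith [ph_le_one e.1.1 (dist x y)])]
        calc |K x y| * (1 - ph e.1.1 (dist x y)) ≤ |K x y| * 1 := by
              gcongr; linarith [ph_nonneg e.1.1 (dist x y)]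
          _ ≤ c / dist x y ^ n := by rw [mul_one]; exact hK
          _ ≤ _ := by gcongr
      linarith
    · rw [ph_one h1 (by linarith)]
      simp only [mul_one, mul_zero, sub_zero, sub_self, abs_zero]
      linarith
  · push Not at hb
    have : kr K e x y = 0 := by simp [kr, indicator, not_lt.2 hb]
    rw [this]
    by_cases hd2 : dist x y ≤ 2 * e.1.2
    · rw [i2 hd2, kk, Ke, Ke]
      have hK2 : |K x y| ≤ c / e.1.2 ^ n := hK.trans (by gcongr)
      by_cases hd3 : dist x y ≤ 2 * e.1.1
      · rw [i1 hd3]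
        have p1 := ph_nonneg e.1.1 (dist x y)
        have p2 := ph_le_one e.1.1 (dist x y)
        have p3 := ph_nonneg e.1.2 (dist x y)
        have p4 := ph_le_one e.1.2 (dist x y)
        have : |0 - (K x y * ph e.1.1 (dist x y) - K x y * ph e.1.2 (dist x y))| ≤ c / e.1.2 ^ n := by
          rw [show 0 - (K x y * ph e.1.1 (dist x y) - K x y * ph e.1.2 (dist x y)) = K x y * (ph e.1.2 (dist x y) - ph e.1.1 (dist x y)) by ring,
            abs_mul]
          calc |K x y| * |ph e.1.2 (dist x y) - ph e.1.1 (dist x y)| ≤ |K x y| * 1 := by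
                gcongr; rw [abs_le]; constructor <;> linarith
            _ ≤ _ := by rw [mul_one]; exact hK2
        have : 0 ≤ c / e.1.1 ^ n := by positivity
        linarith
      · rw [ph_one h1 (by linarith)]
        have p3 := ph_nonneg e.1.2 (dist x y)
        have p4 := ph_le_one e.1.2 (dist x y)
        have : |0 - (K x y * 1 - K x y * ph e.1.2 (dist x y))| ≤ c / e.1.2 ^ n := by
          rw [show 0 - (K x y * 1 - K x y * ph e.1.2 (dist x y)) = K x y * (ph e.1.2 (dist x y) - 1) by ring,
            abs_mul]
          calc |K x y| * |ph e.1.2 (dist x y) - 1| ≤ |K x y| * 1 := by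
                gcongr; rw [abs_le]; constructor <;> linarith
            _ ≤ _ := by rw [mul_one]; exact hK2
        linarith
    · rw [kk_zero e (by linarith)]
      simp only [sub_self, abs_zero]
      linarith

lemma ball_term {h : Rn n → ℝ≥0∞} (hc : 0 < c) (x : Rn n) {r : ℝ} (hr : 0 < r) :
    ∫⁻ y, ENNReal.ofReal ((closedBall x (2 * r)).indicator (fun _ => c / r ^ n) y) * h y ≤
      ENNReal.ofReal (c * 2 ^ n) * vB n * Mc h x := by
  have e : (fun y => ENNReal.ofReal ((closedBall x (2 * r)).indicator (fun _ => c / r ^ n) y) * h y) =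
      (closedBall x (2 * r)).indicator fun y => ENNReal.ofReal (c / r ^ n) * h y := by
    ext y
    simp only [indicator]
    split_ifs <;> simp
  rw [e, lintegral_indicator isClosed_closedBall.measurableSet, lintegral_const_mul' _ _ (by simp)]
  calc _ ≤ ENNReal.ofReal (c / r ^ n) * (volume (closedBall x (2 * r)) * Mc h x) := by
        gcongr; exact lint_le_Mc h x (by linarith)
    _ = _ := by
        rw [vol_cball x (by linarith), ← mul_assoc, ← mul_assoc, ← ENNReal.ofReal_mul (by positivity)]
        congr 3
        rw [mul_pow]
        field_simp

lemma Rr_sub_Ff (hT : IsCZO n T K c δ) {f : Rn n → ℝ} (hfm : Measurable f) (hf : LocallyIntegrable f) (e : TI) (x : Rn n) :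
    ‖Rr K f e x - Ff K f e x‖ₑ ≤ 2 * (ENNReal.ofReal (c * 2 ^ n) * vB n) * Mc (fun y => ‖f y‖ₑ) x := by
  have hc := hT.c_pos
  rw [Rr_eq, Ff, ← integral_sub (kr_integrable hT e x hf) (kk_integrable hT e x hf)]
  refine (enorm_integral_le_lintegral_enorm _).trans ?_
  have h1 := e.2.1
  have h2 := e.pos2
  calc _ ≤ ∫⁻ y, (ENNReal.ofReal ((closedBall x (2 * e.1.1)).indicator (fun _ => c / e.1.1 ^ n) y) * ‖f y‖ₑ +
        ENNReal.ofReal ((closedBall x (2 * e.1.2)).indicator (fun _ => c / e.1.2 ^ n) y) * ‖f y‖ₑ) := by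
        refine lintegral_mono fun y => ?_
        rw [← sub_mul, enorm_mul, ← add_mul]
        gcongr
        rw [Real.enorm_eq_ofReal_abs, ← ENNReal.ofReal_add (indicator_nonneg (fun _ _ => by positivity) _)
          (indicator_nonneg (fun _ _ => by positivity) _)]
        exact ENNReal.ofReal_le_ofReal (kr_sub_kk hT e x y)
    _ ≤ _ := by
        rw [lintegral_add_left]
        · have a1 := ball_term (c := c) (h := fun y => ‖f y‖ₑ) hc x h1
          have a2 := ball_term (c := c) (h := fun y => ‖f y‖ₑ) hc x h2
          refine (add_le_add a1 a2).trans (le_of_eq ?_)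
          ring
        · exact ((measurable_const.indicator isClosed_closedBall.measurableSet).ennreal_ofReal).mul hfm.enorm

lemma Mc_le_hl (h : Rn n → ℝ≥0∞) (x : Rn n) : Mc h x ≤ 3 ^ n * (vB n)⁻¹ * hlMax h x := by
  refine iSup₂_le fun r hr => ?_
  set Q : Cube n := ⟨fun i => x i - 3 / 2 * r, 3 * r, by linarith⟩ with hQ
  have hsub : closedBall x r ⊆ Q.toSet := by
    intro y hy i
    have h1 := coord_le_dist x y i
    rw [mem_closedBall, dist_comm] at hy
    have h2 := abs_le.1 (h1.trans hy)
    simp only [hQ]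
    constructor <;> linarith [h2.1, h2.2]
  have hx : x ∈ Q.toSet := hsub (mem_closedBall_self hr.le)
  have hle : avgE Q.toSet h ≤ hlMax h x := le_iSup₂_of_le Q hx le_rfl
  have hrn : ENNReal.ofReal (r ^ n) ≠ 0 := by
    rw [Ne, ENNReal.ofReal_eq_zero, not_le]; positivity
  calc (volume (closedBall x r))⁻¹ * ∫⁻ y in closedBall x r, h y
      ≤ (volume (closedBall x r))⁻¹ * ∫⁻ y in Q.toSet, h y := by
        gcongr
    _ = (volume (closedBall x r))⁻¹ * (volume Q.toSet * avgE Q.toSet h) := by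
        rw [avgE, ← mul_assoc (volume Q.toSet), ENNReal.mul_inv_cancel Q.volume_ne_zero Q.volume_ne_top, one_mul]
    _ = 3 ^ n * (vB n)⁻¹ * avgE Q.toSet h := by
        rw [vol_cball x hr.le, Q.volume_eq, ← mul_assoc]
        congr 1
        simp only [hQ]
        rw [mul_pow, ENNReal.ofReal_mul (by positivity), ENNReal.mul_inv (Or.inl hrn) (Or.inl (by simp)),
          ENNReal.ofReal_pow (by norm_num : (0 : ℝ) ≤ 3)]
        rw [show (ENNReal.ofReal (r ^ n))⁻¹ * (vB n)⁻¹ * (ENNReal.ofReal 3 ^ n * ENNReal.ofReal (r ^ n)) =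
          ((ENNReal.ofReal (r ^ n))⁻¹ * ENNReal.ofReal (r ^ n)) * (ENNReal.ofReal 3 ^ n * (vB n)⁻¹) by ring,
          ENNReal.inv_mul_cancel hrn (by simp), one_mul]
        simp
    _ ≤ _ := by gcongr

lemma Mc_local (h : Rn n → ℝ≥0∞) (Q : Cube n) {m0 : ℕ} (hm0 : (2 : ℝ) * n ≤ (2 ^ m0 - 1) / 2)
    {x y : Rn n} (hx : x ∈ Q.toSet) (hy : y ∈ Q.toSet) :
    Mc h y ≤ Mc ((Q.dilatePow m0).toSet.indicator h) y + 2 ^ n * Mc h x := by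
  have hs := Q.side_pos
  refine iSup₂_le fun r hr => ?_
  by_cases hr2 : r < (2 ^ m0 - 1) / 2 * Q.side
  · refine le_trans ?_ le_self_add
    refine le_iSup₂_of_le r hr ?_
    refine mul_le_mul_right ?_ _
    refine le_of_eq (setLIntegral_congr_fun isClosed_closedBall.measurableSet fun z hz => ?_)
    rw [indicator_of_mem]
    refine Q.ball_subset_dilate m0 hy (lt_of_le_of_lt ?_ hr2)
    rwa [mem_closedBall, dist_comm] at hz
  · refine le_trans ?_ le_add_self
    have hd := Q.dist_le hy hx
    have hdr : dist y x ≤ r := by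
      have : (2 : ℝ) * n * Q.side ≤ r := (mul_le_mul_of_nonneg_right hm0 hs.le).trans (not_lt.1 hr2)
      have : 0 ≤ (n : ℝ) * Q.side := by positivity
      linarith
    have hsub : closedBall y r ⊆ closedBall x (2 * r) := closedBall_subset_closedBall' (by linarith)
    have hrn : volume (closedBall y r) ≠ 0 := (measure_closedBall_pos volume _ hr).ne'
    have hrt : volume (closedBall y r) ≠ ∞ := measure_closedBall_lt_top.ne
    calc (volume (closedBall y r))⁻¹ * ∫⁻ y in closedBall y r, h y
        ≤ (volume (closedBall y r))⁻¹ * ∫⁻ y in closedBall x (2 * r), h y := by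
          gcongr
      _ ≤ (volume (closedBall y r))⁻¹ * (volume (closedBall x (2 * r)) * Mc h x) := by
          gcongr; exact lint_le_Mc h x (by linarith)
      _ = (volume (closedBall y r))⁻¹ * volume (closedBall y r) * (2 ^ n * Mc h x) := by
          rw [vol_cball x (by linarith), vol_cball y hr.le, mul_pow, ENNReal.ofReal_mul (by positivity),
            ENNReal.ofReal_pow (by norm_num : (0 : ℝ) ≤ 2)]
          simp only [ENNReal.ofReal_ofNat]
          ring
      _ = _ := by rw [ENNReal.inv_mul_cancel hrn hrt, one_mul]

end SparseCZ

namespace SparseCZ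
open Metric
variable {n : ℕ} {T : (Rn n → ℝ) → Rn n → ℝ} {K : Rn n → Rn n → ℝ} {c δ : ℝ}

/-- rational truncation parameters -/
abbrev QI := {q : ℚ × ℚ // 0 < q.1 ∧ q.1 < q.2}

/-- rational parameters as real ones -/
def QI.toTI (q : QI) : TI := ⟨((q.1.1 : ℝ), (q.1.2 : ℝ)), Rat.cast_pos.2 q.2.1, Rat.cast_lt.2 q.2.2⟩

lemma Rr_meas (hT : IsCZO n T K c δ) {f : Rn n → ℝ} (hfm : Measurable f) (e : TI) :
    Measurable (Rr K f e) := by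
  have h1 : Measurable fun p : Rn n × Rn n => kr K e p.1 p.2 * f p.2 := by
    have hd : Measurable fun p : Rn n × Rn n => dist p.1 p.2 := by fun_prop
    have hs : MeasurableSet {p : Rn n × Rn n | e.1.1 < dist p.1 p.2 ∧ dist p.1 p.2 < e.1.2} :=
      (measurableSet_lt measurable_const hd).inter (measurableSet_lt hd measurable_const)
    have h2 := (K0_meas hT).indicator hs
    have h3 : (fun p : Rn n × Rn n => kr K e p.1 p.2) =
        {p : Rn n × Rn n | e.1.1 < dist p.1 p.2 ∧ dist p.1 p.2 < e.1.2}.indicator (Function.uncurry (K0 K)) := by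
      ext p
      simp only [kr, indicator, mem_ofPred_eq, Function.uncurry]
    rw [← h3] at h2
    exact h2.mul (hfm.comp measurable_snd)
  have h4 := h1.stronglyMeasurable.integral_prod_right' (ν := volume)
  have : Rr K f e = fun x => ∫ y, kr K e x y * f y := funext fun x => Rr_eq e f x
  rw [this]
  exact h4.measurable

lemma Rr_approx (hT : IsCZO n T K c δ) {f : Rn n → ℝ} (hf : LocallyIntegrable f)
    (x : Rn n) {B : ℝ} (hB : ∀ q : QI, |Rr K f q.toTI x| ≤ B) (e : TI) : |Rr K f e x| ≤ B := by
  have h1 := e.2.1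
  have h12 := e.2.2
  obtain ⟨a, _, ha, hat⟩ := Real.exists_seq_rat_strictAnti_tendsto e.1.1
  obtain ⟨b, _, hb, hbt⟩ := Real.exists_seq_rat_strictMono_tendsto e.1.2
  set G : ℕ → ℝ := fun k => ∫ y, {y | (a k : ℝ) < dist x y ∧ dist x y < b k}.indicator (K0 K x) y * f y with hG
  have hlim : Tendsto G atTop (𝓝 (Rr K f e x)) := by
    rw [Rr_eq]
    have hi := kr_integrable hT e x hf
    refine tendsto_integral_of_dominated_convergence (fun y => |kr K e x y * f y|) ?_ hi.abs ?_ ?_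
    · intro k
      exact ((K0_meas_right hT x).indicator (ann_meas _ _ _)).aestronglyMeasurable.mul hf.aestronglyMeasurable
    · intro k
      refine Eventually.of_forall fun y => ?_
      rw [Real.norm_eq_abs, abs_mul, abs_mul]
      refine mul_le_mul_of_nonneg_right ?_ (abs_nonneg _)
      simp only [kr, indicator, mem_ofPred_eq]
      by_cases h : (a k : ℝ) < dist x y ∧ dist x y < b k
      · rw [if_pos h, if_pos ⟨(ha k).trans h.1, h.2.trans (hb k)⟩]
      · rw [if_neg h, abs_zero]; exact abs_nonneg _
    · refine Eventually.of_forall fun y => ?_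
      refine Tendsto.mul_const _ ?_
      apply tendsto_const_nhds.congr'
      by_cases h : e.1.1 < dist x y ∧ dist x y < e.1.2
      · filter_upwards [hat.eventually (gt_mem_nhds h.1), hbt.eventually (lt_mem_nhds h.2)] with k h3 h4
        simp only [kr, indicator, mem_ofPred_eq]
        rw [if_pos h, if_pos ⟨h3, h4⟩]
      · refine Eventually.of_forall fun k => ?_
        simp only [kr, indicator, mem_ofPred_eq]
        rw [if_neg h, if_neg fun h' => h ⟨(ha k).trans h'.1, h'.2.trans (hb k)⟩]
  refine le_of_tendsto hlim.abs ?_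
  have hm1 : e.1.1 < (e.1.1 + e.1.2) / 2 := by linarith
  have hm2 : (e.1.1 + e.1.2) / 2 < e.1.2 := by linarith
  filter_upwards [hat.eventually (gt_mem_nhds hm1), hbt.eventually (lt_mem_nhds hm2)] with k h3 h4
  have q1 : (0 : ℚ) < a k := by exact_mod_cast h1.trans (ha k)
  have q2 : a k < b k := by exact_mod_cast h3.trans h4
  have := hB ⟨(a k, b k), q1, q2⟩
  rw [Rr_eq] at this
  exact this

lemma maxTrunc_meas (hT : IsCZO n T K c δ) {f : Rn n → ℝ} (hfm : Measurable f) (hf : LocallyIntegrable f) :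
    Measurable (maxTrunc K f) := by
  have hn : Nonempty QI := ⟨⟨(1, 2), by norm_num, by norm_num⟩⟩
  have hn' : Nonempty TI := ⟨⟨(1, 2), by norm_num, by norm_num⟩⟩
  have e : maxTrunc K f = fun x => ⨆ q : QI, |Rr K f q.toTI x| := by
    ext x
    have e0 : maxTrunc K f x = ⨆ e : TI, |Rr K f e x| := rfl
    rw [e0]
    by_cases hb : BddAbove (range fun q : QI => |Rr K f q.toTI x|)
    · have h1 : ∀ e, |Rr K f e x| ≤ ⨆ q : QI, |Rr K f q.toTI x| :=
        Rr_approx hT hf x fun q => le_ciSup hb q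
      refine le_antisymm (ciSup_le h1) (ciSup_le fun q => ?_)
      refine le_ciSup (f := fun e : TI => |Rr K f e x|) ⟨⨆ q : QI, |Rr K f q.toTI x|, ?_⟩ q.toTI
      rintro _ ⟨e, rfl⟩
      exact h1 e
    · rw [Real.iSup_of_not_bddAbove hb, Real.iSup_of_not_bddAbove]
      rintro ⟨B, hB⟩
      refine hb ⟨B, ?_⟩
      rintro _ ⟨q, rfl⟩
      exact hB ⟨q.toTI, rfl⟩
  rw [e]
  exact Measurable.iSup fun q => (Rr_meas hT hfm q.toTI).abs

/-- local constant -/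
def NQ (K : Rn n → Rn n → ℝ) (f : Rn n → ℝ) (m0 : ℕ) (Q : Cube n) : ℝ := ⨆ e : TI, |cQ K f m0 Q e|

lemma maxTrunc_sub (hT : IsCZO n T K c δ) {f : Rn n → ℝ} (hfm : Measurable f) (hf : LocallyIntegrable f)
    (m0 : ℕ) (Q : Cube n) (x : Rn n) :
    ENNReal.ofReal |maxTrunc K f x - NQ K f m0 Q| ≤
      2 * (ENNReal.ofReal (c * 2 ^ n) * vB n) * Mc (fun y => ‖f y‖ₑ) x +
        ⨆ e : TI, ‖Ff K f e x - cQ K f m0 Q e‖ₑ := by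
  have hn' : Nonempty TI := ⟨⟨(1, 2), by norm_num, by norm_num⟩⟩
  have h := sup_diff (fun e : TI => Rr K f e x) (fun e => cQ K f m0 Q e)
  refine le_trans h (iSup_le fun e => ?_)
  calc ‖Rr K f e x - cQ K f m0 Q e‖ₑ = ‖(Rr K f e x - Ff K f e x) + (Ff K f e x - cQ K f m0 Q e)‖ₑ := by
        congr 1; ring
    _ ≤ ‖Rr K f e x - Ff K f e x‖ₑ + ‖Ff K f e x - cQ K f m0 Q e‖ₑ := enorm_add_le _ _
    _ ≤ _ := add_le_add (Rr_sub_Ff hT hfm hf e x) (le_iSup (fun e : TI => ‖Ff K f e x - cQ K f m0 Q e‖ₑ) e)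

/-- constant in the weak bound -/
def LQ (n m0 : ℕ) (δ : ℝ) : ℝ≥0∞ := 8 * 5 ^ n * (2 ^ (m0 * n) * ENNReal.ofReal ((2 : ℝ) ^ ((m0 : ℝ) * δ)))

lemma LQ_top (n m0 : ℕ) (δ : ℝ) : LQ n m0 δ ≠ ∞ := by unfold LQ; finiteness

lemma Mc_zero {h : Rn n → ℝ≥0∞} (hh : ∫⁻ y, h y = 0) (x : Rn n) : Mc h x = 0 := by
  simp only [Mc, ENNReal.iSup_eq_zero]
  intro r _
  have : ∫⁻ y in closedBall x r, h y = 0 :=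
    le_antisymm ((setLIntegral_le_lintegral _ _).trans hh.le) bot_le
  rw [this, mul_zero]

lemma Mc_bad [NeZero n] (h : Rn n → ℝ≥0∞) (Q : Cube n) (m0 : ℕ) (ha : aQ δ h Q ≠ ∞) :
    volume {y | LQ n m0 δ * aQ δ h Q < Mc ((Q.dilatePow m0).toSet.indicator h) y} ≤ volume Q.toSet / 8 := by
  have hI : ∫⁻ y, (Q.dilatePow m0).toSet.indicator h y = ∫⁻ y in (Q.dilatePow m0).toSet, h y :=
    lintegral_indicator (Q.dilatePow m0).measurableSet _
  have h1 := lint_le_aQ δ h Q m0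
  by_cases ha0 : aQ δ h Q = 0
  · rw [ha0, mul_zero] at h1
    have h2 : ∫⁻ y, (Q.dilatePow m0).toSet.indicator h y = 0 := by rw [hI]; exact le_antisymm h1 bot_le
    simp [Mc_zero h2]
  have hw := Mc_weak ((Q.dilatePow m0).toSet.indicator h) (LQ n m0 δ * aQ δ h Q)
  rw [hI] at hw
  set V := volume {y | LQ n m0 δ * aQ δ h Q < Mc ((Q.dilatePow m0).toSet.indicator h) y}
  have h3 := hw.trans (mul_le_mul_right h1 _)
  set p : ℝ≥0∞ := 5 ^ n * (2 ^ (m0 * n) * ENNReal.ofReal ((2 : ℝ) ^ ((m0 : ℝ) * δ))) * aQ δ h Q with hp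
  have hp0 : p ≠ 0 := by
    have : ENNReal.ofReal ((2 : ℝ) ^ ((m0 : ℝ) * δ)) ≠ 0 := by
      rw [Ne, ENNReal.ofReal_eq_zero, not_le]; positivity
    simp [hp, ha0, this]
  have hpt : p ≠ ∞ := by simp only [hp]; finiteness
  have h4 : p * (V * 8) ≤ p * volume Q.toSet := by
    calc p * (V * 8) = LQ n m0 δ * aQ δ h Q * V := by rw [hp, LQ]; ring
      _ ≤ _ := h3
      _ = _ := by rw [hp]; ring
  rw [ENNReal.mul_le_mul_iff_right hp0 hpt] at h4
  exact (ENNReal.le_div_iff_mul_le (by simp) (by simp)).2 h4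

lemma sum_conv (S : Set (Cube n)) (h : Rn n → ℝ≥0∞) (C : ℝ≥0∞) (x : Rn n) :
    ∑' Q : S, Q.1.toSet.indicator (fun _ => C * aQ δ h Q.1) x =
      C * ∑' m : ℕ, ENNReal.ofReal ((2 : ℝ) ^ (-(m : ℝ) * δ)) * sparseOpShift S m h x := by
  simp only [sparseOpShift, ← ENNReal.tsum_mul_left]
  rw [ENNReal.tsum_comm]
  congr 1
  ext Q
  by_cases hx : x ∈ Q.1.toSet
  · simp [hx, aQ, ENNReal.tsum_mul_left]
  · simp [hx]

end SparseCZ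

namespace SparseCZ
open Metric
variable {n : ℕ} {T : (Rn n → ℝ) → Rn n → ℝ} {K : Rn n → Rn n → ℝ} {c δ : ℝ}

lemma median_bd [NeZero n] (hT : IsCZO n T K c δ) {f : Rn n → ℝ} (hfm : Measurable f)
    (hf : LocallyIntegrable f) {m0 : ℕ} (hm0 : (2 : ℝ) * n ≤ (2 ^ m0 - 1) / 2) (Q : Cube n) {C5 : ℝ≥0∞} (hC5 : C5 ≠ ∞)
    (ha : aQ δ (fun y => ‖f y‖ₑ) Q ≠ ∞)
    (hE : volume {x | x ∈ Q.toSet ∧ C5 * aQ δ (fun y => ‖f y‖ₑ) Q < ⨆ e : TI, ‖Ff K f e x - cQ K f m0 Q e‖ₑ} ≤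
        8⁻¹ * volume Q.toSet) {x : Rn n} (hx : x ∈ Q.toSet) (hM : Mc (fun y => ‖f y‖ₑ) x ≠ ∞) :
    ENNReal.ofReal |median (maxTrunc K f) Q - NQ K f m0 Q| ≤
      2 * (ENNReal.ofReal (c * 2 ^ n) * vB n) * (LQ n m0 δ * aQ δ (fun y => ‖f y‖ₑ) Q + 2 ^ n * Mc (fun y => ‖f y‖ₑ) x)
        + C5 * aQ δ (fun y => ‖f y‖ₑ) Q := by
  set h : Rn n → ℝ≥0∞ := fun y => ‖f y‖ₑ with hh
  set a := aQ δ h Q with haa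
  set C1 : ℝ≥0∞ := 2 * (ENNReal.ofReal (c * 2 ^ n) * vB n) with hC1
  have hC1t : C1 ≠ ∞ := by have := vB_top n; simp only [hC1]; finiteness
  set R0 : ℝ≥0∞ := C1 * (LQ n m0 δ * a + 2 ^ n * Mc h x) + C5 * a with hR0
  have hRt : R0 ≠ ∞ := by have := LQ_top n m0 δ; simp only [hR0]; finiteness
  rw [← ENNReal.ofReal_toReal hRt]
  apply ENNReal.ofReal_le_ofReal
  refine median_mem (maxTrunc_meas hT hfm hf) Q ?_
  have hsub : {y | y ∈ Q.toSet ∧ R0.toReal < |maxTrunc K f y - NQ K f m0 Q|} ⊆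
      {y | LQ n m0 δ * a < Mc ((Q.dilatePow m0).toSet.indicator h) y} ∪
      {y | y ∈ Q.toSet ∧ C5 * a < ⨆ e : TI, ‖Ff K f e y - cQ K f m0 Q e‖ₑ} := by
    rintro y ⟨hy, hy2⟩
    by_contra hc
    simp only [mem_union, mem_ofPred_eq, not_or, not_lt, not_and] at hc
    have h1 := maxTrunc_sub hT hfm hf m0 Q y
    have h2 := Mc_local h Q hm0 hx hy
    have h3 : ENNReal.ofReal |maxTrunc K f y - NQ K f m0 Q| ≤ R0 := by
      refine h1.trans ?_
      rw [hR0]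
      gcongr
      · exact h2.trans (add_le_add hc.1 le_rfl)
      · exact hc.2 hy
    rw [ENNReal.ofReal_le_iff_le_toReal hRt] at h3
    exact absurd hy2 (not_lt.2 h3)
  have hv := Q.volume_ne_top
  have hv0 := Q.volume_ne_zero
  calc _ ≤ volume Q.toSet / 8 + 8⁻¹ * volume Q.toSet :=
        (measure_mono hsub).trans ((measure_union_le _ _).trans (add_le_add (Mc_bad h Q m0 ha) hE))
    _ = (8⁻¹ + 8⁻¹) * volume Q.toSet := by rw [div_eq_mul_inv]; ring
    _ < 2⁻¹ * volume Q.toSet := by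
        apply ENNReal.mul_lt_mul_left hv0 hv
        have e8 : (8 : ℝ≥0∞)⁻¹ = ENNReal.ofReal (1 / 8) := by
          rw [one_div, ENNReal.ofReal_inv_of_pos (by norm_num)]; simp
        have e2 : (2 : ℝ≥0∞)⁻¹ = ENNReal.ofReal (1 / 2) := by
          rw [one_div, ENNReal.ofReal_inv_of_pos (by norm_num)]; simp
        rw [e8, e2, ← ENNReal.ofReal_add (by norm_num) (by norm_num)]
        exact (ENNReal.ofReal_lt_ofReal_iff (by norm_num)).2 (by norm_num)
    _ = _ := by rw [div_eq_mul_inv, mul_comm]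

lemma main_zero (T : (Rn 0 → ℝ) → Rn 0 → ℝ) (K : Rn 0 → Rn 0 → ℝ) (f : Rn 0 → ℝ) (Q : Cube 0) (x : Rn 0) :
    maxTrunc K f x - median (maxTrunc K f) Q = 0 := by
  have h0 : maxTrunc K f = fun _ => 0 := by
    ext x
    rw [maxTrunc]
    have : ∀ e : TI, |∫ y in {y | e.1.1 < dist x y ∧ dist x y < e.1.2}, K x y * f y| = 0 := by
      intro e
      have : {y : Rn 0 | e.1.1 < dist x y ∧ dist x y < e.1.2} = ∅ := by
        ext y
        rw [Subsingleton.elim y x]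
        simp only [dist_self, mem_ofPred_eq, mem_empty_iff_false, iff_false, not_and]
        intro h
        exact absurd e.2.1 (not_lt.2 h.le)
      rw [this]; simp
    simp only [this]
    simp
  have h1 : |median (maxTrunc K f) Q - 0| ≤ 0 := by
    refine median_mem (by rw [h0]; fun_prop) Q ?_
    have : {x | x ∈ Q.toSet ∧ 0 < |maxTrunc K f x - 0|} = ∅ := by
      ext x; simp [h0]
    rw [this, measure_empty]
    exact ENNReal.half_pos Q.volume_ne_zero
  have h2 := abs_nonpos_iff.1 h1
  rw [sub_zero] at h2
  rw [h2, h0]; simp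

theorem main_pos [NeZero n] (hT : IsCZO n T K c δ) :
    ∃ C : ℝ≥0∞, C ≠ ⊤ ∧
      ∀ D : Set (Cube n), IsDyadicGrid D →
      ∀ f : Rn n → ℝ, Measurable f →
      ∀ Q₀ ∈ D, ∃ S : Set (Cube n), S ⊆ D ∧ IsSparse S ∧
        ∀ᵐ x ∂(volume.restrict Q₀.toSet),
          ENNReal.ofReal |maxTrunc K f x - median (maxTrunc K f) Q₀| ≤
            C * (hlMax (fun y => ‖f y‖ₑ) x +
              ∑' m : ℕ, ENNReal.ofReal ((2 : ℝ) ^ (-(m : ℝ) * δ)) *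
                sparseOpShift S m (fun y => ‖f y‖ₑ) x) := by
  obtain ⟨m0, hm⟩ := pow_unbounded_of_one_lt (4 * (n : ℝ) + 1) (one_lt_two (α := ℝ))
  have hm0 : (2 : ℝ) * n ≤ (2 ^ m0 - 1) / 2 := by linarith
  obtain ⟨C5, hC5, hC50, hosc⟩ := osc hT hm0 (η := (2 ^ (n + 3))⁻¹) (by simp)
  set C1 : ℝ≥0∞ := 2 * (ENNReal.ofReal (c * 2 ^ n) * vB n) with hC1
  have hvt := vB_top n
  have hvp := vB_pos n
  have hC1t : C1 ≠ ∞ := by simp only [hC1]; finiteness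
  set Cm : ℝ≥0∞ := 3 ^ n * (vB n)⁻¹ with hCm
  have hCmt : Cm ≠ ∞ := by simp only [hCm]; finiteness
  have hLt := LQ_top n m0 δ
  set C : ℝ≥0∞ := C1 * Cm + 2 * C5 + C1 * LQ n m0 δ + C1 * (2 ^ n * Cm) + C5 with hC
  have hC0 : C ≠ 0 := by simp [hC, hC50]
  refine ⟨C, by simp only [hC]; finiteness, ?_⟩
  intro D hD f hfm Q₀ hQ₀
  set h : Rn n → ℝ≥0∞ := fun y => ‖f y‖ₑ with hh
  set φ : Rn n → Cube n → ℝ≥0∞ := fun x Q => ⨆ e : TI, ‖Ff K f e x - cQ K f m0 Q e‖ₑ with hφd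
  obtain ⟨S, hSD, hSs, hQS, hS⟩ := sparse_exists hD hQ₀ φ (fun Q => C5 * aQ δ h Q) (by
    intro x y P Q
    refine iSup_le fun e => ?_
    have e1 : Ff K f e x - cQ K f m0 Q e = (Ff K f e x - cQ K f m0 P e) + -(Ff K f e y - cQ K f m0 P e)
      + (Ff K f e y - cQ K f m0 Q e) := by ring
    rw [e1]
    refine (enorm_add_le _ _).trans (add_le_add ((enorm_add_le _ _).trans (add_le_add ?_ ?_)) ?_)
    · exact le_iSup (fun e : TI => ‖Ff K f e x - cQ K f m0 P e‖ₑ) e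
    · rw [enorm_neg]; exact le_iSup (fun e : TI => ‖Ff K f e y - cQ K f m0 P e‖ₑ) e
    · exact le_iSup (fun e : TI => ‖Ff K f e y - cQ K f m0 Q e‖ₑ) e) (fun Q => hosc D hD f hfm Q)
  refine ⟨S, hSD, hSs, ?_⟩
  rw [ae_restrict_iff' Q₀.measurableSet]
  filter_upwards [hS] with x hx hxQ
  have h1 := hx hxQ
  rw [sum_conv] at h1
  set W := ∑' m : ℕ, ENNReal.ofReal ((2 : ℝ) ^ (-(m : ℝ) * δ)) * sparseOpShift S m h x with hW
  set H := hlMax h x with hH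
  set a := aQ δ h Q₀ with ha
  have haW : a ≤ W := by
    have e1 := sum_conv (δ := δ) S h 1 x
    rw [one_mul] at e1
    rw [hW, ← e1]
    refine le_trans ?_ (ENNReal.le_tsum (⟨Q₀, hQS⟩ : S))
    simp [hxQ, ha]
  by_cases hHt : H = ∞
  · rw [hHt, top_add, ENNReal.mul_top hC0]; exact le_top
  by_cases hat : a = ∞
  · rw [hat, top_le_iff] at haW
    rw [haW, add_top, ENNReal.mul_top hC0]; exact le_top
  have hMH : Mc h x ≤ Cm * H := Mc_le_hl h x
  have hMt : Mc h x ≠ ∞ := ne_top_of_le_ne_top (by finiteness) hMH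
  have hf := locInt_of_aQ hfm Q₀ hat
  have h2 := maxTrunc_sub hT hfm hf m0 Q₀ x
  have h3 := median_bd hT hfm hf hm0 Q₀ hC5 hat ((hosc D hD f hfm Q₀).trans (by
    gcongr
    calc (8 : ℝ≥0∞) = 2 ^ 3 := by norm_num
      _ ≤ 2 ^ (n + 3) := pow_le_pow_right₀ (by norm_num) (by omega))) hxQ hMt
  have h4 : ENNReal.ofReal |maxTrunc K f x - median (maxTrunc K f) Q₀| ≤
      ENNReal.ofReal |maxTrunc K f x - NQ K f m0 Q₀| + ENNReal.ofReal |median (maxTrunc K f) Q₀ - NQ K f m0 Q₀| := by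
    rw [← ENNReal.ofReal_add (abs_nonneg _) (abs_nonneg _)]
    apply ENNReal.ofReal_le_ofReal
    rw [abs_sub_comm (median (maxTrunc K f) Q₀)]
    exact abs_sub_le _ _ _
  calc _ ≤ _ := h4
    _ ≤ (C1 * (Cm * H) + 2 * (C5 * W)) + (C1 * (LQ n m0 δ * W + 2 ^ n * (Cm * H)) + C5 * W) := by
        refine add_le_add (h2.trans (add_le_add ?_ h1)) (h3.trans ?_)
        · gcongr
        · gcongr
    _ = (C1 * Cm + C1 * (2 ^ n * Cm)) * H + (2 * C5 + C1 * LQ n m0 δ + C5) * W := by ring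
    _ ≤ C * H + C * W := by
        gcongr ?_ * _ + ?_ * _
        · rw [hC, show C1 * Cm + 2 * C5 + C1 * LQ n m0 δ + C1 * (2 ^ n * Cm) + C5 =
            (C1 * Cm + C1 * (2 ^ n * Cm)) + (2 * C5 + C1 * LQ n m0 δ + C5) by ring]
          exact le_self_add
        · rw [hC, show C1 * Cm + 2 * C5 + C1 * LQ n m0 δ + C1 * (2 ^ n * Cm) + C5 =
            (C1 * Cm + C1 * (2 ^ n * Cm)) + (2 * C5 + C1 * LQ n m0 δ + C5) by ring]
          exact le_add_self
    _ = C * (H + W) := by ring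

end SparseCZ

open SparseCZ in
/-- pointwise sparse domination of the maximal truncated CZO. -/
theorem stmt0 (n : ℕ) (T : (Rn n → ℝ) → Rn n → ℝ) (K : Rn n → Rn n → ℝ) (c δ : ℝ)
    (hT : IsCZO n T K c δ) :
    ∃ C : ℝ≥0∞, C ≠ ⊤ ∧
      ∀ D : Set (Cube n), IsDyadicGrid D →
      ∀ f : Rn n → ℝ, Measurable f →
      ∀ Q₀ ∈ D, ∃ S : Set (Cube n), S ⊆ D ∧ IsSparse S ∧
        ∀ᵐ x ∂(volume.restrict Q₀.toSet),
          ENNReal.ofReal |maxTrunc K f x - median (maxTrunc K f) Q₀| ≤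
            C * (hlMax (fun y => ENNReal.ofReal |f y|) x +
              ∑' m : ℕ, ENNReal.ofReal ((2 : ℝ) ^ (-(m : ℝ) * δ)) *
                sparseOpShift S m (fun y => ENNReal.ofReal |f y|) x) := by
  rcases Nat.eq_zero_or_pos n with hn | hn
  · subst hn
    refine ⟨1, by simp, fun D hD f hf Q₀ hQ₀ => ⟨∅, empty_subset _, fun Q hQ => absurd hQ (by simp), ?_⟩⟩
    refine Eventually.of_forall fun x => ?_
    rw [main_zero T K f Q₀ x]
    simp
  · have : NeZero n := ⟨hn.ne'⟩
    have h := main_pos hT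
    simp only [Real.enorm_eq_ofReal_abs] at h
    exact h
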